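/- arXiv:1903.01266 — 5 statements merged into one kernel-verified Lean document; each statement's English description precedes it below -/
import Mathlib

section
/- Let γ > 0, let n ≥ 1 and let τ₁, …, τₙ > 0 and ω > 0. Let f : ℝⁿ → ℝ be locally Lipschitz continuous, and let g : ℝ × [0,1] → ℝ be Hölder continuous with g(t+ω, x) = g(t, x) for all t, x. Assume (H3): there exist constants β₁, …, βₙ > 0 such that |f(ξ₁,…,ξₙ) − f(η₁,…,ηₙ)| ≤ Σ_{k=1}^n βₖ|ξₖ − ηₖ| for all (ξ₁,…,ξₙ), (η₁,…,ηₙ) ∈ ℝⁿ; and (H2): Σ_{k=1}^n βₖ < γπ⁴ + π² − 1. Then there exists exactly one time ω-periodic classical solution u of the extended Fisher–Kolmogorov equation with delays: ∂ₜu + γ ∂ₓ⁴u − ∂ₓ²u − u = g(t,x) + f(u(t−τ₁,x), …, u(t−τₙ,x)) on ℝ × (0,1), with u(t,0) = u(t,1) = 0 and ∂ₓ²u(t,0) = ∂ₓ²u(t,1) = 0 for all t ∈ ℝ. -/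
open Real Set Filter Topology

/-- Time partial derivative of `u : ℝ → ℝ → ℝ` (first variable = time). -/
noncomputable def dt (u : ℝ → ℝ → ℝ) (t x : ℝ) : ℝ := deriv (fun s => u s x) t

/-- `k`-th spatial partial derivative of `u : ℝ → ℝ → ℝ` (second variable = space). -/
noncomputable def dx (k : ℕ) (u : ℝ → ℝ → ℝ) (t x : ℝ) : ℝ := iteratedDeriv k (u t) x

/-- `u` is a time `ω`-periodic classical solution of the delayed extended
Fisher–Kolmogorov equation
`∂ₜu + γ ∂ₓ⁴u − ∂ₓ²u − u = g(t,x) + f(u(t−τ₁,x),…,u(t−τₙ,x))` on `ℝ × (0,1)`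
with Navier boundary conditions. -/
def IsPeriodicClassicalSolution (γ ω : ℝ) {n : ℕ} (τ : Fin n → ℝ)
    (f : (Fin n → ℝ) → ℝ) (g : ℝ → ℝ → ℝ) (u : ℝ → ℝ → ℝ) : Prop :=
  ContinuousOn (fun p : ℝ × ℝ => u p.1 p.2) (univ ×ˢ Icc 0 1) ∧
  (∀ t x, u (t + ω) x = u t x) ∧
  (∀ t : ℝ, ∀ x ∈ Ioo (0:ℝ) 1, DifferentiableAt ℝ (fun s => u s x) t) ∧
  (∀ t : ℝ, ∀ x ∈ Ioo (0:ℝ) 1, ∀ k < 4, DifferentiableAt ℝ (iteratedDeriv k (u t)) x) ∧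
  ContinuousOn (fun p : ℝ × ℝ => dt u p.1 p.2) (univ ×ˢ Ioo 0 1) ∧
  (∀ k ≤ 4, ContinuousOn (fun p : ℝ × ℝ => dx k u p.1 p.2) (univ ×ˢ Ioo 0 1)) ∧
  ContinuousOn (fun p : ℝ × ℝ => dx 2 u p.1 p.2) (univ ×ˢ Icc 0 1) ∧
  (∀ t : ℝ, ∀ x ∈ Ioo (0:ℝ) 1,
    dt u t x + γ * dx 4 u t x - dx 2 u t x - u t x
      = g t x + f (fun k => u (t - τ k) x)) ∧
  (∀ t : ℝ, u t 0 = 0 ∧ u t 1 = 0 ∧ dx 2 u t 0 = 0 ∧ dx 2 u t 1 = 0)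

open MeasureTheory

/-- The wave number of the `k`-th Dirichlet eigenfunction on `(0,1)`. -/
noncomputable def waveNumber (k : ℕ) : ℝ := (k + 1) * π

/-- The `k`-th sine coefficient of a function on `[0,1]`. -/
noncomputable def sineCoeff (b : ℝ → ℝ) (k : ℕ) : ℝ :=
  ∫ x in (0:ℝ)..1, b x * sin (waveNumber k * x)

lemma waveNumber_pos (k : ℕ) : 0 < waveNumber k := by
  unfold waveNumber; positivity

/-- The odd extension across the origin, with complex values. -/
noncomputable def oddExtension (b : ℝ → ℝ) (x : ℝ) : ℂ :=
  if 0 ≤ x then (b x : ℂ) else -(b (-x) : ℂ)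

lemma measurable_oddExtension {b : ℝ → ℝ} (hb : Continuous b) : Measurable (oddExtension b) := by
  unfold oddExtension
  refine Measurable.ite measurableSet_Ici ?_ ?_
  · fun_prop
  · fun_prop

lemma norm_oddExtension (b : ℝ → ℝ) (x : ℝ) : ‖oddExtension b x‖ = |b (|x|)| := by
  unfold oddExtension
  split_ifs with h
  · simp [abs_of_nonneg h]
  · rw [abs_of_neg (not_le.1 h)]; simp

lemma memLp_oddExtension {b : ℝ → ℝ} (hb : Continuous b) :
    MemLp (oddExtension b) 2 (volume.restrict (Ioc (-1) 1)) := by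
  obtain ⟨C, hC⟩ := (isCompact_Icc (a := (0:ℝ)) (b := 1)).exists_bound_of_continuousOn
    hb.continuousOn
  refine MemLp.of_bound (measurable_oddExtension hb).aestronglyMeasurable C ?_
  rw [ae_restrict_iff' measurableSet_Ioc]
  refine .of_forall fun x hx => ?_
  rw [norm_oddExtension]
  exact hC _ ⟨abs_nonneg _, abs_le.2 ⟨hx.1.le, hx.2⟩⟩

lemma intervalIntegral_symm_eq {E : Type*} [NormedAddCommGroup E] [NormedSpace ℝ E] {f : ℝ → E}
    (hf : IntervalIntegrable f volume (-1) 1) :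
    ∫ x in (-1:ℝ)..1, f x = ∫ x in (0:ℝ)..1, (f (-x) + f x) := by
  have h1 : IntervalIntegrable f volume (-1) 0 :=
    hf.mono_set (by rw [uIcc_of_le (by norm_num), uIcc_of_le (by norm_num)]
                    exact Icc_subset_Icc le_rfl (by norm_num))
  have h2 : IntervalIntegrable f volume 0 1 :=
    hf.mono_set (by rw [uIcc_of_le (by norm_num), uIcc_of_le (by norm_num)]
                    exact Icc_subset_Icc (by norm_num) le_rfl)
  have h3 : ∫ x in (0:ℝ)..1, f (-x) = ∫ x in (-1:ℝ)..0, f x := by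
    rw [intervalIntegral.integral_comp_neg]; simp
  have h4 : IntervalIntegrable (fun x => f (-x)) volume 0 1 := by
    simpa using h1.symm.comp_sub_left 0
  rw [intervalIntegral.integral_add h4 h2, h3,
    intervalIntegral.integral_add_adjacent_intervals h1 h2]

lemma norm_sq_fourierCoeffOn_oddExtension {b : ℝ → ℝ} (hb : Continuous b) (n : ℤ) :
    ‖fourierCoeffOn (show (-1:ℝ) < 1 by norm_num) (oddExtension b) n‖ ^ 2
      = (∫ x in (0:ℝ)..1, b x * sin (n * π * x)) ^ 2 := by
  have hi : IntervalIntegrable (fun x : ℝ =>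
      (fourier (-n) (x : AddCircle ((1:ℝ) - (-1)))) • oddExtension b x) volume (-1) 1 := by
    rw [intervalIntegrable_iff_integrableOn_Ioc_of_le (by norm_num)]
    have := (memLp_oddExtension hb).integrable (by norm_num)
    refine this.bdd_mul (c := 1) ?_ ?_
    · refine Continuous.aestronglyMeasurable ?_
      exact (fourier (-n)).continuous.comp (AddCircle.continuous_mk' _)
    · refine .of_forall fun x => ?_
      rw [fourier_apply]
      exact (Circle.norm_coe _).le
  rw [fourierCoeffOn_eq_integral, intervalIntegral_symm_eq hi]
  have h : ∫ x in (0:ℝ)..1, ((fourier (-n) ((-x : ℝ) : AddCircle ((1:ℝ) - (-1))))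
        • oddExtension b (-x)
      + (fourier (-n) (x : AddCircle ((1:ℝ) - (-1)))) • oddExtension b x)
      = ∫ x in (0:ℝ)..1, (-2 * Complex.I) * ((b x * sin (n * π * x) : ℝ) : ℂ) := by
    rw [intervalIntegral.integral_of_le (by norm_num),
      intervalIntegral.integral_of_le (by norm_num)]
    refine setIntegral_congr_fun measurableSet_Ioc fun x hx => ?_
    have e1 : oddExtension b (-x) = -(b x : ℂ) := by
      unfold oddExtension; rw [if_neg (by linarith [hx.1]), neg_neg]
    have e2 : oddExtension b x = (b x : ℂ) := by
      unfold oddExtension; rw [if_pos hx.1.le]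
    simp only [e1, e2, fourier_coe_apply, smul_eq_mul]
    push_cast
    have a1 : 2 * (π:ℂ) * Complex.I * (-(n:ℂ)) * (-(x:ℂ)) / (1 - -1)
        = ((n:ℂ) * π * x) * Complex.I := by
      ring
    have a2 : 2 * (π:ℂ) * Complex.I * (-(n:ℂ)) * (x:ℂ) / (1 - -1)
        = (-((n:ℂ) * π * x)) * Complex.I := by
      ring
    rw [a1, a2, Complex.exp_mul_I, Complex.exp_mul_I, Complex.cos_neg, Complex.sin_neg]
    ring
  rw [h, intervalIntegral.integral_const_mul, intervalIntegral.integral_ofReal, norm_smul, norm_mul,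
    Complex.norm_real]
  simp only [norm_mul, norm_neg, Complex.norm_I, Real.norm_eq_abs]
  rw [mul_pow, mul_pow, sq_abs, sq_abs]
  norm_num
  ring

/-- Parseval's identity for sine series on `[0,1]`. -/
lemma hasSum_sq_sineCoeff {b : ℝ → ℝ} (hb : Continuous b) :
    HasSum (fun k => 2 * sineCoeff b k ^ 2) (∫ x in (0:ℝ)..1, b x ^ 2) := by
  have h := hasSum_sq_fourierCoeffOn (show (-1:ℝ) < 1 by norm_num) (memLp_oddExtension hb)
  simp only [norm_sq_fourierCoeffOn_oddExtension hb] at h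
  have hI : ∫ x in (-1:ℝ)..1, ‖oddExtension b x‖ ^ 2 = 2 * ∫ x in (0:ℝ)..1, b x ^ 2 := by
    simp only [norm_oddExtension, sq_abs]
    rw [intervalIntegral_symm_eq (by
      apply Continuous.intervalIntegrable; fun_prop), ← intervalIntegral.integral_const_mul]
    rw [intervalIntegral.integral_of_le (by norm_num),
      intervalIntegral.integral_of_le (by norm_num)]
    refine setIntegral_congr_fun measurableSet_Ioc fun x hx => ?_
    simp only [abs_neg, abs_of_pos hx.1]; ring
  rw [hI] at h
  have h2 := h.nat_add_neg
  simp only [Int.cast_zero, zero_mul, sin_zero, mul_zero, intervalIntegral.integral_zero] at h2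
  have h3 := (hasSum_nat_add_iff' 1).2 h2
  have hk : ∀ k : ℕ, 2 * sineCoeff b k ^ 2 =
      (∫ x in (0:ℝ)..1, b x * sin ((((k+1:ℕ):ℤ) : ℝ) * π * x)) ^ 2
      + (∫ x in (0:ℝ)..1, b x * sin (((-((k+1:ℕ):ℤ) : ℤ) : ℝ) * π * x)) ^ 2 := by
    intro k
    have e : ∀ x : ℝ, b x * sin (((-((k+1:ℕ):ℤ) : ℤ) : ℝ) * π * x)
        = -(b x * sin (waveNumber k * x)) := by
      intro x
      unfold waveNumber
      push_cast
      rw [show -((k:ℝ)+1) * π * x = -(((k:ℝ)+1) * π * x) by ring, sin_neg]; ring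
    have e' : ∀ x : ℝ, b x * sin ((((k+1:ℕ):ℤ) : ℝ) * π * x)
        = b x * sin (waveNumber k * x) := by
      intro x
      unfold waveNumber
      push_cast
      rfl
    simp only [e, e', intervalIntegral.integral_neg]
    unfold sineCoeff
    ring
  simp only [hk]
  have hv : ((1:ℝ) - -1)⁻¹ • (2 * ∫ x in (0:ℝ)..1, b x ^ 2) + 0 ^ 2 -
      ∑ i ∈ Finset.range 1, ((∫ x in (0:ℝ)..1, b x * sin (((i : ℤ) : ℝ) * π * x)) ^ 2 +
        (∫ x in (0:ℝ)..1, b x * sin (((-(i : ℤ) : ℤ) : ℝ) * π * x)) ^ 2)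
      = ∫ x in (0:ℝ)..1, b x ^ 2 := by
    simp
    ring
  rwa [hv] at h3

/-- Sine coefficients determine a continuous function on `[0,1]`. -/
lemma eqOn_of_sineCoeff_eq {a b : ℝ → ℝ} (ha : Continuous a) (hb : Continuous b)
    (h : ∀ k, sineCoeff a k = sineCoeff b k) {x : ℝ} (hx : x ∈ Icc (0:ℝ) 1) : a x = b x := by
  have hz : ∀ k, sineCoeff (fun x => a x - b x) k = 0 := by
    intro k
    unfold sineCoeff
    simp only [sub_mul]
    rw [intervalIntegral.integral_sub]
    · exact sub_eq_zero.2 (h k)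
    · apply Continuous.intervalIntegrable; fun_prop
    · apply Continuous.intervalIntegrable; fun_prop
  have h1 : HasSum (fun _ : ℕ => 2 * (0:ℝ) ^ 2) (∫ x in (0:ℝ)..1, (a x - b x) ^ 2) := by
    have := hasSum_sq_sineCoeff (ha.sub hb)
    have e : ∀ k, sineCoeff (a - b) k = 0 := hz
    simpa only [e, Pi.sub_apply] using this
  have h2 : ∫ x in (0:ℝ)..1, (a x - b x) ^ 2 = 0 := by
    refine h1.unique ?_
    simp [hasSum_zero]
  by_contra hne
  have : 0 < ∫ x in (0:ℝ)..1, (a x - b x) ^ 2 := by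
    apply intervalIntegral.integral_pos (by norm_num)
    · fun_prop
    · intro y _; positivity
    · exact ⟨x, hx, by have := sub_ne_zero.2 hne; positivity⟩
  linarith

lemma abs_sineCoeff_le {b : ℝ → ℝ} {M : ℝ} (hM : ∀ x ∈ Icc (0:ℝ) 1, |b x| ≤ M)
    (k : ℕ) : |sineCoeff b k| ≤ M := by
  unfold sineCoeff
  have := intervalIntegral.norm_integral_le_of_norm_le_const (a := 0) (b := 1) (C := M)
    (f := fun x => b x * sin (waveNumber k * x)) (by
      intro x hx
      rw [uIoc_of_le (by norm_num)] at hx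
      rw [Real.norm_eq_abs, abs_mul]
      calc |b x| * |sin (waveNumber k * x)| ≤ |b x| * 1 := by gcongr; exact abs_sin_le_one _
        _ ≤ M := by simpa using hM x ⟨hx.1.le, hx.2⟩)
  simpa using this

lemma sineCoeff_sub {a b : ℝ → ℝ} (ha : Continuous a) (hb : Continuous b) (k : ℕ) :
    sineCoeff (fun x => a x - b x) k = sineCoeff a k - sineCoeff b k := by
  unfold sineCoeff
  simp only [sub_mul]
  rw [intervalIntegral.integral_sub] <;> (apply Continuous.intervalIntegrable; fun_prop)

lemma sineCoeff_add {a b : ℝ → ℝ} (ha : Continuous a) (hb : Continuous b) (k : ℕ) :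
    sineCoeff (fun x => a x + b x) k = sineCoeff a k + sineCoeff b k := by
  unfold sineCoeff
  simp only [add_mul]
  rw [intervalIntegral.integral_add] <;> (apply Continuous.intervalIntegrable; fun_prop)

lemma sineCoeff_const_mul (c : ℝ) (b : ℝ → ℝ) (k : ℕ) :
    sineCoeff (fun x => c * b x) k = c * sineCoeff b k := by
  unfold sineCoeff
  simp only [mul_assoc]
  rw [intervalIntegral.integral_const_mul]

lemma continuous_sineCoeff {h : ℝ → ℝ → ℝ} (hh : Continuous (Function.uncurry h)) (k : ℕ) :
    Continuous fun t => sineCoeff (h t) k := by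
  unfold sineCoeff
  apply intervalIntegral.continuous_parametric_intervalIntegral_of_continuous'
  simp only [Function.uncurry_def] at hh ⊢
  fun_prop

/-- Two integrations by parts against a sine that vanishes at both endpoints. -/
lemma integral_deriv_deriv_mul_sin {w w1 w2 : ℝ → ℝ} {a b κ : ℝ} (hab : a ≤ b)
    (h1 : ∀ x ∈ Icc a b, HasDerivAt w (w1 x) x) (h2 : ∀ x ∈ Icc a b, HasDerivAt w1 (w2 x) x)
    (h3 : ContinuousOn w2 (Icc a b)) (hκ : sin (κ * (b - a)) = 0) :
    ∫ x in a..b, w2 x * sin (κ * (x - a))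
      = -(κ * (w b * cos (κ * (b - a)) - w a)) - κ ^ 2 * ∫ x in a..b, w x * sin (κ * (x - a)) := by
  have d1 : ∀ x, HasDerivAt (fun x => sin (κ * (x - a))) (κ * cos (κ * (x - a))) x := by
    intro x
    have := (((hasDerivAt_id x).sub_const a).const_mul κ).sin
    exact this.congr_deriv (by simp only [mul_one, id]; ring)
  have d2 : ∀ x, HasDerivAt (fun x => κ * cos (κ * (x - a))) (-(κ ^ 2) * sin (κ * (x - a))) x := by
    intro x
    have := ((((hasDerivAt_id x).sub_const a).const_mul κ).cos).const_mul κ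
    exact this.congr_deriv (by simp only [mul_one, id]; ring)
  rw [← uIcc_of_le hab] at h1 h2 h3
  have c1 : ContinuousOn w1 (uIcc a b) := fun x hx => (h2 x hx).continuousAt.continuousWithinAt
  have i1 := intervalIntegral.integral_mul_deriv_eq_deriv_mul h2 (fun x _ => d1 x)
    h3.intervalIntegrable (by apply Continuous.intervalIntegrable; fun_prop)
  have i2 := intervalIntegral.integral_mul_deriv_eq_deriv_mul h1 (fun x _ => d2 x)
    c1.intervalIntegrable (by apply Continuous.intervalIntegrable; fun_prop)
  have e : ∫ x in a..b, w x * (-(κ ^ 2) * sin (κ * (x - a)))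
      = -(κ ^ 2) * ∫ x in a..b, w x * sin (κ * (x - a)) := by
    rw [← intervalIntegral.integral_const_mul]
    congr 1; funext x; ring
  rw [e] at i2
  simp only [hκ, sub_self, mul_zero, sin_zero, cos_zero, zero_sub, mul_one] at i1 i2
  linarith

/-- The bounded solution operator of `c' = b - l c` on the whole line. -/
noncomputable def decayConv (l : ℝ) (b : ℝ → ℝ) (t : ℝ) : ℝ :=
  ∫ s in Ioi (0:ℝ), exp (-l * s) * b (t - s)

lemma integral_exp_neg_mul_Ioi {l : ℝ} (hl : 0 < l) : ∫ s in Ioi (0:ℝ), exp (-l * s) = 1 / l := by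
  rw [integral_exp_mul_Ioi (by linarith)]
  simp [neg_div_neg_eq]

lemma integrableOn_exp_neg_mul {l : ℝ} (hl : 0 < l) :
    IntegrableOn (fun s : ℝ => exp (-l * s)) (Ioi 0) :=
  integrableOn_exp_mul_Ioi (by linarith) 0

lemma integrableOn_exp_mul_bounded {l : ℝ} (hl : 0 < l) {b : ℝ → ℝ} (hb : Continuous b) {M : ℝ}
    (hM : ∀ t, |b t| ≤ M) : IntegrableOn (fun s => exp (-l * s) * b s) (Ioi 0) :=
  (integrableOn_exp_neg_mul hl).mul_bdd hb.aestronglyMeasurable (.of_forall fun s => hM s)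

lemma integrableOn_decayConv {l : ℝ} (hl : 0 < l) {b : ℝ → ℝ} (hb : Continuous b) {M : ℝ}
    (hM : ∀ t, |b t| ≤ M) (t : ℝ) : IntegrableOn (fun s => exp (-l * s) * b (t - s)) (Ioi 0) :=
  integrableOn_exp_mul_bounded hl (b := fun s => b (t - s)) (by fun_prop) (fun s => hM _)

lemma abs_decayConv_le {l : ℝ} (hl : 0 < l) {b : ℝ → ℝ} {M : ℝ}
    (hM : ∀ t, |b t| ≤ M) (t : ℝ) : |decayConv l b t| ≤ M / l := by
  unfold decayConv
  have h1 := norm_integral_le_of_norm_le (μ := volume.restrict (Ioi (0:ℝ)))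
    (f := fun s => exp (-l * s) * b (t - s)) (g := fun s => exp (-l * s) * M)
    ((integrableOn_exp_neg_mul hl).mul_const M) (.of_forall fun s => by
      rw [norm_mul, Real.norm_eq_abs, abs_of_pos (exp_pos _)]
      gcongr; exact hM _)
  rw [integral_mul_const, integral_exp_neg_mul_Ioi hl] at h1
  rw [Real.norm_eq_abs] at h1
  calc _ ≤ _ := h1
    _ = M / l := by ring

lemma decayConv_sub {l : ℝ} (hl : 0 < l) {a b : ℝ → ℝ} (ha : Continuous a) (hb : Continuous b)
    {M N : ℝ} (hM : ∀ t, |a t| ≤ M) (hN : ∀ t, |b t| ≤ N) (t : ℝ) :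
    decayConv l (fun s => a s - b s) t = decayConv l a t - decayConv l b t := by
  unfold decayConv
  rw [← integral_sub (integrableOn_decayConv hl ha hM t) (integrableOn_decayConv hl hb hN t)]
  congr 1; funext s; ring

lemma decayConv_eq_Iic (l : ℝ) (b : ℝ → ℝ) (t : ℝ) :
    decayConv l b t = exp (-l * t) * ∫ r in Iic t, exp (l * r) * b r := by
  unfold decayConv
  have h := integral_comp_neg_Iic (-t) (fun s => exp (-l * (s + t)) * b (-s))
  have h2 : ∫ x in Iic t, exp (-l * (t - x)) * b x
      = ∫ s in Ioi (0:ℝ), exp (-l * s) * b (t - s) := by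
    have e := (Measure.measurePreserving_sub_left (volume : Measure ℝ) t).setIntegral_preimage_emb
      (MeasurableEquiv.subLeft t).measurableEmbedding (fun s => exp (-l * s) * b (t - s)) (Ici 0)
    rw [integral_Ici_eq_integral_Ioi] at e
    rw [← e]
    have : (fun x => t - x) ⁻¹' Ici 0 = Iic t := by ext x; simp
    rw [this]
    simp
  rw [← h2, ← integral_const_mul]
  congr 1; funext x
  rw [← mul_assoc, ← exp_add]; congr 2; ring

lemma integrableOn_Iic_exp_mul_bounded {l : ℝ} (hl : 0 < l) {b : ℝ → ℝ} (hb : Continuous b) {M : ℝ}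
    (hM : ∀ t, |b t| ≤ M) (t : ℝ) : IntegrableOn (fun s => exp (l * s) * b s) (Iic t) :=
  (integrableOn_exp_mul_Iic hl t).mul_bdd hb.aestronglyMeasurable (.of_forall fun s => hM s)

lemma hasDerivAt_decayConv {l : ℝ} (hl : 0 < l) {b : ℝ → ℝ} (hb : Continuous b) {M : ℝ}
    (hM : ∀ t, |b t| ≤ M) (t : ℝ) :
    HasDerivAt (decayConv l b) (b t - l * decayConv l b t) t := by
  have hI : ∀ x, ∫ r in Iic x, exp (l * r) * b r
      = (∫ r in Iic (0:ℝ), exp (l * r) * b r) + ∫ r in (0:ℝ)..x, exp (l * r) * b r := by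
    intro x
    rw [← intervalIntegral.integral_Iic_sub_Iic (integrableOn_Iic_exp_mul_bounded hl hb hM 0)
      (integrableOn_Iic_exp_mul_bounded hl hb hM x)]
    ring
  have hc : Continuous fun r => exp (l * r) * b r := by fun_prop
  have h1 : HasDerivAt (fun x => ∫ r in Iic x, exp (l * r) * b r) (exp (l * t) * b t) t := by
    rw [funext hI]
    exact (intervalIntegral.integral_hasDerivAt_right (hc.intervalIntegrable _ _)
      hc.aestronglyMeasurable.stronglyMeasurableAtFilter hc.continuousAt).const_add _
  have h2 : HasDerivAt (fun x => exp (-l * x)) (exp (-l * t) * (-l)) t := by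
    simpa using ((hasDerivAt_id t).const_mul (-l)).exp
  have h3 := h2.mul h1
  have e : decayConv l b = (fun x => exp (-l * x)) * fun x => ∫ r in Iic x, exp (l * r) * b r := by
    funext x; exact decayConv_eq_Iic l b x
  rw [← e] at h3
  refine h3.congr_deriv ?_
  have e2 : exp (-l * t) * (exp (l * t) * b t) = b t := by
    rw [← mul_assoc, ← exp_add]; simp
  rw [e2, decayConv_eq_Iic]; ring

/-- The bounded solution of `c' = b - l c` is unique. -/
lemma eq_decayConv {l : ℝ} (hl : 0 < l) {b c : ℝ → ℝ} (hb : Continuous b) {M N : ℝ}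
    (hM : ∀ t, |b t| ≤ M) (hN : ∀ t, |c t| ≤ N) (hc : ∀ t, HasDerivAt c (b t - l * c t) t) (t : ℝ) :
    c t = decayConv l b t := by
  set z : ℝ → ℝ := fun s => c s - decayConv l b s with hz
  have hzd : ∀ s, HasDerivAt z (-l * z s) s := fun s =>
    ((hc s).sub (hasDerivAt_decayConv hl hb hM s)).congr_deriv (by simp only [hz]; ring)
  have hzb : ∀ s, |z s| ≤ N + M / l := fun s =>
    (abs_sub _ _).trans (add_le_add (hN s) (abs_decayConv_le hl hM s))
  have hconst : ∀ s, exp (l * s) * z s = exp (l * t) * z t := by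
    have hd : ∀ s, HasDerivAt (fun s => exp (l * s) * z s) 0 s := by
      intro s
      have h2 : HasDerivAt (fun x => exp (l * x)) (exp (l * s) * l) s := by
        simpa using ((hasDerivAt_id s).const_mul l).exp
      exact (h2.mul (hzd s)).congr_deriv (by ring)
    intro s
    exact is_const_of_deriv_eq_zero (fun s => (hd s).differentiableAt) (fun s => (hd s).deriv) s t
  have hlim : Tendsto (fun s : ℝ => exp (l * s) * (N + M / l)) atBot (𝓝 0) := by
    have : Tendsto (fun s : ℝ => exp (l * s)) atBot (𝓝 0) :=
      tendsto_exp_atBot.comp (tendsto_id.const_mul_atBot hl)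
    simpa using this.mul_const (N + M / l)
  have h0 : |exp (l * t) * z t| ≤ 0 := by
    refine ge_of_tendsto hlim (.of_forall fun s => ?_)
    rw [← hconst s, abs_mul, abs_of_pos (exp_pos _)]
    gcongr; exact hzb s
  have h1 : z t = 0 := by
    have := abs_nonpos_iff.1 h0
    exact (mul_eq_zero.1 this).resolve_left (exp_pos _).ne'
  exact sub_eq_zero.1 h1

/-- Jensen's inequality for the exponential average. -/
lemma sq_decayConv_le {l l₀ : ℝ} (hl₀ : 0 < l₀) (hl : l₀ ≤ l) {b : ℝ → ℝ} (hb : Continuous b)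
    {M : ℝ} (hM : ∀ t, |b t| ≤ M) (t : ℝ) :
    decayConv l b t ^ 2 ≤ 1 / l₀ * ∫ s in Ioi (0:ℝ), exp (-l₀ * s) * b (t - s) ^ 2 := by
  have hl' : 0 < l := hl₀.trans_le hl
  set d := decayConv l b t with hd
  have hsq : ∀ s, |b s ^ 2| ≤ M ^ 2 := fun s => by
    rw [abs_pow]; exact pow_le_pow_left₀ (abs_nonneg _) (hM s) 2
  have i1 := integrableOn_decayConv hl' hb hM t
  have i2 := integrableOn_decayConv hl' (b := fun s => b s ^ 2) (by fun_prop) hsq t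
  have i2' := integrableOn_decayConv hl₀ (b := fun s => b s ^ 2) (by fun_prop) hsq t
  have i3 := integrableOn_exp_neg_mul hl'
  have key : 0 ≤ ∫ s in Ioi (0:ℝ), exp (-l * s) * (b (t - s) - l * d) ^ 2 :=
    setIntegral_nonneg measurableSet_Ioi fun s _ => by positivity
  have e : ∫ s in Ioi (0:ℝ), exp (-l * s) * (b (t - s) - l * d) ^ 2
      = (∫ s in Ioi (0:ℝ), exp (-l * s) * b (t - s) ^ 2) - l * d ^ 2 := by
    have : ∀ s, exp (-l * s) * (b (t - s) - l * d) ^ 2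
        = (exp (-l * s) * b (t - s) ^ 2 - (2 * l * d) * (exp (-l * s) * b (t - s)))
          + (l * d) ^ 2 * exp (-l * s) := fun s => by ring
    simp only [this]
    have i4 : IntegrableOn (fun s => exp (-l * s) * b (t - s) ^ 2
        - (2 * l * d) * (exp (-l * s) * b (t - s))) (Ioi 0) := i2.sub (i1.const_mul _)
    rw [integral_add i4 (i3.const_mul _),
      integral_sub i2 (i1.const_mul _),
      integral_const_mul, integral_const_mul, integral_exp_neg_mul_Ioi hl']
    have : ∫ s in Ioi (0:ℝ), exp (-l * s) * b (t - s) = d := rfl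
    rw [this]
    field_simp
    ring
  have hmono : ∫ s in Ioi (0:ℝ), exp (-l * s) * b (t - s) ^ 2
      ≤ ∫ s in Ioi (0:ℝ), exp (-l₀ * s) * b (t - s) ^ 2 := by
    refine setIntegral_mono_on i2 i2' measurableSet_Ioi fun s hs => ?_
    have : exp (-l * s) ≤ exp (-l₀ * s) := by
      apply exp_le_exp.2
      have hs' : (0:ℝ) < s := hs
      nlinarith
    gcongr
  have h1 : l₀ * d ^ 2 ≤ ∫ s in Ioi (0:ℝ), exp (-l₀ * s) * b (t - s) ^ 2 := by
    have : l₀ * d ^ 2 ≤ l * d ^ 2 := by gcongr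
    linarith
  rw [div_mul_eq_mul_div, one_mul, le_div_iff₀ hl₀]
  linarith

lemma sub_mul_decayConv {l : ℝ} (hl : 0 < l) {b : ℝ → ℝ} (hb : Continuous b) {M : ℝ}
    (hM : ∀ t, |b t| ≤ M) (t : ℝ) :
    b t - l * decayConv l b t = ∫ s in Ioi (0:ℝ), l * exp (-l * s) * (b t - b (t - s)) := by
  have : ∀ s, l * exp (-l * s) * (b t - b (t - s))
      = (l * b t) * exp (-l * s) - l * (exp (-l * s) * b (t - s)) := fun s => by ring
  simp only [this]
  rw [integral_sub ((integrableOn_exp_neg_mul hl).const_mul _)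
    ((integrableOn_decayConv hl hb hM t).const_mul _), integral_const_mul, integral_const_mul,
    integral_exp_neg_mul_Ioi hl]
  unfold decayConv
  field_simp

lemma decayConv_shift (l : ℝ) (b : ℝ → ℝ) (a t : ℝ) :
    decayConv l (fun s => b (s + a)) t = decayConv l b (t + a) := by
  unfold decayConv
  simp only [sub_add_eq_add_sub]

lemma abs_decayConv_sub_le {l : ℝ} (hl : 0 < l) {b : ℝ → ℝ} (hb : Continuous b) {M : ℝ}
    (hM : ∀ t, |b t| ≤ M) (t t' : ℝ) :
    |decayConv l b t - decayConv l b t'| ≤ 2 * M * |t - t'| ^ (1 / 2 : ℝ) * (1 / √l) := by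
  have hM0 : 0 ≤ M := (abs_nonneg _).trans (hM 0)
  have hd : ∀ s, ‖b s - l * decayConv l b s‖ ≤ 2 * M := by
    intro s
    have h1 := abs_decayConv_le hl hM s
    have h2 : |l * decayConv l b s| ≤ M := by
      rw [abs_mul, abs_of_pos hl]
      rw [le_div_iff₀ hl] at h1; linarith
    calc _ ≤ |b s| + |l * decayConv l b s| := abs_sub _ _
      _ ≤ _ := by linarith [hM s]
  have h1 : |decayConv l b t - decayConv l b t'| ≤ 2 * M * |t - t'| :=
    convex_univ.norm_image_sub_le_of_norm_hasDerivWithin_le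
      (fun s _ => (hasDerivAt_decayConv hl hb hM s).hasDerivWithinAt) (fun s _ => hd s)
      (mem_univ t') (mem_univ t)
  have h2 : |decayConv l b t - decayConv l b t'| ≤ 2 * M * (1 / l) := by
    calc _ ≤ |decayConv l b t| + |decayConv l b t'| := abs_sub _ _
      _ ≤ M / l + M / l := add_le_add (abs_decayConv_le hl hM t) (abs_decayConv_le hl hM t')
      _ = _ := by ring
  rw [← Real.sqrt_eq_rpow]
  have e : (2 * M * √|t - t'| * (1 / √l)) ^ 2 = (2 * M * |t - t'|) * (2 * M * (1 / l)) := by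
    rw [mul_pow, mul_pow, div_pow, Real.sq_sqrt (abs_nonneg _), Real.sq_sqrt hl.le]; ring
  refine (pow_le_pow_iff_left₀ (abs_nonneg _) (by positivity) two_ne_zero).1 ?_
  rw [e, sq]
  gcongr

lemma hasSum_integral_of_summable_bound {F : ℕ → ℝ → ℝ} {u : ℕ → ℝ} (hF : ∀ k, Continuous (F k))
    (hu : Summable u) (hb : ∀ k x, |F k x| ≤ u k) (a b : ℝ) :
    HasSum (fun k => ∫ x in a..b, F k x) (∫ x in a..b, ∑' k, F k x) := by
  refine intervalIntegral.hasSum_integral_of_dominated_convergence (fun k _ => u k)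
    (fun k => (hF k).aestronglyMeasurable) (fun k => .of_forall fun x _ => hb k x)
    (.of_forall fun x _ => hu) (by simp) (.of_forall fun x _ => ?_)
  exact (Summable.of_norm_bounded hu fun k => hb k x).hasSum

lemma integral_cos_int_mul_pi (m : ℤ) :
    ∫ x in (0:ℝ)..1, cos (m * π * x) = if m = 0 then 1 else 0 := by
  split_ifs with h
  · simp [h]
  · have hm : (m : ℝ) * π ≠ 0 := mul_ne_zero (by exact_mod_cast h) pi_ne_zero
    rw [intervalIntegral.integral_comp_mul_left (fun x => cos x) hm]
    simp

lemma sineCoeff_sin (j k : ℕ) :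
    sineCoeff (fun x => sin (waveNumber j * x)) k = if j = k then 1 / 2 else 0 := by
  have e : ∀ x, sin (waveNumber j * x) * sin (waveNumber k * x)
      = 1 / 2 * cos (((j - k : ℤ) : ℝ) * π * x) - 1 / 2 * cos (((j + k + 2 : ℤ) : ℝ) * π * x) := by
    intro x
    have h1 : ((j - k : ℤ) : ℝ) * π * x = waveNumber j * x - waveNumber k * x := by
      unfold waveNumber; push_cast; ring
    have h2 : ((j + k + 2 : ℤ) : ℝ) * π * x = waveNumber j * x + waveNumber k * x := by
      unfold waveNumber; push_cast; ring
    rw [h1, h2, cos_sub, cos_add]; ring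
  unfold sineCoeff
  simp only [e]
  rw [intervalIntegral.integral_sub (by apply Continuous.intervalIntegrable; fun_prop)
    (by apply Continuous.intervalIntegrable; fun_prop), intervalIntegral.integral_const_mul,
    intervalIntegral.integral_const_mul, integral_cos_int_mul_pi, integral_cos_int_mul_pi,
    if_neg (by omega : ¬ ((j:ℤ) + k + 2 = 0))]
  by_cases h : j = k
  · simp [h]
  · rw [if_neg (by omega), if_neg h]; simp

/-- The sine series with coefficients `a`. -/
noncomputable def sineSeries (a : ℕ → ℝ) (x : ℝ) : ℝ := ∑' k, 2 * a k * sin (waveNumber k * x)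

lemma abs_sineTerm_le {a u : ℕ → ℝ} (ha : ∀ k, |a k| ≤ u k) (k : ℕ) (x : ℝ) :
    |2 * a k * sin (waveNumber k * x)| ≤ 2 * u k := by
  rw [abs_mul, abs_mul]
  calc |2| * |a k| * |sin (waveNumber k * x)| ≤ |2| * |a k| * 1 := by
        gcongr; exact abs_sin_le_one _
    _ ≤ 2 * u k := by rw [abs_two]; linarith [ha k]

lemma abs_sineSeries_le {a u : ℕ → ℝ} (hu : Summable u) (ha : ∀ k, |a k| ≤ u k) (x : ℝ) :
    |sineSeries a x| ≤ 2 * ∑' k, u k := by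
  rw [← tsum_mul_left]
  exact tsum_of_norm_bounded (f := fun k => 2 * a k * sin (waveNumber k * x))
    (hu.mul_left 2).hasSum fun k => abs_sineTerm_le ha k x

lemma sineCoeff_sineSeries {a u : ℕ → ℝ} (hu : Summable u) (ha : ∀ k, |a k| ≤ u k) (j : ℕ) :
    sineCoeff (sineSeries a) j = a j := by
  have hs := hasSum_integral_of_summable_bound (a := 0) (b := 1)
    (F := fun k x => 2 * a k * sin (waveNumber k * x) * sin (waveNumber j * x))
    (u := fun k => 2 * u k) (fun k => by fun_prop) (hu.mul_left 2) (fun k x => by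
      rw [abs_mul]
      calc _ ≤ |2 * a k * sin (waveNumber k * x)| * 1 := by gcongr; exact abs_sin_le_one _
        _ ≤ _ := by rw [mul_one]; exact abs_sineTerm_le ha k x)
  have e1 : ∀ k, ∫ x in (0:ℝ)..1, 2 * a k * sin (waveNumber k * x) * sin (waveNumber j * x)
      = if k = j then a j else 0 := by
    intro k
    have : ∀ x, 2 * a k * sin (waveNumber k * x) * sin (waveNumber j * x)
      = (2 * a k) * (sin (waveNumber k * x) * sin (waveNumber j * x)) := fun x => by ring
    simp only [this]
    rw [intervalIntegral.integral_const_mul]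
    have h := sineCoeff_sin k j
    unfold sineCoeff at h
    rw [h]
    split_ifs with h
    · rw [h]; ring
    · ring
  simp only [e1] at hs
  have h2 : ∫ x in (0:ℝ)..1, ∑' k, 2 * a k * sin (waveNumber k * x) * sin (waveNumber j * x)
      = sineCoeff (sineSeries a) j := by
    unfold sineCoeff sineSeries
    simp only [tsum_mul_right]
  rw [h2] at hs
  exact hs.unique (hasSum_ite_eq j (a j))

lemma continuous_sineSeries {X : Type*} [TopologicalSpace X] {a : ℕ → X → ℝ} {y : X → ℝ}
    {u : ℕ → ℝ} (hc : ∀ k, Continuous (a k)) (hy : Continuous y) (hu : Summable u)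
    (ha : ∀ k p, |a k p| ≤ u k) : Continuous fun p => sineSeries (fun k => a k p) (y p) := by
  unfold sineSeries
  refine continuous_tsum (u := fun k => 2 * u k) (fun k => by have := hc k; fun_prop)
    (hu.mul_left 2) fun k p => abs_sineTerm_le (fun k => ha k p) k (y p)

/-- The `k`-th eigenvalue of `γ ∂ₓ⁴ - ∂ₓ² - 1` with Navier boundary conditions on `(0,1)`. -/
noncomputable def eigenvalue (γ : ℝ) (k : ℕ) : ℝ := γ * waveNumber k ^ 4 + waveNumber k ^ 2 - 1

lemma one_add_le_waveNumber (k : ℕ) : (k:ℝ) + 1 ≤ waveNumber k := by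
  unfold waveNumber
  have := pi_gt_three
  have h : (0:ℝ) ≤ k := k.cast_nonneg
  nlinarith

lemma mul_waveNumber_pow_le_eigenvalue {γ : ℝ} (k : ℕ) :
    γ * waveNumber k ^ 4 ≤ eigenvalue γ k := by
  unfold eigenvalue
  have h := one_add_le_waveNumber k
  have h' : (0:ℝ) ≤ k := k.cast_nonneg
  nlinarith

lemma eigenvalue_pos {γ : ℝ} (hγ : 0 < γ) (k : ℕ) : 0 < eigenvalue γ k :=
  lt_of_lt_of_le (by have := waveNumber_pos k; positivity) (mul_waveNumber_pow_le_eigenvalue k)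

lemma eigenvalue_monotone {γ : ℝ} (hγ : 0 < γ) : Monotone (eigenvalue γ) := by
  intro j k hjk
  unfold eigenvalue
  have h : waveNumber j ≤ waveNumber k := by
    unfold waveNumber
    have : (j:ℝ) ≤ k := by exact_mod_cast hjk
    gcongr
  have := waveNumber_pos j
  gcongr

lemma eigenvalue_zero (γ : ℝ) : eigenvalue γ 0 = γ * π ^ 4 + π ^ 2 - 1 := by
  simp [eigenvalue, waveNumber]

lemma summable_inv_sq_succ (c : ℝ) : Summable fun k : ℕ => c * (1 / ((k:ℝ) + 1) ^ 2) := by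
  have h := (summable_nat_add_iff 1).2 (Real.summable_one_div_nat_pow.2 (one_lt_two))
  simpa using h.mul_left c

lemma summable_waveNumber_sq_div_eigenvalue {γ : ℝ} (hγ : 0 < γ) :
    Summable fun k => waveNumber k ^ 2 * (1 / eigenvalue γ k) := by
  refine (summable_inv_sq_succ (1 / γ)).of_nonneg_of_le (fun k => ?_) (fun k => ?_)
  · have := eigenvalue_pos hγ k; positivity
  · have hw := waveNumber_pos k
    have h1 := one_add_le_waveNumber k
    calc waveNumber k ^ 2 * (1 / eigenvalue γ k)
        ≤ waveNumber k ^ 2 * (1 / (γ * waveNumber k ^ 4)) := by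
          gcongr; exact mul_waveNumber_pow_le_eigenvalue k
      _ = 1 / γ * (1 / waveNumber k ^ 2) := by field_simp
      _ ≤ _ := by gcongr

lemma summable_inv_eigenvalue {γ : ℝ} (hγ : 0 < γ) : Summable fun k => 1 / eigenvalue γ k := by
  refine (summable_waveNumber_sq_div_eigenvalue hγ).of_nonneg_of_le (fun k => ?_) (fun k => ?_)
  · have := eigenvalue_pos hγ k; positivity
  · have := eigenvalue_pos hγ k
    have h1 : 1 ≤ waveNumber k ^ 2 := by
      have h := one_add_le_waveNumber k
      have h' : (0:ℝ) ≤ k := k.cast_nonneg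
      nlinarith
    exact le_mul_of_one_le_left (by positivity) h1

lemma summable_inv_sqrt_eigenvalue {γ : ℝ} (hγ : 0 < γ) :
    Summable fun k => 1 / √(eigenvalue γ k) := by
  refine (summable_inv_sq_succ (1 / √γ)).of_nonneg_of_le (fun k => by positivity) (fun k => ?_)
  have hw := waveNumber_pos k
  have h1 := one_add_le_waveNumber k
  have h2 : √(γ * waveNumber k ^ 4) = √γ * waveNumber k ^ 2 := by
    rw [Real.sqrt_mul hγ.le, show waveNumber k ^ 4 = (waveNumber k ^ 2) ^ 2 by ring,
      Real.sqrt_sq (by positivity)]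
  have h3 := Real.sqrt_le_sqrt (mul_waveNumber_pow_le_eigenvalue (γ := γ) k)
  rw [h2] at h3
  have h4 : 0 < √γ := Real.sqrt_pos.2 hγ
  calc 1 / √(eigenvalue γ k) ≤ 1 / (√γ * waveNumber k ^ 2) := by gcongr
    _ = 1 / √γ * (1 / waveNumber k ^ 2) := by field_simp
    _ ≤ _ := by gcongr

/-- The Fourier multiplier of `A e^{-sA}`. -/
noncomputable def decayRate (γ s : ℝ) (k : ℕ) : ℝ := eigenvalue γ k * exp (-eigenvalue γ k * s)

/-- The even periodic kernel of `A e^{-sA}`. -/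
noncomputable def decayKernel (γ s z : ℝ) : ℝ := ∑' k, decayRate γ s k * cos (waveNumber k * z)

lemma decayRate_nonneg {γ : ℝ} (hγ : 0 < γ) (s : ℝ) (k : ℕ) : 0 ≤ decayRate γ s k := by
  have := eigenvalue_pos hγ k
  unfold decayRate; positivity

lemma decayRate_le {γ : ℝ} (hγ : 0 < γ) {s : ℝ} (hs : 0 < s) (k : ℕ) :
    decayRate γ s k ≤ 2 / s ^ 2 * (1 / eigenvalue γ k) := by
  have hl := eigenvalue_pos hγ k
  unfold decayRate
  set l := eigenvalue γ k
  have h1 := Real.quadratic_le_exp_of_nonneg (x := l * s) (by positivity)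
  have h2 : (l * s) ^ 2 / 2 ≤ exp (l * s) := by nlinarith [mul_pos hl hs]
  rw [show -l * s = -(l * s) by ring, exp_neg, ← div_eq_mul_inv, div_le_iff₀ (exp_pos _)]
  calc l = 2 / s ^ 2 * (1 / l) * ((l * s) ^ 2 / 2) := by field_simp
    _ ≤ _ := by gcongr

lemma summable_decayRate {γ : ℝ} (hγ : 0 < γ) {s : ℝ} (hs : 0 < s) : Summable (decayRate γ s) :=
  ((summable_inv_eigenvalue hγ).mul_left (2 / s ^ 2)).of_nonneg_of_le (decayRate_nonneg hγ s)
    (decayRate_le hγ hs)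

lemma abs_decayTerm_le {γ : ℝ} (hγ : 0 < γ) (s : ℝ) (k : ℕ) (z : ℝ) :
    |decayRate γ s k * cos (waveNumber k * z)| ≤ decayRate γ s k := by
  rw [abs_mul, abs_of_nonneg (decayRate_nonneg hγ s k)]
  exact mul_le_of_le_one_right (decayRate_nonneg hγ s k) (abs_cos_le_one _)

lemma hasSum_decayKernel {γ : ℝ} (hγ : 0 < γ) {s : ℝ} (hs : 0 < s) (z : ℝ) :
    HasSum (fun k => decayRate γ s k * cos (waveNumber k * z)) (decayKernel γ s z) :=
  (Summable.of_norm_bounded (summable_decayRate hγ hs) fun k => abs_decayTerm_le hγ s k z).hasSum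

lemma continuous_decayKernel {γ : ℝ} (hγ : 0 < γ) {s : ℝ} (hs : 0 < s) :
    Continuous (decayKernel γ s) := by
  unfold decayKernel
  exact continuous_tsum (fun k => by fun_prop) (summable_decayRate hγ hs)
    fun k z => abs_decayTerm_le hγ s k z

lemma abs_decayKernel_le {γ : ℝ} (hγ : 0 < γ) {s : ℝ} (hs : 0 < s) (z : ℝ) :
    |decayKernel γ s z| ≤ (2 * ∑' k, 1 / eigenvalue γ k) / s ^ 2 := by
  have h := tsum_of_norm_bounded (f := fun k => decayRate γ s k * cos (waveNumber k * z))
    ((summable_inv_eigenvalue hγ).mul_left (2 / s ^ 2)).hasSum fun k =>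
    (abs_decayTerm_le hγ s k z).trans (decayRate_le hγ hs k)
  rw [tsum_mul_left] at h
  calc _ ≤ _ := h
    _ = _ := by ring

lemma one_add_mul_exp_neg_antitone {x y : ℝ} (hx : 0 ≤ x) (hxy : x ≤ y) :
    (1 + y) * exp (-y) ≤ (1 + x) * exp (-x) := by
  have h1 : exp (-x) = exp (y - x) * exp (-y) := by rw [← exp_add]; congr 1; ring
  rw [h1, ← mul_assoc]
  gcongr
  have := add_one_le_exp (y - x)
  nlinarith

/-- A decreasing majorant that controls the variation of `decayRate`. -/
noncomputable def decayVariation (γ s : ℝ) (k : ℕ) : ℝ :=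
  decayRate γ s k + 2 / s * exp (-eigenvalue γ k * s)

lemma abs_decayRate_sub_le {γ : ℝ} (hγ : 0 < γ) {s : ℝ} (hs : 0 < s) (k : ℕ) :
    |decayRate γ s k - decayRate γ s (k + 1)|
      ≤ decayVariation γ s k - decayVariation γ s (k + 1) := by
  have hl := eigenvalue_pos hγ k
  have hm := eigenvalue_monotone hγ k.le_succ
  simp only [Nat.succ_eq_add_one] at hm
  unfold decayVariation decayRate
  set l := eigenvalue γ k
  set m := eigenvalue γ (k + 1)
  have h1 : exp (-m * s) ≤ exp (-l * s) := exp_le_exp.2 (by nlinarith)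
  have h2 := one_add_mul_exp_neg_antitone (x := l * s) (y := m * s) (by positivity) (by gcongr)
  have h3 : 2 / s * exp (-m * s) ≤ 2 / s * exp (-l * s) := by gcongr
  have h4 : 2 / s * ((1 + m * s) * exp (-(m * s))) ≤ 2 / s * ((1 + l * s) * exp (-(l * s))) := by
    gcongr
  have e : ∀ r : ℝ, 2 / s * ((1 + r * s) * exp (-(r * s)))
      = 2 * (r * exp (-r * s)) + 2 / s * exp (-r * s) := by
    intro r
    rw [show -(r * s) = -r * s by ring]; field_simp; ring
  rw [e, e] at h4
  rw [abs_le]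
  constructor <;> linarith

lemma decayRate_add_decayVariation_le {γ : ℝ} (hγ : 0 < γ) {s : ℝ} (hs : 0 < s) :
    decayRate γ s 0 + decayVariation γ s 0 ≤ 4 / s := by
  have hl := eigenvalue_pos hγ 0
  unfold decayVariation decayRate
  set l := eigenvalue γ 0
  have h2 := one_add_mul_exp_neg_antitone (x := 0) (y := l * s) le_rfl (by positivity)
  have h4 : 2 / s * ((1 + l * s) * exp (-(l * s))) ≤ 2 / s * ((1 + 0) * exp (-0)) := by
    gcongr
  have e : 2 / s * ((1 + l * s) * exp (-(l * s)))
      = 2 * (l * exp (-l * s)) + 2 / s * exp (-l * s) := by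
    rw [show -(l * s) = -l * s by ring]; field_simp; ring
  rw [e] at h4
  simp at h4
  have h5 : 2 / s ≤ 4 / s := by gcongr; norm_num
  simp only [neg_mul]
  linarith

/-- Summation by parts. -/
lemma abs_sin_mul_sum_decayRate_le {γ : ℝ} (hγ : 0 < γ) {s : ℝ} (hs : 0 < s) (z : ℝ) (N : ℕ) :
    |2 * sin (π * z / 2) * ∑ k ∈ Finset.range N, decayRate γ s k * cos (waveNumber k * z)|
      ≤ 4 / s := by
  set S : ℕ → ℝ := fun k => sin ((k + 1 / 2) * π * z) with hS
  have hS1 : ∀ k, |S k| ≤ 1 := fun k => abs_sin_le_one _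
  have hstep : ∀ k, 2 * sin (π * z / 2) * cos (waveNumber k * z) = S (k + 1) - S k := by
    intro k
    have h1 : ((k + 1 : ℕ) + 1 / 2 : ℝ) * π * z = waveNumber k * z + π * z / 2 := by
      unfold waveNumber; push_cast; ring
    have h2 : ((k:ℝ) + 1 / 2) * π * z = waveNumber k * z - π * z / 2 := by
      unfold waveNumber; ring
    simp only [hS]
    rw [h1, h2, sin_add, sin_sub]; ring
  have hR : ∀ n : ℕ, |2 * sin (π * z / 2) *
      (∑ k ∈ Finset.range n, decayRate γ s k * cos (waveNumber k * z)) - decayRate γ s n * S n|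
      ≤ decayRate γ s 0 + decayVariation γ s 0 - decayVariation γ s n := by
    intro n
    induction n with
    | zero =>
      simp only [Finset.range_zero, Finset.sum_empty, mul_zero, zero_sub, abs_neg, abs_mul,
        add_sub_cancel_right]
      rw [abs_of_nonneg (decayRate_nonneg hγ s 0)]
      exact mul_le_of_le_one_right (decayRate_nonneg hγ s 0) (hS1 0)
    | succ n ih =>
      have e : 2 * sin (π * z / 2) *
          (∑ k ∈ Finset.range (n + 1), decayRate γ s k * cos (waveNumber k * z))
            - decayRate γ s (n + 1) * S (n + 1)
          = (2 * sin (π * z / 2) *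
          (∑ k ∈ Finset.range n, decayRate γ s k * cos (waveNumber k * z)) - decayRate γ s n * S n)
          + (decayRate γ s n - decayRate γ s (n + 1)) * S (n + 1) := by
        rw [Finset.sum_range_succ]
        linear_combination decayRate γ s n * hstep n
      rw [e]
      have h1 : |(decayRate γ s n - decayRate γ s (n + 1)) * S (n + 1)|
          ≤ decayVariation γ s n - decayVariation γ s (n + 1) := by
        rw [abs_mul]
        exact (mul_le_of_le_one_right (abs_nonneg _) (hS1 _)).trans (abs_decayRate_sub_le hγ hs n)
      exact (abs_add_le _ _).trans (by linarith)
  have h1 := hR N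
  have h2 : |decayRate γ s N * S N| ≤ decayVariation γ s N := by
    rw [abs_mul, abs_of_nonneg (decayRate_nonneg hγ s N)]
    refine (mul_le_of_le_one_right (decayRate_nonneg hγ s N) (hS1 N)).trans ?_
    unfold decayVariation
    have : 0 ≤ 2 / s * exp (-eigenvalue γ N * s) := by positivity
    linarith
  have h3 := decayRate_add_decayVariation_le hγ hs
  have h4 := abs_sub_abs_le_abs_sub (2 * sin (π * z / 2) *
      (∑ k ∈ Finset.range N, decayRate γ s k * cos (waveNumber k * z))) (decayRate γ s N * S N)
  linarith

lemma abs_mul_abs_decayKernel_le {γ : ℝ} (hγ : 0 < γ) {s : ℝ} (hs : 0 < s) {z : ℝ} (hz : |z| ≤ 1) :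
    |z| * |decayKernel γ s z| ≤ 2 / s := by
  have hlim := ((hasSum_decayKernel hγ hs z).tendsto_sum_nat.const_mul (2 * sin (π * z / 2))).abs
  have h1 := le_of_tendsto hlim (.of_forall fun N => abs_sin_mul_sum_decayRate_le hγ hs z N)
  have h2 := mul_abs_le_abs_sin (x := π * z / 2) (by
    rw [abs_div, abs_mul, abs_of_pos pi_pos, abs_two]
    have := pi_pos
    gcongr
    nlinarith)
  have h3 : 2 / π * |π * z / 2| = |z| := by
    rw [abs_div, abs_mul, abs_of_pos pi_pos, abs_two]
    field_simp
  rw [h3] at h2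
  rw [abs_mul, abs_mul, abs_two] at h1
  have h4 : |z| * |decayKernel γ s z| ≤ |sin (π * z / 2)| * |decayKernel γ s z| := by gcongr
  have h5 : (4:ℝ) / s = 2 * (2 / s) := by ring
  linarith

lemma decayKernel_neg (γ s z : ℝ) : decayKernel γ s (-z) = decayKernel γ s z := by
  unfold decayKernel
  simp only [mul_neg, cos_neg]

lemma decayKernel_periodic (γ s : ℝ) : Function.Periodic (decayKernel γ s) 2 := by
  intro z
  unfold decayKernel
  congr 1; funext k
  have : waveNumber k * (z + 2) = waveNumber k * z + ((k + 1 : ℕ) : ℝ) * (2 * π) := by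
    unfold waveNumber; push_cast; ring
  rw [this, cos_add_nat_mul_two_pi]

/-- The constant in the kernel bound. -/
noncomputable def kernelConst (γ δ : ℝ) : ℝ :=
  (2 * ∑' k, 1 / eigenvalue γ k) ^ δ * 2 ^ (1 - δ)

lemma abs_decayKernel_le_rpow {γ : ℝ} (hγ : 0 < γ) {δ : ℝ} (hδ : 0 < δ) (hδ1 : δ < 1) {s : ℝ}
    (hs : 0 < s) {z : ℝ} (hz0 : 0 < z) (hz : z ≤ 1) :
    |decayKernel γ s z| ≤ kernelConst γ δ * s ^ (-1 - δ) * z ^ (δ - 1) := by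
  have hC : 0 ≤ 2 * ∑' k, 1 / eigenvalue γ k :=
    mul_nonneg two_pos.le (tsum_nonneg fun k => by have := eigenvalue_pos hγ k; positivity)
  have h1 := abs_decayKernel_le hγ hs z
  have h2 : |decayKernel γ s z| ≤ 2 / (s * z) := by
    have := abs_mul_abs_decayKernel_le hγ hs (z := z) (by rwa [abs_of_pos hz0])
    rw [abs_of_pos hz0] at this
    rw [le_div_iff₀ (by positivity)]
    rw [le_div_iff₀ hs] at this
    linarith
  set K := |decayKernel γ s z| with hK
  have hK0 : 0 ≤ K := abs_nonneg _
  have e : K = K ^ δ * K ^ (1 - δ) := by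
    rw [← Real.rpow_add_of_nonneg hK0 hδ.le (by linarith)]; simp
  rw [e]
  calc K ^ δ * K ^ (1 - δ)
      ≤ ((2 * ∑' k, 1 / eigenvalue γ k) / s ^ 2) ^ δ * (2 / (s * z)) ^ (1 - δ) := by
        have h1δ : 0 ≤ 1 - δ := by linarith
        gcongr
    _ = kernelConst γ δ * s ^ (-1 - δ) * z ^ (δ - 1) := by
        unfold kernelConst
        rw [Real.div_rpow hC (by positivity), Real.div_rpow (by norm_num) (by positivity),
          Real.mul_rpow hs.le hz0.le, ← Real.rpow_natCast s 2, ← Real.rpow_mul hs.le,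
          show δ - 1 = -(1 - δ) by ring, Real.rpow_neg hz0.le,
          show -1 - δ = -(((2:ℕ):ℝ) * δ + (1 - δ)) by push_cast; ring, Real.rpow_neg hs.le,
          Real.rpow_add hs]
        field_simp

lemma integral_abs_decayKernel_le {γ : ℝ} (hγ : 0 < γ) {δ : ℝ} (hδ : 0 < δ) (hδ1 : δ < 1) {s : ℝ}
    (hs : 0 < s) :
    ∫ z in (-1:ℝ)..1, |decayKernel γ s z| ≤ 2 * kernelConst γ δ / δ * s ^ (-1 - δ) := by
  have hc := (continuous_decayKernel hγ hs).abs
  rw [intervalIntegral_symm_eq (hc.intervalIntegrable _ _)]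
  simp only [decayKernel_neg]
  have h1 : ∫ z in (0:ℝ)..1, (|decayKernel γ s z| + |decayKernel γ s z|)
      ≤ ∫ z in (0:ℝ)..1, (2 * kernelConst γ δ * s ^ (-1 - δ)) * z ^ (δ - 1) := by
    rw [intervalIntegral.integral_of_le (by norm_num),
      intervalIntegral.integral_of_le (by norm_num)]
    refine setIntegral_mono_on ?_ ?_ measurableSet_Ioc fun z hz => ?_
    · exact (hc.add hc).integrableOn_Ioc
    · exact (((intervalIntegral.intervalIntegrable_rpow' (by linarith)).const_mul _).1)
    · have := abs_decayKernel_le_rpow hγ hδ hδ1 hs hz.1 hz.2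
      linarith
  refine h1.trans (le_of_eq ?_)
  rw [intervalIntegral.integral_const_mul, integral_rpow (Or.inl (by linarith))]
  simp [hδ.ne']
  ring

lemma sineSeries_decayRate_eq {γ : ℝ} (hγ : 0 < γ) {s : ℝ} (hs : 0 < s) {D : ℝ → ℝ}
    (hD : Continuous D) {η : ℝ} (hη : ∀ y, |D y| ≤ η) (x : ℝ) :
    sineSeries (fun k => decayRate γ s k * sineCoeff D k) x
      = ∫ y in (0:ℝ)..1, D y * (decayKernel γ s (y - x) - decayKernel γ s (y + x)) := by
  have hs1 := hasSum_integral_of_summable_bound (a := 0) (b := 1)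
    (F := fun k y => D y * (decayRate γ s k * cos (waveNumber k * (y - x))
      - decayRate γ s k * cos (waveNumber k * (y + x)))) (u := fun k => η * (2 * decayRate γ s k))
    (fun k => by fun_prop) (((summable_decayRate hγ hs).mul_left 2).mul_left η) (fun k y => by
      rw [abs_mul]
      have hη0 : 0 ≤ η := (abs_nonneg _).trans (hη 0)
      gcongr
      · exact hη y
      · refine (abs_sub _ _).trans ?_
        linarith [abs_decayTerm_le hγ s k (y - x), abs_decayTerm_le hγ s k (y + x)])
  have e1 : ∀ y, ∑' k, D y * (decayRate γ s k * cos (waveNumber k * (y - x))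
      - decayRate γ s k * cos (waveNumber k * (y + x)))
      = D y * (decayKernel γ s (y - x) - decayKernel γ s (y + x)) := fun y =>
    (((hasSum_decayKernel hγ hs (y - x)).sub (hasSum_decayKernel hγ hs (y + x))).mul_left _).tsum_eq
  simp only [e1] at hs1
  rw [← hs1.tsum_eq]
  unfold sineSeries
  congr 1; funext k
  unfold sineCoeff
  have e2 : ∀ y, D y * (decayRate γ s k * cos (waveNumber k * (y - x))
      - decayRate γ s k * cos (waveNumber k * (y + x)))
      = (2 * decayRate γ s k * sin (waveNumber k * x)) * (D y * sin (waveNumber k * y)) := by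
    intro y
    rw [mul_sub (waveNumber k), mul_add (waveNumber k), cos_sub, cos_add]; ring
  simp only [e2]
  rw [intervalIntegral.integral_const_mul]
  ring

/-- `A e^{-sA}` is bounded on continuous functions by the `L¹` norm of its kernel. -/
lemma abs_sineSeries_decayRate_le {γ : ℝ} (hγ : 0 < γ) {s : ℝ} (hs : 0 < s) {D : ℝ → ℝ}
    (hD : Continuous D) {η : ℝ} (hη : ∀ y, |D y| ≤ η) (x : ℝ) :
    |sineSeries (fun k => decayRate γ s k * sineCoeff D k) x|
      ≤ η * ∫ z in (-1:ℝ)..1, |decayKernel γ s z| := by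
  have hη0 : 0 ≤ η := (abs_nonneg _).trans (hη 0)
  rw [sineSeries_decayRate_eq hγ hs hD hη]
  have hc := continuous_decayKernel hγ hs
  have hca := hc.abs
  have h1 := intervalIntegral.norm_integral_le_of_norm_le (a := 0) (b := 1) (μ := volume)
    (f := fun y => D y * (decayKernel γ s (y - x) - decayKernel γ s (y + x)))
    (g := fun y => η * (|decayKernel γ s (x - y)| + |decayKernel γ s (x + y)|)) (by norm_num)
    (.of_forall fun y _ => by
      rw [norm_mul, Real.norm_eq_abs, Real.norm_eq_abs, ← decayKernel_neg γ s (x - y), neg_sub,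
        add_comm x y]
      gcongr
      · exact hη y
      · exact abs_sub _ _)
    (by apply Continuous.intervalIntegrable; fun_prop)
  rw [intervalIntegral.integral_const_mul, intervalIntegral.integral_add
    (by apply Continuous.intervalIntegrable; fun_prop)
    (by apply Continuous.intervalIntegrable; fun_prop),
    intervalIntegral.integral_comp_sub_left (fun z => |decayKernel γ s z|),
    intervalIntegral.integral_comp_add_left (fun z => |decayKernel γ s z|), sub_zero, add_zero,
    intervalIntegral.integral_add_adjacent_intervals (hca.intervalIntegrable _ _)
      (hca.intervalIntegrable _ _)] at h1
  have hp : Function.Periodic (fun z => |decayKernel γ s z|) 2 := fun z => by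
    simp only [decayKernel_periodic γ s z]
  have h2 := hp.intervalIntegral_add_eq (x - 1) (-1)
  rw [show x - 1 + 2 = x + 1 by ring, show (-1:ℝ) + 2 = 1 by norm_num] at h2
  rwa [h2] at h1

/-- `h` is continuous, bounded by `M`, and locally `θ`-Hölder in time, uniformly in space. -/
structure IsBoundedTimeHolder (h : ℝ → ℝ → ℝ) (M H θ : ℝ) : Prop where
  continuous : Continuous (Function.uncurry h)
  bound : ∀ t x, |h t x| ≤ M
  holder : ∀ t t' x, |t - t'| ≤ 1 → |h t x - h t' x| ≤ H * |t - t'| ^ θ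
  const_nonneg : 0 ≤ H

/-- The `k`-th sine coefficient of the bounded solution of `∂ₜu + Au = h`. -/
noncomputable def linearMode (γ : ℝ) (h : ℝ → ℝ → ℝ) (k : ℕ) (t : ℝ) : ℝ :=
  decayConv (eigenvalue γ k) (fun r => sineCoeff (h r) k) t

/-- The bounded solution of `∂ₜu + Au = h`. -/
noncomputable def linearSol (γ : ℝ) (h : ℝ → ℝ → ℝ) (t x : ℝ) : ℝ :=
  sineSeries (fun k => linearMode γ h k t) x

lemma continuous_slice {h : ℝ → ℝ → ℝ} (hh : Continuous (Function.uncurry h)) (t : ℝ) :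
    Continuous (h t) := hh.comp (by fun_prop : Continuous fun x : ℝ => (t, x))

lemma abs_linearMode_le {γ : ℝ} (hγ : 0 < γ) {h : ℝ → ℝ → ℝ} {M : ℝ}
    (hM : ∀ t, ∀ x ∈ Icc (0:ℝ) 1, |h t x| ≤ M) (k : ℕ) (t : ℝ) :
    |linearMode γ h k t| ≤ M * (1 / eigenvalue γ k) :=
  (abs_decayConv_le (eigenvalue_pos hγ k) (fun r => abs_sineCoeff_le (hM r) k) t).trans_eq
    (by ring)

lemma hasDerivAt_linearMode {γ : ℝ} (hγ : 0 < γ) {h : ℝ → ℝ → ℝ} {M : ℝ}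
    (hh : Continuous (Function.uncurry h)) (hM : ∀ t x, |h t x| ≤ M) (k : ℕ) (t : ℝ) :
    HasDerivAt (linearMode γ h k)
      (sineCoeff (h t) k - eigenvalue γ k * linearMode γ h k t) t :=
  hasDerivAt_decayConv (eigenvalue_pos hγ k) (continuous_sineCoeff hh k)
    (fun r => abs_sineCoeff_le (fun x _ => hM r x) k) t

lemma continuous_linearMode {γ : ℝ} (hγ : 0 < γ) {h : ℝ → ℝ → ℝ} {M : ℝ}
    (hh : Continuous (Function.uncurry h)) (hM : ∀ t x, |h t x| ≤ M) (k : ℕ) :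
    Continuous (linearMode γ h k) :=
  continuous_iff_continuousAt.2 fun t => (hasDerivAt_linearMode hγ hh hM k t).continuousAt

lemma continuous_linearSol {γ : ℝ} (hγ : 0 < γ) {h : ℝ → ℝ → ℝ} {M : ℝ}
    (hh : Continuous (Function.uncurry h)) (hM : ∀ t x, |h t x| ≤ M) :
    Continuous (Function.uncurry (linearSol γ h)) :=
  continuous_sineSeries (X := ℝ × ℝ) (a := fun k p => linearMode γ h k p.1) (y := fun p => p.2)
    (fun k => (continuous_linearMode hγ hh hM k).comp continuous_fst) continuous_snd
    ((summable_inv_eigenvalue hγ).mul_left M)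
    (fun k p => abs_linearMode_le hγ (fun t x _ => hM t x) k p.1)

lemma sineCoeff_linearSol {γ : ℝ} (hγ : 0 < γ) {h : ℝ → ℝ → ℝ} {M : ℝ}
    (hM : ∀ t, ∀ x ∈ Icc (0:ℝ) 1, |h t x| ≤ M) (t : ℝ) (k : ℕ) :
    sineCoeff (linearSol γ h t) k = linearMode γ h k t :=
  sineCoeff_sineSeries ((summable_inv_eigenvalue hγ).mul_left M)
    (fun k => abs_linearMode_le hγ hM k t) k

/-- The integrand `A e^{-sA} (h(t) - h(t-s))` in the formula for the time derivative of the
bounded solution. -/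
noncomputable def timeDerivIntegrand (γ : ℝ) (h : ℝ → ℝ → ℝ) (t x s : ℝ) : ℝ :=
  sineSeries (fun k => decayRate γ s k * sineCoeff (fun y => h t y - h (t - s) y) k) x

/-- An integrable majorant of `timeDerivIntegrand`. -/
noncomputable def timeDerivMajorant (γ M H θ s : ℝ) : ℝ :=
  if s ≤ 1 then H * (2 * kernelConst γ (θ / 2) / (θ / 2)) * s ^ (θ / 2 - 1)
  else 8 * M * (∑' k, 1 / eigenvalue γ k) * s ^ (-2:ℝ)

lemma integrableOn_timeDerivMajorant (γ M H : ℝ) {θ : ℝ} (hθ : 0 < θ) :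
    IntegrableOn (timeDerivMajorant γ M H θ) (Ioi 0) := by
  rw [← Ioc_union_Ioi_eq_Ioi (zero_le_one (α := ℝ))]
  refine IntegrableOn.union ?_ ?_
  · have h1 := (intervalIntegral.intervalIntegrable_rpow' (a := 0) (b := 1) (r := θ / 2 - 1)
      (by linarith)).const_mul (H * (2 * kernelConst γ (θ / 2) / (θ / 2)))
    rw [intervalIntegrable_iff_integrableOn_Ioc_of_le zero_le_one] at h1
    refine h1.congr_fun (fun s hs => ?_) measurableSet_Ioc
    simp only [timeDerivMajorant, if_pos hs.2]
  · have h1 : IntegrableOn (fun s : ℝ => 8 * M * (∑' k, 1 / eigenvalue γ k) * s ^ (-2:ℝ)) (Ioi 1) :=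
      (integrableOn_Ioi_rpow_of_lt (by norm_num) zero_lt_one).const_mul _
    refine h1.congr_fun (fun s hs => ?_) measurableSet_Ioi
    simp only [timeDerivMajorant, if_neg (not_le.2 (mem_Ioi.1 hs))]

lemma abs_sineCoeff_increment_le {h : ℝ → ℝ → ℝ} {M : ℝ} (hM : ∀ t x, |h t x| ≤ M) (t t' : ℝ)
    (k : ℕ) : |sineCoeff (fun y => h t y - h t' y) k| ≤ 2 * M :=
  abs_sineCoeff_le (fun x _ => (abs_sub _ _).trans (by linarith [hM t x, hM t' x])) k

lemma abs_decayRate_mul_increment_le {γ : ℝ} (hγ : 0 < γ) {h : ℝ → ℝ → ℝ} {M : ℝ}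
    (hM : ∀ t x, |h t x| ≤ M) (t s : ℝ) (k : ℕ) :
    |decayRate γ s k * sineCoeff (fun y => h t y - h (t - s) y) k| ≤ decayRate γ s k * (2 * M) := by
  rw [abs_mul, abs_of_nonneg (decayRate_nonneg hγ s k)]
  exact mul_le_mul_of_nonneg_left (abs_sineCoeff_increment_le hM t _ k) (decayRate_nonneg hγ s k)

lemma abs_timeDerivIntegrand_le {γ : ℝ} (hγ : 0 < γ) {h : ℝ → ℝ → ℝ} {M H θ : ℝ} (hθ : 0 < θ)
    (hθ1 : θ ≤ 1) (hh : IsBoundedTimeHolder h M H θ) (t x : ℝ) {s : ℝ} (hs : 0 < s) :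
    |timeDerivIntegrand γ h t x s| ≤ timeDerivMajorant γ M H θ s := by
  have hM0 : 0 ≤ M := (abs_nonneg _).trans (hh.bound 0 0)
  have hH0 := hh.const_nonneg
  have hD : Continuous fun y => h t y - h (t - s) y :=
    (continuous_slice hh.continuous t).sub (continuous_slice hh.continuous (t - s))
  unfold timeDerivMajorant
  split_ifs with h1
  · have h2 := abs_sineSeries_decayRate_le hγ hs hD (η := H * s ^ θ) (fun y => by
      have := hh.holder t (t - s) y (by rw [sub_sub_cancel, abs_of_pos hs]; exact h1)
      rwa [sub_sub_cancel, abs_of_pos hs] at this) x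
    refine h2.trans ?_
    have h3 := integral_abs_decayKernel_le hγ (δ := θ / 2) (by linarith) (by linarith) hs
    calc H * s ^ θ * ∫ z in (-1:ℝ)..1, |decayKernel γ s z|
        ≤ H * s ^ θ * (2 * kernelConst γ (θ / 2) / (θ / 2) * s ^ (-1 - θ / 2)) := by gcongr
      _ = H * (2 * kernelConst γ (θ / 2) / (θ / 2)) * (s ^ θ * s ^ (-1 - θ / 2)) := by ring
      _ = _ := by rw [← rpow_add hs]; congr 2; ring
  · have h2 := abs_sineSeries_le (a := fun k => decayRate γ s k
      * sineCoeff (fun y => h t y - h (t - s) y) k)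
      (((summable_inv_eigenvalue hγ).mul_left (2 / s ^ 2)).mul_right (2 * M)) (fun k =>
        (abs_decayRate_mul_increment_le hγ hh.bound t s k).trans
          (mul_le_mul_of_nonneg_right (decayRate_le hγ hs k) (by positivity))) x
    rw [tsum_mul_right, tsum_mul_left] at h2
    refine h2.trans_eq ?_
    rw [rpow_neg hs.le, rpow_two]
    ring

lemma continuous_timeDerivIntegrand {γ : ℝ} (hγ : 0 < γ) {h : ℝ → ℝ → ℝ} {M : ℝ}
    (hh : Continuous (Function.uncurry h)) (hM : ∀ t x, |h t x| ≤ M) {s : ℝ} (hs : 0 < s) :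
    Continuous fun p : ℝ × ℝ => timeDerivIntegrand γ h p.1 p.2 s := by
  refine continuous_sineSeries (a := fun k (p : ℝ × ℝ) =>
    decayRate γ s k * sineCoeff (fun y => h p.1 y - h (p.1 - s) y) k) (y := fun p => p.2)
    (fun k => ?_) continuous_snd ((summable_decayRate hγ hs).mul_right (2 * M))
    (fun k p => abs_decayRate_mul_increment_le hγ hM p.1 s k)
  refine ((continuous_sineCoeff (h := fun t y => h t y - h (t - s) y) ?_ k).comp
    continuous_fst).const_mul _
  simp only [Function.uncurry_def] at hh ⊢
  exact hh.sub (hh.comp (by fun_prop : Continuous fun p : ℝ × ℝ => (p.1 - s, p.2)))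

lemma aestronglyMeasurable_timeDerivIntegrand {γ : ℝ} (hγ : 0 < γ) {h : ℝ → ℝ → ℝ} {M : ℝ}
    (hh : Continuous (Function.uncurry h)) (hM : ∀ t x, |h t x| ≤ M) (t : ℝ)
    {X : Type*} [TopologicalSpace X] [MeasurableSpace X] [OpensMeasurableSpace X]
    [SecondCountableTopology X]
    {μ : Measure X} {x s : X → ℝ} (hx : Continuous x) (hs : Continuous s)
    (hμ : ∀ᵐ p ∂μ, 0 < s p) :
    AEStronglyMeasurable (fun p => timeDerivIntegrand γ h t (x p) (s p)) μ := by
  refine aestronglyMeasurable_of_tendsto_ae atTop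
    (f := fun N p => ∑ k ∈ Finset.range N, 2 * (decayRate γ (s p) k
      * sineCoeff (fun y => h t y - h (t - s p) y) k) * sin (waveNumber k * x p))
    (fun N => Continuous.aestronglyMeasurable ?_) ?_
  · refine continuous_finsetSum _ fun k _ => ?_
    have h1 : Continuous fun p => sineCoeff (fun y => h t y - h (t - s p) y) k :=
      (continuous_sineCoeff (h := fun r y => h t y - h (t - r) y) (by
        simp only [Function.uncurry_def] at hh ⊢
        exact (hh.comp (by fun_prop : Continuous fun p : ℝ × ℝ => (t, p.2))).sub
          (hh.comp (by fun_prop : Continuous fun p : ℝ × ℝ => (t - p.1, p.2)))) k).comp hs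
    unfold decayRate
    fun_prop
  · filter_upwards [hμ] with p hp
    exact (Summable.of_norm_bounded (((summable_decayRate hγ hp).mul_right (2 * M)).mul_left 2)
      (fun k => abs_sineTerm_le (fun k => abs_decayRate_mul_increment_le hγ hM t (s p) k) k
        (x p))).hasSum.tendsto_sum_nat

/-- The time derivative of the bounded solution. -/
noncomputable def linearSolDeriv (γ : ℝ) (h : ℝ → ℝ → ℝ) (t x : ℝ) : ℝ :=
  ∫ s in Ioi (0:ℝ), timeDerivIntegrand γ h t x s

lemma continuous_linearSolDeriv {γ : ℝ} (hγ : 0 < γ) {h : ℝ → ℝ → ℝ} {M H θ : ℝ} (hθ : 0 < θ)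
    (hθ1 : θ ≤ 1) (hh : IsBoundedTimeHolder h M H θ) :
    Continuous (Function.uncurry (linearSolDeriv γ h)) := by
  have hpos : ∀ᵐ s ∂volume.restrict (Ioi (0:ℝ)), 0 < s := ae_restrict_mem measurableSet_Ioi
  refine continuous_of_dominated (F := fun (p : ℝ × ℝ) s => timeDerivIntegrand γ h p.1 p.2 s)
    (fun p => aestronglyMeasurable_timeDerivIntegrand hγ hh.continuous hh.bound p.1
      continuous_const continuous_id hpos) (fun p => ?_)
    (integrableOn_timeDerivMajorant γ M H hθ) ?_
  · filter_upwards [hpos] with s hs using abs_timeDerivIntegrand_le hγ hθ hθ1 hh p.1 p.2 hs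
  · filter_upwards [hpos] with s hs using continuous_timeDerivIntegrand hγ hh.continuous hh.bound hs

lemma sineCoeff_linearSolDeriv {γ : ℝ} (hγ : 0 < γ) {h : ℝ → ℝ → ℝ} {M H θ : ℝ} (hθ : 0 < θ)
    (hθ1 : θ ≤ 1) (hh : IsBoundedTimeHolder h M H θ) (t : ℝ) (k : ℕ) :
    sineCoeff (linearSolDeriv γ h t) k
      = sineCoeff (h t) k - eigenvalue γ k * linearMode γ h k t := by
  have hpos : ∀ᵐ s ∂volume.restrict (Ioi (0:ℝ)), 0 < s := ae_restrict_mem measurableSet_Ioi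
  have hpos2 : ∀ᵐ p ∂(volume.restrict (Ioc (0:ℝ) 1)).prod (volume.restrict (Ioi (0:ℝ))),
      0 < p.2 := Measure.quasiMeasurePreserving_snd.ae hpos
  have hii : Integrable (Function.uncurry fun x s =>
      timeDerivIntegrand γ h t x s * sin (waveNumber k * x))
      ((volume.restrict (Ioc (0:ℝ) 1)).prod (volume.restrict (Ioi (0:ℝ)))) := by
    have hm : Integrable (fun p : ℝ × ℝ => timeDerivMajorant γ M H θ p.2)
        ((volume.restrict (Ioc (0:ℝ) 1)).prod (volume.restrict (Ioi (0:ℝ)))) :=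
      Integrable.comp_snd (integrableOn_timeDerivMajorant γ M H hθ) _
    refine hm.mono' ?_ ?_
    · exact (aestronglyMeasurable_timeDerivIntegrand hγ hh.continuous hh.bound t
        continuous_fst continuous_snd hpos2).mul
        (by fun_prop : Continuous fun p : ℝ × ℝ => sin (waveNumber k * p.1)).aestronglyMeasurable
    · filter_upwards [hpos2] with p hp
      simp only [Function.uncurry]
      rw [norm_mul]
      calc _ ≤ timeDerivMajorant γ M H θ p.2 * 1 := by
            gcongr
            · exact (abs_nonneg _).trans (abs_timeDerivIntegrand_le hγ hθ hθ1 hh t p.1 hp)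
            · exact abs_timeDerivIntegrand_le hγ hθ hθ1 hh t p.1 hp
            · exact abs_sin_le_one _
        _ = _ := mul_one _
  have hsw := integral_integral_swap hii
  have e1 : sineCoeff (linearSolDeriv γ h t) k = ∫ x in Ioc (0:ℝ) 1, ∫ s in Ioi (0:ℝ),
      timeDerivIntegrand γ h t x s * sin (waveNumber k * x) := by
    unfold sineCoeff linearSolDeriv
    rw [intervalIntegral.integral_of_le zero_le_one]
    simp only [integral_mul_const]
  rw [e1, hsw, linearMode, sub_mul_decayConv (eigenvalue_pos hγ k)
    (continuous_sineCoeff hh.continuous k)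
    (fun r => abs_sineCoeff_le (fun x _ => hh.bound r x) k) t]
  refine setIntegral_congr_fun measurableSet_Ioi fun s hs => ?_
  have h2 := sineCoeff_sineSeries ((summable_decayRate hγ hs).mul_right (2 * M))
    (fun k => abs_decayRate_mul_increment_le hγ hh.bound t s k) k
  unfold sineCoeff at h2
  rw [intervalIntegral.integral_of_le zero_le_one] at h2
  refine h2.trans ?_
  have h3 := sineCoeff_sub (continuous_slice hh.continuous t)
    (continuous_slice hh.continuous (t - s)) k
  unfold sineCoeff at h3
  rw [h3]
  rfl

lemma sineCoeff_integral {V : ℝ → ℝ → ℝ} (hV : Continuous (Function.uncurry V)) (a b : ℝ) (k : ℕ) :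
    sineCoeff (fun x => ∫ r in a..b, V r x) k = ∫ r in a..b, sineCoeff (V r) k := by
  unfold sineCoeff
  have hc : Continuous (Function.uncurry fun r x => V r x * sin (waveNumber k * x)) := by
    simp only [Function.uncurry_def] at hV ⊢
    fun_prop
  have hi : IntegrableOn (Function.uncurry fun r x => V r x * sin (waveNumber k * x))
      (uIoc a b ×ˢ uIoc 0 1) volume :=
    (hc.continuousOn.integrableOn_compact (isCompact_uIcc.prod isCompact_uIcc)).mono_set
      (prod_mono uIoc_subset_uIcc uIoc_subset_uIcc)
  rw [intervalIntegral_intervalIntegral_swap hi]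
  simp only [intervalIntegral.integral_mul_const]

lemma hasDerivAt_linearSol {γ : ℝ} (hγ : 0 < γ) {h : ℝ → ℝ → ℝ} {M H θ : ℝ} (hθ : 0 < θ)
    (hθ1 : θ ≤ 1) (hh : IsBoundedTimeHolder h M H θ) (t : ℝ) {x : ℝ} (hx : x ∈ Icc (0:ℝ) 1) :
    HasDerivAt (fun s => linearSol γ h s x) (linearSolDeriv γ h t x) t := by
  have hV := continuous_linearSolDeriv hγ hθ hθ1 hh
  have hu := continuous_linearSol hγ hh.continuous hh.bound
  have key : ∀ s, linearSol γ h s x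
      = linearSol γ h 0 x + ∫ r in (0:ℝ)..s, linearSolDeriv γ h r x := by
    intro s
    have hU : Continuous fun y => ∫ r in (0:ℝ)..s, linearSolDeriv γ h r y := by
      apply intervalIntegral.continuous_parametric_intervalIntegral_of_continuous'
      simp only [Function.uncurry_def] at hV ⊢
      exact hV.comp (by fun_prop : Continuous fun p : ℝ × ℝ => (p.2, p.1))
    refine eqOn_of_sineCoeff_eq (b := fun y => linearSol γ h 0 y
      + ∫ r in (0:ℝ)..s, linearSolDeriv γ h r y) (continuous_slice hu s)
      ((continuous_slice hu 0).add hU) (fun k => ?_) hx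
    have hM := fun t x (_ : x ∈ Icc (0:ℝ) 1) => hh.bound t x
    rw [sineCoeff_add (continuous_slice hu 0) hU, sineCoeff_integral hV,
      sineCoeff_linearSol hγ hM, sineCoeff_linearSol hγ hM]
    simp only [sineCoeff_linearSolDeriv hγ hθ hθ1 hh]
    rw [intervalIntegral.integral_eq_sub_of_hasDerivAt
      (fun r _ => hasDerivAt_linearMode hγ hh.continuous hh.bound k r)]
    · ring
    · apply Continuous.intervalIntegrable
      exact (continuous_sineCoeff hh.continuous k).sub
        ((continuous_linearMode hγ hh.continuous hh.bound k).const_mul _)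
  have hVx : Continuous fun r => linearSolDeriv γ h r x :=
    hV.comp (by fun_prop : Continuous fun r : ℝ => (r, x))
  have h1 := (intervalIntegral.integral_hasDerivAt_right (hVx.intervalIntegrable 0 t)
    (hVx.stronglyMeasurableAtFilter _ _) hVx.continuousAt).const_add (linearSol γ h 0 x)
  exact h1.congr_of_eventuallyEq (.of_forall key)

/-- The termwise derivative of `sineSeries a`. -/
noncomputable def sineSeriesDeriv (a : ℕ → ℝ) (x : ℝ) : ℝ :=
  ∑' k, 2 * a k * (waveNumber k * cos (waveNumber k * x))

lemma one_le_waveNumber (k : ℕ) : 1 ≤ waveNumber k :=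
  le_trans (by have := k.cast_nonneg (α := ℝ); linarith) (one_add_le_waveNumber k)

lemma hasDerivAt_sineSeries {a u : ℕ → ℝ} (hu : Summable fun k => waveNumber k ^ 2 * u k)
    (ha : ∀ k, |a k| ≤ u k) (x : ℝ) : HasDerivAt (sineSeries a) (sineSeriesDeriv a x) x := by
  refine hasDerivAt_tsum (g := fun k x => 2 * a k * sin (waveNumber k * x))
    (g' := fun k x => 2 * a k * (waveNumber k * cos (waveNumber k * x))) (y₀ := 0)
    (hu.mul_left 2) (fun k y => ?_) (fun k y => ?_) ?_ x
  · have := (((hasDerivAt_id y).const_mul (waveNumber k)).sin).const_mul (2 * a k)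
    exact this.congr_deriv (by simp only [mul_one, id]; ring)
  · have h1 := one_le_waveNumber k
    rw [norm_mul, norm_mul, norm_mul, Real.norm_eq_abs, Real.norm_eq_abs, Real.norm_eq_abs,
      Real.norm_eq_abs, abs_two, abs_of_pos (waveNumber_pos k)]
    calc 2 * |a k| * (waveNumber k * |cos (waveNumber k * y)|)
        ≤ 2 * u k * (waveNumber k ^ 2 * 1) := by
          have := (abs_nonneg _).trans (ha k)
          gcongr
          · exact ha k
          · exact le_self_pow₀ h1 two_ne_zero
          · exact abs_cos_le_one _
      _ = _ := by ring
  · simp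

lemma hasDerivAt_sineSeriesDeriv {a u : ℕ → ℝ} (hu : Summable fun k => waveNumber k ^ 2 * u k)
    (ha : ∀ k, |a k| ≤ u k) (x : ℝ) :
    HasDerivAt (sineSeriesDeriv a) (sineSeries (fun k => -(waveNumber k ^ 2 * a k)) x) x := by
  have hau : ∀ k, |a k| ≤ waveNumber k ^ 2 * u k := fun k =>
    (ha k).trans (le_mul_of_one_le_left ((abs_nonneg _).trans (ha k))
      (one_le_pow₀ (one_le_waveNumber k)))
  refine hasDerivAt_tsum (g := fun k x => 2 * a k * (waveNumber k * cos (waveNumber k * x)))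
    (g' := fun k x => 2 * -(waveNumber k ^ 2 * a k) * sin (waveNumber k * x)) (y₀ := 1 / 2)
    (hu.mul_left 2) (fun k y => ?_) (fun k y => ?_) ?_ x
  · have := ((((hasDerivAt_id y).const_mul (waveNumber k)).cos).const_mul
      (waveNumber k)).const_mul (2 * a k)
    exact this.congr_deriv (by simp only [mul_one, id]; ring)
  · refine abs_sineTerm_le (a := fun k => -(waveNumber k ^ 2 * a k))
      (u := fun k => waveNumber k ^ 2 * u k) (fun k => ?_) k y
    rw [abs_neg, abs_mul, abs_of_nonneg (sq_nonneg _)]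
    exact mul_le_mul_of_nonneg_left (ha k) (sq_nonneg _)
  · refine Summable.of_norm_bounded (hu.mul_left 2) fun k => ?_
    have h1 := one_le_waveNumber k
    rw [norm_mul, norm_mul, norm_mul, Real.norm_eq_abs, Real.norm_eq_abs, Real.norm_eq_abs,
      Real.norm_eq_abs, abs_two, abs_of_pos (waveNumber_pos k)]
    calc 2 * |a k| * (waveNumber k * |cos (waveNumber k * (1 / 2))|)
        ≤ 2 * u k * (waveNumber k ^ 2 * 1) := by
          have := (abs_nonneg _).trans (ha k)
          gcongr
          · exact ha k
          · exact le_self_pow₀ h1 two_ne_zero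
          · exact abs_cos_le_one _
      _ = _ := by ring

/-- The derivative of the solution of `W'' = q`, `W 0 = W 1 = 0`. -/
noncomputable def dirichletSlope (q : ℝ → ℝ) (x : ℝ) : ℝ :=
  (∫ y in (0:ℝ)..x, q y) - ∫ z in (0:ℝ)..1, ∫ y in (0:ℝ)..z, q y

lemma hasDerivAt_integral_of_continuous {q : ℝ → ℝ} (hq : Continuous q) (a x : ℝ) :
    HasDerivAt (fun x => ∫ y in a..x, q y) (q x) x :=
  intervalIntegral.integral_hasDerivAt_right (hq.intervalIntegrable _ _)
    (hq.stronglyMeasurableAtFilter _ _) hq.continuousAt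

lemma hasDerivAt_dirichletSlope {q : ℝ → ℝ} (hq : Continuous q) (x : ℝ) :
    HasDerivAt (dirichletSlope q) (q x) x :=
  (hasDerivAt_integral_of_continuous hq 0 x).sub_const _

/-- A continuous function whose sine coefficients are those of `W` with `-W'' = -q` and Dirichlet
conditions is twice differentiable with second derivative `q`. -/
lemma hasDerivAt_of_sineCoeff_eq {w q : ℝ → ℝ} (hw : Continuous w) (hq : Continuous q)
    (h : ∀ k, sineCoeff q k = -(waveNumber k ^ 2 * sineCoeff w k)) {x : ℝ} (hx : x ∈ Ioo (0:ℝ) 1) :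
    HasDerivAt w (dirichletSlope q x) x := by
  have hs : Continuous (dirichletSlope q) :=
    continuous_iff_continuousAt.2 fun x => (hasDerivAt_dirichletSlope hq x).continuousAt
  set W : ℝ → ℝ := fun x => ∫ y in (0:ℝ)..x, dirichletSlope q y with hW
  have hWd : ∀ x, HasDerivAt W (dirichletSlope q x) x := hasDerivAt_integral_of_continuous hs 0
  have hWc : Continuous W := continuous_iff_continuousAt.2 fun x => (hWd x).continuousAt
  have hp : Continuous fun z => ∫ y in (0:ℝ)..z, q y :=
    continuous_iff_continuousAt.2 fun x => (hasDerivAt_integral_of_continuous hq 0 x).continuousAt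
  have hW0 : W 0 = 0 := by simp [hW]
  have hW1 : W 1 = 0 := by
    simp only [hW, dirichletSlope]
    rw [intervalIntegral.integral_sub (hp.intervalIntegrable _ _) (by simp)]
    simp
  have hcoef : ∀ k, sineCoeff w k = sineCoeff W k := by
    intro k
    have h1 := integral_deriv_deriv_mul_sin (κ := waveNumber k) (zero_le_one (α := ℝ))
      (fun x _ => hWd x) (fun x _ => hasDerivAt_dirichletSlope hq x) hq.continuousOn
      (by rw [sub_zero, mul_one]; unfold waveNumber; exact_mod_cast sin_nat_mul_pi (k + 1))
    simp only [sub_zero, hW0, hW1, zero_mul, mul_zero, neg_zero, zero_sub] at h1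
    have h2 := h k
    have h3 : sineCoeff q k = -(waveNumber k ^ 2 * sineCoeff W k) := h1
    rw [h3, neg_inj] at h2
    exact (mul_left_cancel₀ (pow_ne_zero 2 (waveNumber_pos k).ne') h2).symm
  refine (hWd x).congr_of_eventuallyEq ?_
  filter_upwards [Icc_mem_nhds hx.1 hx.2] with y hy
  exact eqOn_of_sineCoeff_eq hw hWc hcoef hy

/-- The second space derivative of `linearSol γ h`. -/
noncomputable def linearSolDxx (γ : ℝ) (h : ℝ → ℝ → ℝ) (t x : ℝ) : ℝ :=
  sineSeries (fun k => -(waveNumber k ^ 2 * linearMode γ h k t)) x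

/-- The fourth space derivative of `linearSol γ h`, as given by the equation. -/
noncomputable def linearSolDxxxx (γ : ℝ) (h : ℝ → ℝ → ℝ) (t x : ℝ) : ℝ :=
  1 / γ * (h t x - linearSolDeriv γ h t x + linearSol γ h t x + linearSolDxx γ h t x)

lemma summable_mode_bound {γ : ℝ} (hγ : 0 < γ) (M : ℝ) :
    Summable fun k => waveNumber k ^ 2 * (M * (1 / eigenvalue γ k)) :=
  ((summable_waveNumber_sq_div_eigenvalue hγ).mul_left M).congr fun k => by ring

lemma abs_linearSolDxx_coeff_le {γ : ℝ} (hγ : 0 < γ) {h : ℝ → ℝ → ℝ} {M : ℝ}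
    (hM : ∀ t x, |h t x| ≤ M) (k : ℕ) (t : ℝ) :
    |-(waveNumber k ^ 2 * linearMode γ h k t)| ≤ waveNumber k ^ 2 * (M * (1 / eigenvalue γ k)) := by
  rw [abs_neg, abs_mul, abs_of_nonneg (sq_nonneg _)]
  exact mul_le_mul_of_nonneg_left (abs_linearMode_le hγ (fun t x _ => hM t x) k t) (sq_nonneg _)

lemma continuous_linearSolDxx {γ : ℝ} (hγ : 0 < γ) {h : ℝ → ℝ → ℝ} {M : ℝ}
    (hh : Continuous (Function.uncurry h)) (hM : ∀ t x, |h t x| ≤ M) :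
    Continuous (Function.uncurry (linearSolDxx γ h)) :=
  continuous_sineSeries (X := ℝ × ℝ)
    (a := fun k p => -(waveNumber k ^ 2 * linearMode γ h k p.1)) (y := fun p => p.2)
    (fun k => (((continuous_linearMode hγ hh hM k).comp continuous_fst).const_mul _).neg)
    continuous_snd (summable_mode_bound hγ M) (fun k p => abs_linearSolDxx_coeff_le hγ hM k p.1)

lemma continuous_linearSolDxxxx {γ : ℝ} (hγ : 0 < γ) {h : ℝ → ℝ → ℝ} {M H θ : ℝ} (hθ : 0 < θ)
    (hθ1 : θ ≤ 1) (hh : IsBoundedTimeHolder h M H θ) :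
    Continuous (Function.uncurry (linearSolDxxxx γ h)) :=
  (((hh.continuous.sub (continuous_linearSolDeriv hγ hθ hθ1 hh)).add
    (continuous_linearSol hγ hh.continuous hh.bound)).add
      (continuous_linearSolDxx hγ hh.continuous hh.bound)).const_mul (1 / γ)

lemma sineCoeff_linearSolDxxxx {γ : ℝ} (hγ : 0 < γ) {h : ℝ → ℝ → ℝ} {M H θ : ℝ} (hθ : 0 < θ)
    (hθ1 : θ ≤ 1) (hh : IsBoundedTimeHolder h M H θ) (t : ℝ) (k : ℕ) :
    sineCoeff (linearSolDxxxx γ h t) k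
      = -(waveNumber k ^ 2 * sineCoeff (linearSolDxx γ h t) k) := by
  have c1 := continuous_slice hh.continuous t
  have c2 := continuous_slice (continuous_linearSolDeriv hγ hθ hθ1 hh) t
  have c3 := continuous_slice (continuous_linearSol hγ hh.continuous hh.bound) t
  have c4 := continuous_slice (continuous_linearSolDxx hγ hh.continuous hh.bound) t
  have e4 : sineCoeff (linearSolDxx γ h t) k = -(waveNumber k ^ 2 * linearMode γ h k t) :=
    sineCoeff_sineSeries (summable_mode_bound hγ M)
      (fun k => abs_linearSolDxx_coeff_le hγ hh.bound k t) k
  have e := sineCoeff_const_mul (1 / γ) (fun x => h t x - linearSolDeriv γ h t x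
    + linearSol γ h t x + linearSolDxx γ h t x) k
  rw [sineCoeff_add (a := fun x => h t x - linearSolDeriv γ h t x + linearSol γ h t x)
    ((c1.sub c2).add c3) c4, sineCoeff_add (a := fun x => h t x - linearSolDeriv γ h t x)
    (c1.sub c2) c3, sineCoeff_sub c1 c2,
    sineCoeff_linearSol hγ (fun t x _ => hh.bound t x), e4,
    sineCoeff_linearSolDeriv hγ hθ hθ1 hh] at e
  refine e.trans ?_
  rw [e4]
  unfold eigenvalue
  field_simp
  ring

lemma dx_two_linearSol {γ : ℝ} (hγ : 0 < γ) {h : ℝ → ℝ → ℝ} {M : ℝ}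
    (hM : ∀ t x, |h t x| ≤ M) (t : ℝ) :
    iteratedDeriv 1 (linearSol γ h t) = sineSeriesDeriv (fun k => linearMode γ h k t) ∧
      iteratedDeriv 2 (linearSol γ h t) = linearSolDxx γ h t := by
  have hb := fun k => abs_linearMode_le hγ (fun t x _ => hM t x) k t
  have h1 : iteratedDeriv 1 (linearSol γ h t) = sineSeriesDeriv (fun k => linearMode γ h k t) := by
    rw [iteratedDeriv_one]
    exact funext fun x => (hasDerivAt_sineSeries (summable_mode_bound hγ M) hb x).deriv
  refine ⟨h1, ?_⟩
  rw [iteratedDeriv_succ, h1]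
  exact funext fun x => (hasDerivAt_sineSeriesDeriv (summable_mode_bound hγ M) hb x).deriv

lemma continuous_sineSeriesDeriv_linearMode {γ : ℝ} (hγ : 0 < γ) {h : ℝ → ℝ → ℝ} {M : ℝ}
    (hh : Continuous (Function.uncurry h)) (hM : ∀ t x, |h t x| ≤ M) :
    Continuous fun p : ℝ × ℝ => sineSeriesDeriv (fun k => linearMode γ h k p.1) p.2 := by
  unfold sineSeriesDeriv
  refine continuous_tsum (fun k => ?_) ((summable_mode_bound hγ M).mul_left 2) (fun k p => ?_)
  · have := (continuous_linearMode hγ hh hM k).comp (continuous_fst (X := ℝ) (Y := ℝ))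
    simp only [Function.comp_def] at this
    fun_prop
  · have h1 := one_le_waveNumber k
    have hb := abs_linearMode_le hγ (fun t x _ => hM t x) k p.1
    rw [norm_mul, norm_mul, norm_mul, Real.norm_eq_abs, Real.norm_eq_abs, Real.norm_eq_abs,
      Real.norm_eq_abs, abs_two, abs_of_pos (waveNumber_pos k)]
    calc 2 * |linearMode γ h k p.1| * (waveNumber k * |cos (waveNumber k * p.2)|)
        ≤ 2 * (M * (1 / eigenvalue γ k)) * (waveNumber k ^ 2 * 1) := by
          have := (abs_nonneg _).trans hb
          gcongr
          · exact le_self_pow₀ h1 two_ne_zero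
          · exact abs_cos_le_one _
      _ = _ := by ring

lemma hasDerivAt_iteratedDeriv_linearSol {γ : ℝ} (hγ : 0 < γ) {h : ℝ → ℝ → ℝ} {M H θ : ℝ}
    (hθ : 0 < θ) (hθ1 : θ ≤ 1) (hh : IsBoundedTimeHolder h M H θ) (t : ℝ) {x : ℝ}
    (hx : x ∈ Ioo (0:ℝ) 1) :
    HasDerivAt (iteratedDeriv 2 (linearSol γ h t)) (dirichletSlope (linearSolDxxxx γ h t) x) x ∧
      HasDerivAt (iteratedDeriv 3 (linearSol γ h t)) (linearSolDxxxx γ h t x) x := by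
  have hq := continuous_slice (continuous_linearSolDxxxx hγ hθ hθ1 hh) t
  have h2 : ∀ y ∈ Ioo (0:ℝ) 1, HasDerivAt (iteratedDeriv 2 (linearSol γ h t))
      (dirichletSlope (linearSolDxxxx γ h t) y) y := by
    intro y hy
    rw [(dx_two_linearSol hγ hh.bound t).2]
    exact hasDerivAt_of_sineCoeff_eq
      (continuous_slice (continuous_linearSolDxx hγ hh.continuous hh.bound) t) hq
      (sineCoeff_linearSolDxxxx hγ hθ hθ1 hh t) hy
  refine ⟨h2 x hx, (hasDerivAt_dirichletSlope hq x).congr_of_eventuallyEq ?_⟩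
  filter_upwards [Ioo_mem_nhds hx.1 hx.2] with y hy
  rw [iteratedDeriv_succ]
  exact (h2 y hy).deriv

lemma continuous_dirichletSlope {q : ℝ → ℝ → ℝ} (hq : Continuous (Function.uncurry q)) :
    Continuous fun p : ℝ × ℝ => dirichletSlope (q p.1) p.2 := by
  have h1 : Continuous fun p : ℝ × ℝ => ∫ y in (0:ℝ)..p.2, q p.1 y :=
    intervalIntegral.continuous_parametric_intervalIntegral_of_continuous
      (f := fun (p : ℝ × ℝ) y => q p.1 y)
      (hq.comp (by fun_prop : Continuous fun z : (ℝ × ℝ) × ℝ => (z.1.1, z.2))) continuous_snd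
  refine h1.sub ?_
  exact intervalIntegral.continuous_parametric_intervalIntegral_of_continuous'
    (f := fun (p : ℝ × ℝ) z => ∫ y in (0:ℝ)..z, q p.1 y)
    (h1.comp (by fun_prop : Continuous fun z : (ℝ × ℝ) × ℝ => (z.1.1, z.2))) 0 1

/-- A bounded solution of the linear equation with Hölder right-hand side which is periodic is a
classical solution. -/
lemma isPeriodicClassicalSolution_linearSol {γ ω : ℝ} (hγ : 0 < γ) {h : ℝ → ℝ → ℝ} {M H θ : ℝ}
    (hθ : 0 < θ) (hθ1 : θ ≤ 1) (hh : IsBoundedTimeHolder h M H θ)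
    {n : ℕ} {τ : Fin n → ℝ} {f : (Fin n → ℝ) → ℝ} {g : ℝ → ℝ → ℝ}
    (hper : ∀ t x, linearSol γ h (t + ω) x = linearSol γ h t x)
    (heq : ∀ t, ∀ x ∈ Ioo (0:ℝ) 1, h t x = g t x + f (fun k => linearSol γ h (t - τ k) x)) :
    IsPeriodicClassicalSolution γ ω τ f g (linearSol γ h) := by
  have hu := continuous_linearSol hγ hh.continuous hh.bound
  have hdt : ∀ t, ∀ x ∈ Ioo (0:ℝ) 1, HasDerivAt (fun s => linearSol γ h s x)
      (linearSolDeriv γ h t x) t := fun t x hx =>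
    hasDerivAt_linearSol hγ hθ hθ1 hh t (Ioo_subset_Icc_self hx)
  have hd2 := fun t => dx_two_linearSol hγ hh.bound t
  have hd3 := fun t x hx => hasDerivAt_iteratedDeriv_linearSol hγ hθ hθ1 hh t (x := x) hx
  have hb := fun t k => abs_linearMode_le hγ (fun t x _ => hh.bound t x) k t
  have e3 : ∀ t, ∀ x ∈ Ioo (0:ℝ) 1, dx 3 (linearSol γ h) t x
      = dirichletSlope (linearSolDxxxx γ h t) x := fun t x hx => by
    rw [dx, iteratedDeriv_succ]; exact (hd3 t x hx).1.deriv
  have e4 : ∀ t, ∀ x ∈ Ioo (0:ℝ) 1, dx 4 (linearSol γ h) t x = linearSolDxxxx γ h t x :=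
    fun t x hx => by
      rw [dx, iteratedDeriv_succ]; exact (hd3 t x hx).2.deriv
  have e2 : ∀ t x, dx 2 (linearSol γ h) t x = linearSolDxx γ h t x := fun t x => by
    rw [dx, (hd2 t).2]
  have hw := continuous_linearSolDxx hγ hh.continuous hh.bound
  refine ⟨hu.continuousOn, hper, fun t x hx => (hdt t x hx).differentiableAt, ?_, ?_, ?_, ?_, ?_,
    fun t => ?_⟩
  · intro t x hx k hk
    interval_cases k
    · rw [iteratedDeriv_zero]
      exact (hasDerivAt_sineSeries (summable_mode_bound hγ M) (hb t) x).differentiableAt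
    · rw [(hd2 t).1]
      exact (hasDerivAt_sineSeriesDeriv (summable_mode_bound hγ M) (hb t) x).differentiableAt
    · exact (hd3 t x hx).1.differentiableAt
    · exact (hd3 t x hx).2.differentiableAt
  · exact (continuous_linearSolDeriv hγ hθ hθ1 hh).continuousOn.congr
      fun p hp => (hdt p.1 p.2 hp.2).deriv
  · intro k hk
    interval_cases k
    · simp only [dx, iteratedDeriv_zero]
      exact hu.continuousOn
    · simpa only [dx, (hd2 _).1] using
        (continuous_sineSeriesDeriv_linearMode hγ hh.continuous hh.bound).continuousOn
    · simp only [e2]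
      exact hw.continuousOn
    · exact (continuous_dirichletSlope
        (continuous_linearSolDxxxx hγ hθ hθ1 hh)).continuousOn.congr fun p hp => e3 p.1 p.2 hp.2
    · exact (continuous_linearSolDxxxx hγ hθ hθ1 hh).continuousOn.congr
        fun p hp => e4 p.1 p.2 hp.2
  · simp only [e2]
    exact hw.continuousOn
  · intro t x hx
    rw [dt, (hdt t x hx).deriv, e4 t x hx, e2, ← heq t x hx, linearSolDxxxx]
    field_simp
    ring
  · have hs : ∀ k, sin (waveNumber k) = 0 := fun k => by
      unfold waveNumber; exact_mod_cast sin_nat_mul_pi (k + 1)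
    simp [e2, linearSol, linearSolDxx, sineSeries, hs]

/-- The right-hand side of the equation along `u`, with `g` extended constantly in space outside
`[0, 1]`. -/
noncomputable def reaction {n : ℕ} (τ : Fin n → ℝ) (f : (Fin n → ℝ) → ℝ) (g u : ℝ → ℝ → ℝ)
    (t x : ℝ) : ℝ :=
  g t (projIcc (0:ℝ) 1 zero_le_one x) + f (fun k => u (t - τ k) x)

lemma linearMode_sub {γ : ℝ} (hγ : 0 < γ) {h₁ h₂ : ℝ → ℝ → ℝ} {M₁ M₂ : ℝ}
    (hh₁ : Continuous (Function.uncurry h₁)) (hh₂ : Continuous (Function.uncurry h₂))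
    (hM₁ : ∀ t x, |h₁ t x| ≤ M₁) (hM₂ : ∀ t x, |h₂ t x| ≤ M₂) (k : ℕ) (t : ℝ) :
    linearMode γ (fun t x => h₁ t x - h₂ t x) k t = linearMode γ h₁ k t - linearMode γ h₂ k t := by
  unfold linearMode
  rw [← decayConv_sub (eigenvalue_pos hγ k) (continuous_sineCoeff hh₁ k)
    (continuous_sineCoeff hh₂ k) (fun r => abs_sineCoeff_le (fun x _ => hM₁ r x) k)
    (fun r => abs_sineCoeff_le (fun x _ => hM₂ r x) k)]
  congr 1; funext r
  exact sineCoeff_sub (continuous_slice hh₁ r) (continuous_slice hh₂ r) k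

lemma sum_sq_sineCoeff_le {b : ℝ → ℝ} (hb : Continuous b) {N : ℝ}
    (hN : ∫ x in (0:ℝ)..1, b x ^ 2 ≤ N ^ 2) (S : Finset ℕ) :
    ∑ k ∈ S, 2 * sineCoeff b k ^ 2 ≤ N ^ 2 :=
  (sum_le_hasSum S (fun _ _ => by positivity) (hasSum_sq_sineCoeff hb)).trans hN

lemma sum_sq_linearMode_le {γ : ℝ} (hγ : 0 < γ) {h : ℝ → ℝ → ℝ} {M N : ℝ}
    (hh : Continuous (Function.uncurry h)) (hM : ∀ t x, |h t x| ≤ M)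
    (hN : ∀ t, ∫ x in (0:ℝ)..1, h t x ^ 2 ≤ N ^ 2) (t : ℝ) (S : Finset ℕ) :
    ∑ k ∈ S, 2 * linearMode γ h k t ^ 2 ≤ (N / eigenvalue γ 0) ^ 2 := by
  set l := eigenvalue γ 0 with hl
  have hl0 : 0 < l := eigenvalue_pos hγ 0
  have hcb := fun k r => abs_sineCoeff_le (fun x _ => hM r x) k
  have hcc := fun k => continuous_sineCoeff hh k
  have hsqb : ∀ k r, |sineCoeff (h r) k ^ 2| ≤ M ^ 2 := fun k r => by
    rw [abs_pow]; exact pow_le_pow_left₀ (abs_nonneg _) (hcb k r) 2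
  have hi : ∀ k, IntegrableOn (fun s => exp (-l * s) * sineCoeff (h (t - s)) k ^ 2) (Ioi 0) :=
    fun k => integrableOn_decayConv hl0 ((hcc k).pow 2) (hsqb k) t
  calc ∑ k ∈ S, 2 * linearMode γ h k t ^ 2
      ≤ ∑ k ∈ S, 2 * (1 / l * ∫ s in Ioi (0:ℝ), exp (-l * s) * sineCoeff (h (t - s)) k ^ 2) := by
        gcongr with k
        exact sq_decayConv_le hl0 (eigenvalue_monotone hγ k.zero_le) (hcc k) (hcb k) t
    _ = 1 / l * ∫ s in Ioi (0:ℝ), ∑ k ∈ S, 2 * (exp (-l * s) * sineCoeff (h (t - s)) k ^ 2) := by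
        rw [integral_finsetSum _ fun k _ => (hi k).const_mul 2, Finset.mul_sum]
        refine Finset.sum_congr rfl fun k _ => ?_
        rw [integral_const_mul]; ring
    _ ≤ 1 / l * ∫ s in Ioi (0:ℝ), exp (-l * s) * N ^ 2 := by
        refine mul_le_mul_of_nonneg_left ?_ (by positivity)
        refine integral_mono (integrable_finsetSum _ fun k _ => (hi k).const_mul 2)
          ((integrableOn_exp_neg_mul hl0).mul_const _) fun s => ?_
        have := sum_sq_sineCoeff_le (continuous_slice hh (t - s)) (hN (t - s)) S
        calc ∑ k ∈ S, 2 * (exp (-l * s) * sineCoeff (h (t - s)) k ^ 2)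
            = exp (-l * s) * ∑ k ∈ S, 2 * sineCoeff (h (t - s)) k ^ 2 := by
              rw [Finset.mul_sum]; refine Finset.sum_congr rfl fun k _ => ?_; ring
          _ ≤ _ := by gcongr
    _ = (N / l) ^ 2 := by
        rw [integral_mul_const, integral_exp_neg_mul_Ioi hl0]; ring

lemma abs_linearSol_le {γ : ℝ} (hγ : 0 < γ) {h : ℝ → ℝ → ℝ} {N : ℝ} (hN0 : 0 ≤ N)
    (hh : Continuous (Function.uncurry h))
    (hN : ∀ t, ∫ x in (0:ℝ)..1, h t x ^ 2 ≤ N ^ 2) (t x : ℝ) :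
    |linearSol γ h t x| ≤ 2 * (N * ∑' k, 1 / eigenvalue γ k) := by
  rw [← tsum_mul_left]
  refine abs_sineSeries_le ((summable_inv_eigenvalue hγ).mul_left N) (fun k => ?_) x
  refine (abs_decayConv_le (eigenvalue_pos hγ k) (M := N) (fun r => ?_) t).trans_eq (by ring)
  have h1 := sum_sq_sineCoeff_le (continuous_slice hh r) (hN r) {k}
  rw [Finset.sum_singleton] at h1
  exact abs_le_of_sq_le_sq (by nlinarith [sq_nonneg (sineCoeff (h r) k)]) hN0

section Reaction

variable {n : ℕ} {τ : Fin n → ℝ} {f : (Fin n → ℝ) → ℝ} {g : ℝ → ℝ → ℝ} {β : Fin n → ℝ}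

lemma abs_reaction_sub_le (hβ : ∀ k, 0 < β k)
    (hf : ∀ ξ η : Fin n → ℝ, |f ξ - f η| ≤ ∑ k, β k * |ξ k - η k|) (u v : ℝ → ℝ → ℝ) (t x : ℝ) :
    (reaction τ f g u t x - reaction τ f g v t x) ^ 2
      ≤ (∑ k, β k) * ∑ k, β k * (u (t - τ k) x - v (t - τ k) x) ^ 2 := by
  have h1 := hf (fun k => u (t - τ k) x) (fun k => v (t - τ k) x)
  have h2 := Finset.sum_sq_le_sum_mul_sum_of_sq_le_mul Finset.univ
    (r := fun k => β k * |u (t - τ k) x - v (t - τ k) x|) (f := β)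
    (g := fun k => β k * (u (t - τ k) x - v (t - τ k) x) ^ 2) (fun k _ => (hβ k).le)
    (fun k _ => mul_nonneg (hβ k).le (sq_nonneg _))
    (fun k _ => by rw [mul_pow, sq_abs]; exact le_of_eq (by ring))
  unfold reaction
  rw [add_sub_add_left_eq_sub, ← sq_abs]
  exact (pow_le_pow_left₀ (abs_nonneg _) h1 2).trans h2

lemma continuous_reaction (hf : Continuous f)
    (hg : Continuous fun p : ℝ × ℝ => g p.1 (projIcc (0:ℝ) 1 zero_le_one p.2)) {u : ℝ → ℝ → ℝ}
    (hu : Continuous (Function.uncurry u)) :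
    Continuous (Function.uncurry (reaction τ f g u)) := by
  refine hg.add (hf.comp (continuous_pi fun k => ?_))
  exact hu.comp (by fun_prop : Continuous fun p : ℝ × ℝ => (p.1 - τ k, p.2))

lemma abs_reaction_le (hβ : ∀ k, 0 < β k)
    (hf : ∀ ξ η : Fin n → ℝ, |f ξ - f η| ≤ ∑ k, β k * |ξ k - η k|) {G M : ℝ}
    (hG : ∀ t, ∀ x ∈ Icc (0:ℝ) 1, |g t x| ≤ G) {u : ℝ → ℝ → ℝ} (hM : ∀ t x, |u t x| ≤ M) (t x : ℝ) :
    |reaction τ f g u t x| ≤ G + (|f 0| + (∑ k, β k) * M) := by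
  refine (abs_add_le _ _).trans (add_le_add (hG _ _ (projIcc (0:ℝ) 1 zero_le_one x).2) ?_)
  have h1 := hf (fun k => u (t - τ k) x) 0
  have h2 : ∑ k, β k * |u (t - τ k) x - (0 : Fin n → ℝ) k| ≤ (∑ k, β k) * M := by
    rw [Finset.sum_mul]
    refine Finset.sum_le_sum fun k _ => mul_le_mul_of_nonneg_left ?_ (hβ k).le
    simpa using hM _ _
  have h3 := abs_sub_abs_le_abs_sub (f fun k => u (t - τ k) x) (f 0)
  linarith

lemma integral_sq_reaction_sub_le (hβ : ∀ k, 0 < β k) (hfc : Continuous f)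
    (hf : ∀ ξ η : Fin n → ℝ, |f ξ - f η| ≤ ∑ k, β k * |ξ k - η k|)
    (hg : Continuous fun p : ℝ × ℝ => g p.1 (projIcc (0:ℝ) 1 zero_le_one p.2)) {u v : ℝ → ℝ → ℝ}
    (hu : Continuous (Function.uncurry u)) (hv : Continuous (Function.uncurry v)) {N : ℝ}
    (hN : ∀ t, ∫ x in (0:ℝ)..1, (u t x - v t x) ^ 2 ≤ N ^ 2) (t : ℝ) :
    ∫ x in (0:ℝ)..1, (reaction τ f g u t x - reaction τ f g v t x) ^ 2
      ≤ ((∑ k, β k) * N) ^ 2 := by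
  have hB : 0 ≤ ∑ k, β k := Finset.sum_nonneg fun k _ => (hβ k).le
  have hd : ∀ r, Continuous fun x => (u r x - v r x) ^ 2 := fun r =>
    ((continuous_slice hu r).sub (continuous_slice hv r)).pow 2
  have hi : ∀ k ∈ (Finset.univ : Finset (Fin n)), IntervalIntegrable
      (fun x => β k * (u (t - τ k) x - v (t - τ k) x) ^ 2) volume 0 1 := fun k _ =>
    ((hd (t - τ k)).const_mul (β k)).intervalIntegrable _ _
  calc ∫ x in (0:ℝ)..1, (reaction τ f g u t x - reaction τ f g v t x) ^ 2
      ≤ ∫ x in (0:ℝ)..1, (∑ k, β k) * ∑ k, β k * (u (t - τ k) x - v (t - τ k) x) ^ 2 := by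
        refine intervalIntegral.integral_mono_on zero_le_one ?_ ?_
          (fun x _ => abs_reaction_sub_le hβ hf u v t x)
        · exact (((continuous_slice (continuous_reaction hfc hg hu) t).sub
            (continuous_slice (continuous_reaction hfc hg hv) t)).pow 2).intervalIntegrable _ _
        · exact ((continuous_finsetSum _ fun k _ =>
            (hd (t - τ k)).const_mul (β k)).const_mul _).intervalIntegrable _ _
    _ = (∑ k, β k) * ∑ k, β k * ∫ x in (0:ℝ)..1, (u (t - τ k) x - v (t - τ k) x) ^ 2 := by
        rw [intervalIntegral.integral_const_mul, intervalIntegral.integral_finsetSum hi]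
        simp only [intervalIntegral.integral_const_mul]
    _ ≤ (∑ k, β k) * ∑ k, β k * N ^ 2 := by
        gcongr with k
        · exact (hβ k).le
        · exact hN _
    _ = ((∑ k, β k) * N) ^ 2 := by rw [← Finset.sum_mul]; ring

/-- One step of the fixed point iteration contracts the `L²` distance. -/
lemma integral_sq_step_le {γ : ℝ} (hγ : 0 < γ) (hβ : ∀ k, 0 < β k) (hfc : Continuous f)
    (hf : ∀ ξ η : Fin n → ℝ, |f ξ - f η| ≤ ∑ k, β k * |ξ k - η k|)
    (hg : Continuous fun p : ℝ × ℝ => g p.1 (projIcc (0:ℝ) 1 zero_le_one p.2)) {G : ℝ}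
    (hG : ∀ t, ∀ x ∈ Icc (0:ℝ) 1, |g t x| ≤ G) {u v U V : ℝ → ℝ → ℝ}
    (hu : Continuous (Function.uncurry u)) (hv : Continuous (Function.uncurry v)) {M₁ M₂ : ℝ}
    (hM₁ : ∀ t x, |u t x| ≤ M₁) (hM₂ : ∀ t x, |v t x| ≤ M₂)
    (hUc : ∀ t, Continuous (U t)) (hVc : ∀ t, Continuous (V t))
    (hU : ∀ t k, sineCoeff (U t) k = linearMode γ (reaction τ f g u) k t)
    (hV : ∀ t k, sineCoeff (V t) k = linearMode γ (reaction τ f g v) k t) {N : ℝ}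
    (hN : ∀ t, ∫ x in (0:ℝ)..1, (u t x - v t x) ^ 2 ≤ N ^ 2) (t : ℝ) :
    ∫ x in (0:ℝ)..1, (U t x - V t x) ^ 2 ≤ ((∑ k, β k) / eigenvalue γ 0 * N) ^ 2 := by
  have c1 := continuous_reaction (τ := τ) hfc hg hu
  have c2 := continuous_reaction (τ := τ) hfc hg hv
  have b1 := abs_reaction_le (τ := τ) hβ hf hG hM₁
  have b2 := abs_reaction_le (τ := τ) hβ hf hG hM₂
  refine hasSum_le_of_sum_le (hasSum_sq_sineCoeff ((hUc t).sub (hVc t))) fun S => ?_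
  refine le_trans (Finset.sum_le_sum fun k _ => ?_) ((sum_sq_linearMode_le hγ
    (h := fun t x => reaction τ f g u t x - reaction τ f g v t x) (c1.sub c2)
    (fun t x => (abs_sub _ _).trans (add_le_add (b1 t x) (b2 t x)))
    (integral_sq_reaction_sub_le hβ hfc hf hg hu hv hN) t S).trans_eq (by ring))
  rw [linearMode_sub hγ c1 c2 b1 b2, ← hU, ← hV]
  exact le_of_eq (by rw [← sineCoeff_sub (hUc t) (hVc t)])

end Reaction

/-- The standing assumptions on the nonlinearity `f` and the forcing `g`. -/
structure IsAdmissible {n : ℕ} (f : (Fin n → ℝ) → ℝ) (g : ℝ → ℝ → ℝ) (β : Fin n → ℝ) (G : ℝ) :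
    Prop where
  pos : ∀ k, 0 < β k
  continuous : Continuous f
  lipschitz : ∀ ξ η : Fin n → ℝ, |f ξ - f η| ≤ ∑ k, β k * |ξ k - η k|
  continuous_forcing : Continuous fun p : ℝ × ℝ => g p.1 (projIcc (0:ℝ) 1 zero_le_one p.2)
  bound_forcing : ∀ t, ∀ x ∈ Icc (0:ℝ) 1, |g t x| ≤ G

/-- Bounded solutions of the equation in the sense of sine coefficients. -/
structure IsMild (γ : ℝ) {n : ℕ} (τ : Fin n → ℝ) (f : (Fin n → ℝ) → ℝ) (g u : ℝ → ℝ → ℝ) :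
    Prop where
  continuous : Continuous (Function.uncurry u)
  bounded : ∃ M, ∀ t x, |u t x| ≤ M
  coeff : ∀ t k, sineCoeff (u t) k = linearMode γ (reaction τ f g u) k t

section Mild

variable {γ : ℝ} {n : ℕ} {τ : Fin n → ℝ} {f : (Fin n → ℝ) → ℝ} {g : ℝ → ℝ → ℝ} {β : Fin n → ℝ}
  {G : ℝ}

lemma integral_sq_le_of_abs_le {b : ℝ → ℝ} (hb : Continuous b) {N : ℝ} (hN : ∀ x, |b x| ≤ N) :
    ∫ x in (0:ℝ)..1, b x ^ 2 ≤ N ^ 2 := by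
  have h1 := intervalIntegral.integral_mono_on (μ := volume)
    (f := fun x => b x ^ 2) (g := fun _ => N ^ 2) (zero_le_one (α := ℝ))
    ((hb.pow 2).intervalIntegrable 0 1) (intervalIntegrable_const (c := N ^ 2))
    (fun x _ => by rw [← sq_abs]; exact pow_le_pow_left₀ (abs_nonneg _) (hN x) 2)
  simpa using h1

lemma IsMild.sineCoeff_eq (hγ : 0 < γ) (H : IsAdmissible f g β G)
    (hq : ∑ k, β k < eigenvalue γ 0) {u v : ℝ → ℝ → ℝ} (hu : IsMild γ τ f g u)
    (hv : IsMild γ τ f g v) (t : ℝ) (k : ℕ) : sineCoeff (u t) k = sineCoeff (v t) k := by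
  obtain ⟨M₁, hM₁⟩ := hu.bounded
  obtain ⟨M₂, hM₂⟩ := hv.bounded
  set q := (∑ k, β k) / eigenvalue γ 0 with hqd
  have hl := eigenvalue_pos hγ 0
  have hq0 : 0 ≤ q := div_nonneg (Finset.sum_nonneg fun k _ => (H.pos k).le) hl.le
  have hq1 : q < 1 := (div_lt_one hl).2 hq
  have cu := continuous_slice hu.continuous
  have cv := continuous_slice hv.continuous
  have hm : ∀ m : ℕ, ∀ t, ∫ x in (0:ℝ)..1, (u t x - v t x) ^ 2 ≤ (q ^ m * (M₁ + M₂)) ^ 2 := by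
    intro m
    induction m with
    | zero =>
      intro t
      refine integral_sq_le_of_abs_le (b := fun x => u t x - v t x) ((cu t).sub (cv t))
        fun x => ?_
      rw [pow_zero, one_mul]
      exact (abs_sub _ _).trans (add_le_add (hM₁ t x) (hM₂ t x))
    | succ m ih =>
      intro t
      have := integral_sq_step_le hγ H.pos H.continuous H.lipschitz H.continuous_forcing
        H.bound_forcing hu.continuous hv.continuous hM₁ hM₂ cu cv hu.coeff hv.coeff ih t
      refine this.trans_eq ?_
      rw [← hqd]; ring
  have hlim : Tendsto (fun m : ℕ => (q ^ m * (M₁ + M₂)) ^ 2) atTop (𝓝 0) := by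
    simpa using ((tendsto_pow_atTop_nhds_zero_of_lt_one hq0 hq1).mul_const (M₁ + M₂)).pow 2
  have h0 : ∫ x in (0:ℝ)..1, (u t x - v t x) ^ 2 ≤ 0 :=
    ge_of_tendsto' hlim fun m => hm m t
  have h1 := sum_sq_sineCoeff_le (b := fun x => u t x - v t x) ((cu t).sub (cv t)) (N := 0)
    (by simpa using h0) {k}
  rw [Finset.sum_singleton] at h1
  have h2 : sineCoeff (fun x => u t x - v t x) k = 0 :=
    pow_eq_zero_iff two_ne_zero |>.1 (le_antisymm (by linarith) (sq_nonneg _))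
  rw [sineCoeff_sub (cu t) (cv t)] at h2
  linarith

/-- The fixed point map on bounded continuous functions. -/
noncomputable def mildMap (hγ : 0 < γ) (H : IsAdmissible f g β G) (τ : Fin n → ℝ)
    (u : BoundedContinuousFunction (ℝ × ℝ) ℝ) : BoundedContinuousFunction (ℝ × ℝ) ℝ :=
  BoundedContinuousFunction.ofNormedAddCommGroup
    (Function.uncurry (linearSol γ (reaction τ f g fun t x => u (t, x))))
    (continuous_linearSol hγ (continuous_reaction H.continuous H.continuous_forcing u.continuous)
      (abs_reaction_le H.pos H.lipschitz H.bound_forcing fun t x => u.norm_coe_le_norm (t, x)))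
    (2 * ∑' k, (G + (|f 0| + (∑ k, β k) * ‖u‖)) * (1 / eigenvalue γ k))
    (fun p => abs_sineSeries_le ((summable_inv_eigenvalue hγ).mul_left _) (fun k =>
      abs_linearMode_le hγ (fun t x _ => abs_reaction_le H.pos H.lipschitz H.bound_forcing
        (fun t x => u.norm_coe_le_norm (t, x)) t x) k p.1) p.2)

lemma mildMap_apply (hγ : 0 < γ) (H : IsAdmissible f g β G)
    (u : BoundedContinuousFunction (ℝ × ℝ) ℝ) (t x : ℝ) :
    mildMap hγ H τ u (t, x) = linearSol γ (reaction τ f g fun t x => u (t, x)) t x := rfl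

lemma sineCoeff_mildMap (hγ : 0 < γ) (H : IsAdmissible f g β G)
    (u : BoundedContinuousFunction (ℝ × ℝ) ℝ) (t : ℝ) (k : ℕ) :
    sineCoeff (fun x => mildMap hγ H τ u (t, x)) k
      = linearMode γ (reaction τ f g fun t x => u (t, x)) k t :=
  sineCoeff_linearSol hγ (fun t x _ => abs_reaction_le H.pos H.lipschitz H.bound_forcing
    (fun t x => u.norm_coe_le_norm (t, x)) t x) t k

lemma linearSol_sub (hγ : 0 < γ) {h₁ h₂ : ℝ → ℝ → ℝ} {M₁ M₂ : ℝ}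
    (hh₁ : Continuous (Function.uncurry h₁)) (hh₂ : Continuous (Function.uncurry h₂))
    (hM₁ : ∀ t x, |h₁ t x| ≤ M₁) (hM₂ : ∀ t x, |h₂ t x| ≤ M₂) (t x : ℝ) :
    linearSol γ (fun t x => h₁ t x - h₂ t x) t x = linearSol γ h₁ t x - linearSol γ h₂ t x := by
  have hs : ∀ {h : ℝ → ℝ → ℝ} {M : ℝ}, (∀ t x, |h t x| ≤ M) →
      Summable fun k => 2 * linearMode γ h k t * sin (waveNumber k * x) := fun {h M} hM =>
    Summable.of_norm_bounded (((summable_inv_eigenvalue hγ).mul_left M).mul_left 2) fun k =>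
      abs_sineTerm_le (fun k => abs_linearMode_le hγ (fun t x _ => hM t x) k t) k x
  unfold linearSol sineSeries
  rw [← (hs hM₁).tsum_sub (hs hM₂)]
  congr 1; funext k
  dsimp only
  rw [linearMode_sub hγ hh₁ hh₂ hM₁ hM₂]; ring

lemma integral_sq_iterate_mildMap_le (hγ : 0 < γ) (H : IsAdmissible f g β G)
    (u v : BoundedContinuousFunction (ℝ × ℝ) ℝ) (m : ℕ) (t : ℝ) :
    ∫ x in (0:ℝ)..1, ((mildMap hγ H τ)^[m] u (t, x) - (mildMap hγ H τ)^[m] v (t, x)) ^ 2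
      ≤ (((∑ k, β k) / eigenvalue γ 0) ^ m * dist u v) ^ 2 := by
  have hc : ∀ (w : BoundedContinuousFunction (ℝ × ℝ) ℝ) t, Continuous fun x => w (t, x) :=
    fun w t => w.continuous.comp (by fun_prop)
  induction m generalizing t with
  | zero =>
    refine integral_sq_le_of_abs_le (b := fun x => u (t, x) - v (t, x))
      ((hc u t).sub (hc v t)) fun x => ?_
    rw [pow_zero, one_mul, ← Real.dist_eq]
    exact BoundedContinuousFunction.dist_coe_le_dist _
  | succ m ih =>
    simp only [Function.iterate_succ_apply']
    have := integral_sq_step_le hγ H.pos H.continuous H.lipschitz H.continuous_forcing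
      H.bound_forcing (u := fun t x => (mildMap hγ H τ)^[m] u (t, x))
      (v := fun t x => (mildMap hγ H τ)^[m] v (t, x)) (BoundedContinuousFunction.continuous _)
      (BoundedContinuousFunction.continuous _)
      (fun t x => ((mildMap hγ H τ)^[m] u).norm_coe_le_norm (t, x))
      (fun t x => ((mildMap hγ H τ)^[m] v).norm_coe_le_norm (t, x))
      (hc _) (hc _) (sineCoeff_mildMap (τ := τ) hγ H _) (sineCoeff_mildMap (τ := τ) hγ H _) ih t
    exact this.trans_eq (by ring)

lemma dist_iterate_mildMap_le (hγ : 0 < γ) (H : IsAdmissible f g β G)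
    (u v : BoundedContinuousFunction (ℝ × ℝ) ℝ) (m : ℕ) :
    dist ((mildMap hγ H τ)^[m + 1] u) ((mildMap hγ H τ)^[m + 1] v)
      ≤ 2 * (∑ k, β k) * (∑' k, 1 / eigenvalue γ k) * ((∑ k, β k) / eigenvalue γ 0) ^ m
        * dist u v := by
  have hB : 0 ≤ ∑ k, β k := Finset.sum_nonneg fun k _ => (H.pos k).le
  have hl := eigenvalue_pos hγ 0
  have hS : 0 ≤ ∑' k, 1 / eigenvalue γ k :=
    tsum_nonneg fun k => by have := eigenvalue_pos hγ k; positivity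
  rw [BoundedContinuousFunction.dist_le (by positivity)]
  rintro ⟨t, x⟩
  simp only [Function.iterate_succ_apply', mildMap_apply]
  set U := (mildMap hγ H τ)^[m] u with hU
  set V := (mildMap hγ H τ)^[m] v with hV
  have c := fun w : BoundedContinuousFunction (ℝ × ℝ) ℝ =>
    continuous_reaction (τ := τ) (u := fun t x => w (t, x)) H.continuous H.continuous_forcing
      w.continuous
  have b := fun w : BoundedContinuousFunction (ℝ × ℝ) ℝ =>
    abs_reaction_le (τ := τ) (u := fun t x => w (t, x)) H.pos H.lipschitz H.bound_forcing
      fun t x => w.norm_coe_le_norm (t, x)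
  rw [Real.dist_eq, ← linearSol_sub hγ (c U) (c V) (b U) (b V)]
  refine (abs_linearSol_le hγ (h := fun t x => reaction τ f g (fun t x => U (t, x)) t x
    - reaction τ f g (fun t x => V (t, x)) t x) (N := (∑ k, β k) *
    (((∑ k, β k) / eigenvalue γ 0) ^ m * dist u v)) (by positivity) ((c U).sub (c V))
    (integral_sq_reaction_sub_le (u := fun t x => U (t, x)) (v := fun t x => V (t, x)) H.pos
      H.continuous H.lipschitz H.continuous_forcing U.continuous V.continuous
      (integral_sq_iterate_mildMap_le hγ H u v m)) t x).trans_eq (by ring)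

lemma exists_eq_linearSol_reaction (hγ : 0 < γ) (H : IsAdmissible f g β G)
    (hq : ∑ k, β k < eigenvalue γ 0) (τ : Fin n → ℝ) :
    ∃ u : ℝ → ℝ → ℝ, IsMild γ τ f g u ∧ u = linearSol γ (reaction τ f g u) := by
  have hl := eigenvalue_pos hγ 0
  have hB : 0 ≤ ∑ k, β k := Finset.sum_nonneg fun k _ => (H.pos k).le
  have hS : 0 ≤ ∑' k, 1 / eigenvalue γ k :=
    tsum_nonneg fun k => by have := eigenvalue_pos hγ k; positivity
  have hlim := (tendsto_pow_atTop_nhds_zero_of_lt_one (div_nonneg hB hl.le)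
    ((div_lt_one hl).2 hq)).const_mul (2 * (∑ k, β k) * ∑' k, 1 / eigenvalue γ k)
  rw [mul_zero] at hlim
  obtain ⟨m, hm⟩ := (hlim.eventually (gt_mem_nhds zero_lt_one)).exists
  have hc : ContractingWith ⟨2 * (∑ k, β k) * (∑' k, 1 / eigenvalue γ k)
      * ((∑ k, β k) / eigenvalue γ 0) ^ m, by positivity⟩ (mildMap hγ H τ)^[m + 1] :=
    ⟨hm, LipschitzWith.of_dist_le_mul fun u v => dist_iterate_mildMap_le hγ H u v m⟩
  have hfix := hc.isFixedPt_fixedPoint_iterate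
  set U := hc.fixedPoint with hU
  have e : (fun t x => U (t, x)) = linearSol γ (reaction τ f g fun t x => U (t, x)) := by
    funext t x
    conv_lhs => rw [← hfix]
    rfl
  refine ⟨fun t x => U (t, x), ⟨U.continuous, ⟨‖U‖, fun t x => U.norm_coe_le_norm (t, x)⟩,
    fun t k => ?_⟩, e⟩
  conv_lhs => rw [← hfix]
  exact sineCoeff_mildMap hγ H U t k

end Mild

lemma abs_linearSol_sub_le {γ : ℝ} (hγ : 0 < γ) {h : ℝ → ℝ → ℝ} {M : ℝ}
    (hh : Continuous (Function.uncurry h)) (hM : ∀ t x, |h t x| ≤ M) (t t' x : ℝ) :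
    |linearSol γ h t x - linearSol γ h t' x|
      ≤ 4 * M * (∑' k, 1 / √(eigenvalue γ k)) * |t - t'| ^ (1 / 2 : ℝ) := by
  have hs : ∀ t, Summable fun k => 2 * linearMode γ h k t * sin (waveNumber k * x) := fun t =>
    Summable.of_norm_bounded (((summable_inv_eigenvalue hγ).mul_left M).mul_left 2) fun k =>
      abs_sineTerm_le (fun k => abs_linearMode_le hγ (fun t x _ => hM t x) k t) k x
  have h1 : linearSol γ h t x - linearSol γ h t' x
      = sineSeries (fun k => linearMode γ h k t - linearMode γ h k t') x := by
    unfold linearSol sineSeries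
    rw [← (hs t).tsum_sub (hs t')]
    congr 1; funext k; ring
  rw [h1]
  refine (abs_sineSeries_le ((summable_inv_sqrt_eigenvalue hγ).mul_left
    (2 * M * |t - t'| ^ (1 / 2 : ℝ))) (fun k => abs_decayConv_sub_le (eigenvalue_pos hγ k)
      (continuous_sineCoeff hh k) (fun r => abs_sineCoeff_le (fun x _ => hM r x) k) t t')
    x).trans_eq ?_
  rw [tsum_mul_left]; ring

section Forcing

variable {g : ℝ → ℝ → ℝ} {L θ : ℝ}

lemma continuous_clamp_of_holder (hθ : 0 < θ)
    (hg : ∀ t : ℝ, ∀ x ∈ Icc (0:ℝ) 1, ∀ s : ℝ, ∀ y ∈ Icc (0:ℝ) 1,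
      |g t x - g s y| ≤ L * (|t - s| + |x - y|) ^ θ) :
    Continuous fun p : ℝ × ℝ => g p.1 (projIcc (0:ℝ) 1 zero_le_one p.2) := by
  refine continuous_iff_continuousAt.2 fun q => ?_
  have hc : Continuous fun p : ℝ × ℝ => L * (|p.1 - q.1|
      + |(projIcc (0:ℝ) 1 zero_le_one p.2 : ℝ) - projIcc (0:ℝ) 1 zero_le_one q.2|) ^ θ := by
    refine continuous_const.mul (Continuous.rpow_const ?_ fun _ => Or.inr hθ.le)
    have := continuous_subtype_val.comp ((continuous_projIcc (h := zero_le_one (α := ℝ))).comp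
      (continuous_snd (X := ℝ)))
    exact (continuous_fst.sub continuous_const).abs.add (this.sub continuous_const).abs
  have h0 := hc.tendsto q
  simp only [sub_self, abs_zero, add_zero, zero_rpow hθ.ne', mul_zero] at h0
  refine tendsto_iff_dist_tendsto_zero.2 (squeeze_zero (fun _ => dist_nonneg) (fun p => ?_) h0)
  exact hg _ _ (projIcc _ _ _ _).2 _ _ (projIcc _ _ _ _).2

lemma exists_bound_of_holder_of_periodic {ω : ℝ} (hω : 0 < ω) (hL : 0 < L) (hθ : 0 < θ)
    (hg : ∀ t : ℝ, ∀ x ∈ Icc (0:ℝ) 1, ∀ s : ℝ, ∀ y ∈ Icc (0:ℝ) 1,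
      |g t x - g s y| ≤ L * (|t - s| + |x - y|) ^ θ)
    (hper : ∀ t : ℝ, ∀ x ∈ Icc (0:ℝ) 1, g (t + ω) x = g t x) :
    ∃ G, ∀ t, ∀ x ∈ Icc (0:ℝ) 1, |g t x| ≤ G := by
  refine ⟨|g 0 0| + L * (ω + 1) ^ θ, fun t x hx => ?_⟩
  obtain ⟨s, hs, he⟩ := Function.Periodic.exists_mem_Ico₀ (f := fun t => g t x)
    (fun t => hper t x hx) hω t
  have h1 := hg s x hx 0 0 ⟨le_rfl, zero_le_one⟩
  have h2 : (|s - 0| + |x - 0|) ^ θ ≤ (ω + 1) ^ θ := by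
    refine rpow_le_rpow (by positivity) ?_ hθ.le
    rw [sub_zero, sub_zero, abs_of_nonneg hs.1, abs_of_nonneg hx.1]
    exact add_le_add hs.2.le hx.2
  have h3 := abs_sub_abs_le_abs_sub (g s x) (g 0 0)
  have h4 := mul_le_mul_of_nonneg_left h2 hL.le
  rw [he]
  linarith

end Forcing

section Existence

variable {γ : ℝ} {n : ℕ} {τ : Fin n → ℝ} {f : (Fin n → ℝ) → ℝ} {g u : ℝ → ℝ → ℝ} {β : Fin n → ℝ}
  {G : ℝ}

lemma isBoundedTimeHolder_reaction (hγ : 0 < γ) (H : IsAdmissible f g β G) {L θ : ℝ} (hL : 0 < L)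
    (hθ : 0 < θ) (hg : ∀ t : ℝ, ∀ x ∈ Icc (0:ℝ) 1, ∀ s : ℝ, ∀ y ∈ Icc (0:ℝ) 1,
      |g t x - g s y| ≤ L * (|t - s| + |x - y|) ^ θ)
    (hu : IsMild γ τ f g u) (he : u = linearSol γ (reaction τ f g u)) :
    ∃ M C, IsBoundedTimeHolder (reaction τ f g u) M C (min θ (1 / 2)) := by
  obtain ⟨N, hN⟩ := hu.bounded
  have hb := abs_reaction_le (τ := τ) H.pos H.lipschitz H.bound_forcing hN
  have hc := continuous_reaction (τ := τ) H.continuous H.continuous_forcing hu.continuous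
  set M := G + (|f 0| + (∑ k, β k) * N)
  have hM : 0 ≤ M := (abs_nonneg _).trans (hb 0 0)
  have hB : 0 ≤ ∑ k, β k := Finset.sum_nonneg fun k _ => (H.pos k).le
  set S := ∑' k, 1 / √(eigenvalue γ k)
  have hS : 0 ≤ S := tsum_nonneg fun k => by positivity
  refine ⟨M, L + (∑ k, β k) * (4 * M * S), hc, hb, fun t t' x htt => ?_, by positivity⟩
  have hsub : ∀ s s', |u s x - u s' x| ≤ 4 * M * S * |s - s'| ^ (1 / 2 : ℝ) := fun s s' => by
    rw [he]; exact abs_linearSol_sub_le hγ hc hb s s' x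
  have hp : ∀ {p : ℝ}, min θ (1 / 2) ≤ p → |t - t'| ^ p ≤ |t - t'| ^ min θ (1 / 2) := fun h => by
    rcases (abs_nonneg (t - t')).eq_or_lt with h0 | h0
    · have : 0 < min θ (1 / 2) := lt_min hθ (by norm_num)
      rw [← h0, zero_rpow this.ne', zero_rpow (this.trans_le h).ne']
    · exact rpow_le_rpow_of_exponent_ge h0 htt h
  have h1 := hg t _ (projIcc (0:ℝ) 1 zero_le_one x).2 t' _ (projIcc (0:ℝ) 1 zero_le_one x).2
  rw [sub_self, abs_zero, add_zero] at h1
  have h2 := H.lipschitz (fun k => u (t - τ k) x) (fun k => u (t' - τ k) x)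
  have h3 : ∑ k, β k * |u (t - τ k) x - u (t' - τ k) x|
      ≤ (∑ k, β k) * (4 * M * S * |t - t'| ^ (1 / 2 : ℝ)) := by
    rw [Finset.sum_mul]
    refine Finset.sum_le_sum fun k _ => mul_le_mul_of_nonneg_left ?_ (H.pos k).le
    simpa using hsub (t - τ k) (t' - τ k)
  calc |reaction τ f g u t x - reaction τ f g u t' x|
      ≤ L * |t - t'| ^ θ + (∑ k, β k) * (4 * M * S * |t - t'| ^ (1 / 2 : ℝ)) := by
        unfold reaction
        rw [add_sub_add_comm]
        exact (abs_add_le _ _).trans (add_le_add h1 (h2.trans h3))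
    _ ≤ L * |t - t'| ^ min θ (1 / 2)
        + (∑ k, β k) * (4 * M * S * |t - t'| ^ min θ (1 / 2)) := by
        gcongr ?_ * ?_ + ?_ * (?_ * ?_)
        · exact hp (min_le_left _ _)
        · exact hp (min_le_right _ _)
    _ = _ := by ring

lemma linearSol_reaction_periodic {ω : ℝ} (hγ : 0 < γ) (H : IsAdmissible f g β G)
    (hq : ∑ k, β k < eigenvalue γ 0)
    (hper : ∀ t : ℝ, ∀ x ∈ Icc (0:ℝ) 1, g (t + ω) x = g t x) (hu : IsMild γ τ f g u) (t x : ℝ) :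
    linearSol γ (reaction τ f g u) (t + ω) x = linearSol γ (reaction τ f g u) t x := by
  have hr : ∀ t, reaction τ f g (fun t x => u (t + ω) x) t = reaction τ f g u (t + ω) := fun t => by
    funext x
    unfold reaction
    rw [hper t _ (projIcc (0:ℝ) 1 zero_le_one x).2]
    simp only [sub_add_eq_add_sub]
  have hv : IsMild γ τ f g fun t x => u (t + ω) x := by
    refine ⟨hu.continuous.comp (by fun_prop : Continuous fun p : ℝ × ℝ => (p.1 + ω, p.2)),
      hu.bounded.imp fun M hM t x => hM _ _, fun t k => ?_⟩
    unfold linearMode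
    simp only [hr]
    rw [decayConv_shift _ (fun r => sineCoeff (reaction τ f g u r) k)]
    exact hu.coeff (t + ω) k
  unfold linearSol
  congr 1; funext k
  rw [← hu.coeff, ← hu.coeff]
  exact hv.sineCoeff_eq hγ H hq hu t k

lemma exists_isPeriodicClassicalSolution {ω : ℝ} (hγ : 0 < γ) (H : IsAdmissible f g β G)
    (hq : ∑ k, β k < eigenvalue γ 0) {L θ : ℝ} (hL : 0 < L) (hθ : 0 < θ)
    (hg : ∀ t : ℝ, ∀ x ∈ Icc (0:ℝ) 1, ∀ s : ℝ, ∀ y ∈ Icc (0:ℝ) 1,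
      |g t x - g s y| ≤ L * (|t - s| + |x - y|) ^ θ)
    (hper : ∀ t : ℝ, ∀ x ∈ Icc (0:ℝ) 1, g (t + ω) x = g t x) (τ : Fin n → ℝ) :
    ∃ u : ℝ → ℝ → ℝ, IsPeriodicClassicalSolution γ ω τ f g u ∧ IsMild γ τ f g u := by
  obtain ⟨u, hu, he⟩ := exists_eq_linearSol_reaction hγ H hq τ
  obtain ⟨M, C, hh⟩ := isBoundedTimeHolder_reaction hγ H hL hθ hg hu he
  refine ⟨u, ?_, hu⟩
  rw [he]
  refine isPeriodicClassicalSolution_linearSol hγ (lt_min hθ (by norm_num))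
    ((min_le_right _ _).trans (by norm_num)) hh
    (linearSol_reaction_periodic hγ H hq hper hu) fun t x hx => ?_
  rw [← he]
  simp only [reaction, projIcc_of_mem _ (Ioo_subset_Icc_self hx)]

end Existence

lemma continuous_intervalIntegral_of_continuous {X : Type*} [TopologicalSpace X]
    [FirstCountableTopology X] {F : X → ℝ → ℝ} (hF : Continuous (Function.uncurry F))
    {a b : X → ℝ} (ha : Continuous a) (hb : Continuous b) :
    Continuous fun x => ∫ y in a x..b x, F x y := by
  have hi : ∀ x c d, IntervalIntegrable (F x) volume c d := fun x c d =>
    (hF.comp (by fun_prop : Continuous fun y : ℝ => (x, y))).intervalIntegrable c d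
  have e : (fun x => ∫ y in a x..b x, F x y)
      = fun x => (∫ y in (0:ℝ)..b x, F x y) - ∫ y in (0:ℝ)..a x, F x y := by
    funext x
    exact (intervalIntegral.integral_interval_sub_left (hi x _ _) (hi x _ _)).symm
  rw [e]
  exact (intervalIntegral.continuous_parametric_intervalIntegral_of_continuous hF hb).sub
    (intervalIntegral.continuous_parametric_intervalIntegral_of_continuous hF ha)

/-- The sine coefficient of `b` on the shrunk interval `[ε, 1 - ε]`. -/
noncomputable def shrunkCoeff (κ ε : ℝ) (b : ℝ → ℝ) : ℝ :=
  ∫ x in ε..(1 - ε), b x * sin (κ * (x - ε))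

/-- The boundary terms of two integrations by parts on `[ε, 1 - ε]`. -/
noncomputable def shrunkBoundary (κ ε : ℝ) (b : ℝ → ℝ) : ℝ :=
  κ * (b (1 - ε) * cos (κ * (1 - ε - ε)) - b ε)

lemma continuous_shrunkCoeff {W : ℝ → ℝ → ℝ} (hW : Continuous (Function.uncurry W)) {K : ℝ → ℝ}
    (hK : Continuous K) : Continuous fun p : ℝ × ℝ => shrunkCoeff (K p.1) p.1 (W p.2) := by
  unfold shrunkCoeff
  refine continuous_intervalIntegral_of_continuous
    (F := fun (p : ℝ × ℝ) x => W p.2 x * sin (K p.1 * (x - p.1))) ?_ (by fun_prop) (by fun_prop)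
  simp only [Function.uncurry_def] at hW ⊢
  fun_prop

lemma continuous_shrunkBoundary {W : ℝ → ℝ → ℝ} (hW : Continuous (Function.uncurry W)) {K : ℝ → ℝ}
    (hK : Continuous K) : Continuous fun p : ℝ × ℝ => shrunkBoundary (K p.1) p.1 (W p.2) := by
  unfold shrunkBoundary
  simp only [Function.uncurry_def] at hW
  fun_prop

/-- The function `u` extended constantly in space outside `[0, 1]`. -/
noncomputable def clamp (u : ℝ → ℝ → ℝ) (t x : ℝ) : ℝ := u t (projIcc (0:ℝ) 1 zero_le_one x)

lemma clamp_of_mem (u : ℝ → ℝ → ℝ) (t : ℝ) {x : ℝ} (hx : x ∈ Icc (0:ℝ) 1) :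
    clamp u t x = u t x := by
  rw [clamp, projIcc_of_mem _ hx]

lemma continuous_comp_projIcc {u : ℝ → ℝ → ℝ} {a b : ℝ} (hab : a ≤ b) {s : Set ℝ}
    (hs : Icc a b ⊆ s) (hu : ContinuousOn (fun p : ℝ × ℝ => u p.1 p.2) (univ ×ˢ s)) :
    Continuous fun p : ℝ × ℝ => u p.1 (projIcc a b hab p.2) := by
  refine hu.comp_continuous (f := fun p : ℝ × ℝ => (p.1, (projIcc a b hab p.2 : ℝ))) ?_
    fun p => ⟨mem_univ _, hs (projIcc a b hab p.2).2⟩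
  exact continuous_fst.prodMk (continuous_subtype_val.comp (continuous_projIcc.comp continuous_snd))

section Classical

variable {γ ω : ℝ} {n : ℕ} {τ : Fin n → ℝ} {f : (Fin n → ℝ) → ℝ} {g v : ℝ → ℝ → ℝ} {β : Fin n → ℝ}
  {G : ℝ}

lemma IsPeriodicClassicalSolution.continuous_clamp
    (hv : IsPeriodicClassicalSolution γ ω τ f g v) : Continuous (Function.uncurry (clamp v)) :=
  continuous_comp_projIcc zero_le_one Subset.rfl hv.1

lemma IsPeriodicClassicalSolution.continuous_clamp_dx_two
    (hv : IsPeriodicClassicalSolution γ ω τ f g v) :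
    Continuous (Function.uncurry (clamp (dx 2 v))) :=
  continuous_comp_projIcc zero_le_one Subset.rfl hv.2.2.2.2.2.2.1

lemma IsPeriodicClassicalSolution.exists_bound (hω : 0 < ω)
    (hv : IsPeriodicClassicalSolution γ ω τ f g v) : ∃ M, ∀ t x, |clamp v t x| ≤ M := by
  obtain ⟨M, hM⟩ := (isCompact_Icc.prod isCompact_Icc :
    IsCompact (Icc (0:ℝ) ω ×ˢ Icc (0:ℝ) 1)).exists_bound_of_continuousOn
      (hv.1.mono (prod_mono (subset_univ _) Subset.rfl))
  refine ⟨M, fun t x => ?_⟩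
  obtain ⟨s, hs, he⟩ := Function.Periodic.exists_mem_Ico₀
    (f := fun t => v t (projIcc (0:ℝ) 1 zero_le_one x)) (fun t => hv.2.1 t _) hω t
  rw [clamp, he]
  exact hM (s, _) ⟨Ico_subset_Icc_self hs, (projIcc (0:ℝ) 1 zero_le_one x).2⟩

lemma IsPeriodicClassicalSolution.hasDerivAt_iteratedDeriv
    (hv : IsPeriodicClassicalSolution γ ω τ f g v) (t : ℝ) {x : ℝ} (hx : x ∈ Ioo (0:ℝ) 1) {k : ℕ}
    (hk : k < 4) : HasDerivAt (iteratedDeriv k (v t)) (iteratedDeriv (k + 1) (v t) x) x := by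
  rw [iteratedDeriv_succ]
  exact (hv.2.2.2.1 t x hx k hk).hasDerivAt

lemma IsPeriodicClassicalSolution.shrunkCoeff_dt (H : IsAdmissible f g β G)
    (hv : IsPeriodicClassicalSolution γ ω τ f g v) {ε : ℝ} (hε : 0 < ε) (hε' : ε ≤ 1 / 4) {κ : ℝ}
    (hκ : sin (κ * (1 - ε - ε)) = 0) (t : ℝ) :
    shrunkCoeff κ ε (dt v t) = shrunkCoeff κ ε (reaction τ f g (clamp v) t)
      + (1 - κ ^ 2 - γ * κ ^ 4) * shrunkCoeff κ ε (clamp v t)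
      - (1 + γ * κ ^ 2) * shrunkBoundary κ ε (clamp v t)
      + γ * shrunkBoundary κ ε (clamp (dx 2 v) t) := by
  have hab : ε ≤ 1 - ε := by linarith
  have hsub : Icc ε (1 - ε) ⊆ Ioo (0:ℝ) 1 := fun x hx =>
    ⟨hε.trans_le hx.1, by linarith [hx.2]⟩
  have hd := fun k (hk : k < 4) x (hx : x ∈ Icc ε (1 - ε)) =>
    hv.hasDerivAt_iteratedDeriv t (hsub hx) hk
  have hdc : ∀ k ≤ 4, ContinuousOn (iteratedDeriv k (v t)) (Icc ε (1 - ε)) := fun k hk =>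
    (hv.2.2.2.2.2.1 k hk).comp (f := fun x : ℝ => (t, x)) (by fun_prop)
      fun x hx => ⟨mem_univ _, hsub hx⟩
  have h0 : iteratedDeriv 0 (v t) = v t := iteratedDeriv_zero
  have i2 := integral_deriv_deriv_mul_sin hab (hd 0 (by norm_num)) (hd 1 (by norm_num))
    (hdc 2 (by norm_num)) hκ
  have i4 := integral_deriv_deriv_mul_sin hab (hd 2 (by norm_num)) (hd 3 (by norm_num))
    (hdc 4 le_rfl) hκ
  simp only [Nat.reduceAdd, h0] at i2 i4
  have hφ : Continuous fun x => sin (κ * (x - ε)) := by fun_prop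
  have hii : ∀ {b : ℝ → ℝ}, ContinuousOn b (Icc ε (1 - ε)) →
      IntervalIntegrable (fun x => b x * sin (κ * (x - ε))) volume ε (1 - ε) := fun hb =>
    ((hb.mul hφ.continuousOn).congr fun _ _ => rfl).intervalIntegrable_of_Icc hab
  have hR : ContinuousOn (reaction τ f g (clamp v) t) (Icc ε (1 - ε)) :=
    (continuous_slice (continuous_reaction H.continuous H.continuous_forcing hv.continuous_clamp)
      t).continuousOn
  have hmem : ∀ {x}, x ∈ Icc ε (1 - ε) → x ∈ Icc (0:ℝ) 1 := fun hx => Ioo_subset_Icc_self (hsub hx)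
  have hcl : shrunkCoeff κ ε (clamp v t) = ∫ x in ε..(1 - ε), v t x * sin (κ * (x - ε)) := by
    refine intervalIntegral.integral_congr fun x hx => ?_
    rw [uIcc_of_le hab] at hx
    simp only [clamp_of_mem v t (hmem hx)]
  have hb1 : shrunkBoundary κ ε (clamp v t)
      = κ * (v t (1 - ε) * cos (κ * (1 - ε - ε)) - v t ε) := by
    rw [shrunkBoundary, clamp_of_mem v t (hmem ⟨le_rfl, hab⟩),
      clamp_of_mem v t (hmem ⟨hab, le_rfl⟩)]
  have hb2 : shrunkBoundary κ ε (clamp (dx 2 v) t) = κ * (iteratedDeriv 2 (v t) (1 - ε)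
      * cos (κ * (1 - ε - ε)) - iteratedDeriv 2 (v t) ε) := by
    rw [shrunkBoundary, clamp_of_mem _ t (hmem ⟨le_rfl, hab⟩),
      clamp_of_mem _ t (hmem ⟨hab, le_rfl⟩)]
    rfl
  have hdt : shrunkCoeff κ ε (dt v t)
      = ∫ x in ε..(1 - ε), (reaction τ f g (clamp v) t x * sin (κ * (x - ε))
        + v t x * sin (κ * (x - ε)) + iteratedDeriv 2 (v t) x * sin (κ * (x - ε))
        - γ * (iteratedDeriv 4 (v t) x * sin (κ * (x - ε)))) := by
    refine intervalIntegral.integral_congr fun x hx => ?_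
    rw [uIcc_of_le hab] at hx
    have h1 := hv.2.2.2.2.2.2.2.1 t x (hsub hx)
    have h2 : reaction τ f g (clamp v) t x = g t x + f fun k => v (t - τ k) x := by
      simp only [reaction, projIcc_of_mem _ (hmem hx), clamp_of_mem v _ (hmem hx)]
    rw [← h2] at h1
    simp only [dx] at h1
    linear_combination sin (κ * (x - ε)) * h1
  have c0 : ContinuousOn (v t) (Icc ε (1 - ε)) := h0 ▸ hdc 0 (by norm_num)
  rw [hdt, intervalIntegral.integral_sub
    (((hii hR).add (hii c0)).add (hii (hdc 2 (by norm_num)))) ((hii (hdc 4 le_rfl)).const_mul γ),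
    intervalIntegral.integral_add ((hii hR).add (hii c0)) (hii (hdc 2 (by norm_num))),
    intervalIntegral.integral_add (hii hR) (hii c0), intervalIntegral.integral_const_mul,
    i4, i2, hcl, hb1, hb2, shrunkCoeff]
  ring

lemma IsPeriodicClassicalSolution.shrunkCoeff_sub
    (hv : IsPeriodicClassicalSolution γ ω τ f g v) {ε : ℝ} (hε : 0 < ε) (hε' : ε ≤ 1 / 4) (κ : ℝ)
    (s t : ℝ) : shrunkCoeff κ ε (clamp v t) - shrunkCoeff κ ε (clamp v s)
      = ∫ r in s..t, shrunkCoeff κ ε (dt v r) := by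
  have hab : ε ≤ 1 - ε := by linarith
  have hsub : Icc ε (1 - ε) ⊆ Ioo (0:ℝ) 1 := fun x hx =>
    ⟨hε.trans_le hx.1, by linarith [hx.2]⟩
  have hW := continuous_comp_projIcc hab hsub hv.2.2.2.2.1
  have hφ : Continuous fun x => sin (κ * (x - ε)) := by fun_prop
  have hc : Continuous (Function.uncurry fun r x =>
      dt v r (projIcc ε (1 - ε) hab x) * sin (κ * (x - ε))) :=
    hW.mul (hφ.comp continuous_snd)
  have hi : IntegrableOn (Function.uncurry fun r x =>
      dt v r (projIcc ε (1 - ε) hab x) * sin (κ * (x - ε)))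
      (uIoc s t ×ˢ uIoc ε (1 - ε)) volume :=
    (hc.continuousOn.integrableOn_compact (isCompact_uIcc.prod isCompact_uIcc)).mono_set
      (prod_mono uIoc_subset_uIcc uIoc_subset_uIcc)
  have e1 : ∀ r, shrunkCoeff κ ε (dt v r)
      = ∫ x in ε..(1 - ε), dt v r (projIcc ε (1 - ε) hab x) * sin (κ * (x - ε)) := fun r => by
    refine intervalIntegral.integral_congr fun x hx => ?_
    rw [uIcc_of_le hab] at hx
    simp only [projIcc_of_mem hab hx]
  simp only [e1]
  have hii : ∀ r, IntervalIntegrable (fun x => clamp v r x * sin (κ * (x - ε))) volume ε (1 - ε) :=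
    fun r => ((continuous_slice hv.continuous_clamp r).mul hφ).intervalIntegrable _ _
  rw [intervalIntegral_intervalIntegral_swap hi, shrunkCoeff, shrunkCoeff,
    ← intervalIntegral.integral_sub (hii t) (hii s)]
  refine intervalIntegral.integral_congr fun x hx => ?_
  rw [uIcc_of_le hab] at hx
  have hx' := hsub hx
  have hcx : Continuous fun r => dt v r x := by
    have := hW.comp (by fun_prop : Continuous fun r : ℝ => (r, x))
    simpa only [Function.comp_def, projIcc_of_mem hab hx] using this
  simp only [projIcc_of_mem hab hx, intervalIntegral.integral_mul_const,
    clamp_of_mem v _ (Ioo_subset_Icc_self hx')]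
  rw [intervalIntegral.integral_eq_sub_of_hasDerivAt (f := fun r => v r x)
    (f' := fun r => dt v r x) (fun r _ => (hv.2.2.1 r x hx').hasDerivAt)
    (hcx.intervalIntegrable _ _)]
  ring

lemma IsPeriodicClassicalSolution.hasDerivAt_sineCoeff (H : IsAdmissible f g β G)
    (hv : IsPeriodicClassicalSolution γ ω τ f g v) (k : ℕ) (t : ℝ) :
    HasDerivAt (fun t => sineCoeff (clamp v t) k) (sineCoeff (reaction τ f g (clamp v) t) k
      - eigenvalue γ k * sineCoeff (clamp v t) k) t := by
  have cv := hv.continuous_clamp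
  have c2 := hv.continuous_clamp_dx_two
  have cR := continuous_reaction (τ := τ) H.continuous H.continuous_forcing cv
  set K : ℝ → ℝ := fun ε => waveNumber k / max (1 - ε - ε) (1 / 2) with hKd
  have hK : Continuous K := by
    refine continuous_const.div (by fun_prop) fun ε => ?_
    exact (lt_of_lt_of_le (by norm_num) (le_max_right (1 - ε - ε) (1 / 2 : ℝ))).ne'
  have hK0 : K 0 = waveNumber k := by simp only [hKd]; norm_num
  set F : ℝ → ℝ → ℝ := fun ε r => shrunkCoeff (K ε) ε (reaction τ f g (clamp v) r)
      + (1 - K ε ^ 2 - γ * K ε ^ 4) * shrunkCoeff (K ε) ε (clamp v r)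
      - (1 + γ * K ε ^ 2) * shrunkBoundary (K ε) ε (clamp v r)
      + γ * shrunkBoundary (K ε) ε (clamp (dx 2 v) r) with hF
  have hFc : Continuous (Function.uncurry F) := by
    have h1 := continuous_shrunkCoeff cR hK
    have h2 := continuous_shrunkCoeff cv hK
    have h3 := continuous_shrunkBoundary cv hK
    have h4 := continuous_shrunkBoundary c2 hK
    simp only [hF, Function.uncurry_def]
    fun_prop
  have hcoeff : ∀ b : ℝ → ℝ, shrunkCoeff (K 0) 0 b = sineCoeff b k := fun b => by
    simp only [shrunkCoeff, sineCoeff, hK0, sub_zero]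
  have hF0 : ∀ r, F 0 r = sineCoeff (reaction τ f g (clamp v) r) k
      - eigenvalue γ k * sineCoeff (clamp v r) k := fun r => by
    obtain ⟨b0, b1, b20, b21⟩ := hv.2.2.2.2.2.2.2.2 r
    have m0 : (0:ℝ) ∈ Icc (0:ℝ) 1 := ⟨le_rfl, zero_le_one⟩
    have m1 : (1:ℝ) ∈ Icc (0:ℝ) 1 := ⟨zero_le_one, le_rfl⟩
    simp only [hF, hcoeff]
    simp only [shrunkBoundary, sub_zero, clamp_of_mem _ _ m0, clamp_of_mem _ _ m1, b0, b1, b20, b21,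
      hK0, eigenvalue]
    ring
  have key : ∀ s r, sineCoeff (clamp v r) k - sineCoeff (clamp v s) k = ∫ r in s..r, F 0 r := by
    intro s r
    have hl : Continuous fun ε =>
        shrunkCoeff (K ε) ε (clamp v r) - shrunkCoeff (K ε) ε (clamp v s) :=
      ((continuous_shrunkCoeff cv hK).comp (by fun_prop : Continuous fun ε : ℝ => (ε, r))).sub
        ((continuous_shrunkCoeff cv hK).comp (by fun_prop : Continuous fun ε : ℝ => (ε, s)))
    have hr : Continuous fun ε => ∫ r in s..r, F ε r :=
      intervalIntegral.continuous_parametric_intervalIntegral_of_continuous' hFc s r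
    have he : (fun ε => shrunkCoeff (K ε) ε (clamp v r) - shrunkCoeff (K ε) ε (clamp v s))
        =ᶠ[𝓝[>] 0] fun ε => ∫ r in s..r, F ε r := by
      filter_upwards [Ioc_mem_nhdsGT (show (0:ℝ) < 1 / 4 by norm_num)] with ε hε
      rw [hv.shrunkCoeff_sub hε.1 hε.2]
      have hκ : sin (K ε * (1 - ε - ε)) = 0 := by
        have h1 : 1 / 2 ≤ 1 - ε - ε := by linarith [hε.2]
        have h2 : K ε * (1 - ε - ε) = ((k + 1 : ℕ) : ℝ) * π := by
          simp only [hKd, max_eq_left h1, waveNumber]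
          rw [div_mul_cancel₀ _ (by linarith)]
          push_cast; ring
        rw [h2, sin_nat_mul_pi]
      simp only [hv.shrunkCoeff_dt H hε.1 hε.2 hκ, hF]
    have := tendsto_nhds_unique_of_eventuallyEq (hl.continuousWithinAt (s := Ioi 0) (x := 0))
      (hr.continuousWithinAt (s := Ioi 0) (x := 0)) he
    simpa only [hcoeff] using this
  have hF0c : Continuous (F 0) := hFc.comp (by fun_prop : Continuous fun r : ℝ => ((0:ℝ), r))
  have h1 := (hasDerivAt_integral_of_continuous hF0c t t).const_add (sineCoeff (clamp v t) k)
  rw [hF0] at h1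
  exact h1.congr_of_eventuallyEq (.of_forall fun r => eq_add_of_sub_eq' (key t r))

lemma IsPeriodicClassicalSolution.isMild_clamp (hγ : 0 < γ) (hω : 0 < ω)
    (H : IsAdmissible f g β G) (hv : IsPeriodicClassicalSolution γ ω τ f g v) :
    IsMild γ τ f g (clamp v) := by
  obtain ⟨M, hM⟩ := hv.exists_bound hω
  refine ⟨hv.continuous_clamp, ⟨M, hM⟩, fun t k => ?_⟩
  exact eq_decayConv (c := fun t => sineCoeff (clamp v t) k) (eigenvalue_pos hγ k)
    (continuous_sineCoeff (continuous_reaction H.continuous H.continuous_forcing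
      hv.continuous_clamp) k)
    (fun r => abs_sineCoeff_le (fun x _ => abs_reaction_le H.pos H.lipschitz H.bound_forcing hM r x)
      k)
    (fun r => abs_sineCoeff_le (fun x _ => hM r x) k) (hv.hasDerivAt_sineCoeff H k) t

end Classical

/-- Theorem 1.2: existence and uniqueness of the time `ω`-periodic classical solution
of the delayed extended Fisher–Kolmogorov equation under conditions (H3) and (H2). -/
theorem efk_periodic_classical_solution_exists_unique
    (γ ω : ℝ) (hγ : 0 < γ) (hω : 0 < ω) (n : ℕ) (hn : 1 ≤ n)
    (τ : Fin n → ℝ) (hτ : ∀ k, 0 < τ k)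
    (f : (Fin n → ℝ) → ℝ) (hf : LocallyLipschitz f)
    (g : ℝ → ℝ → ℝ)
    (hg : ∃ L > (0:ℝ), ∃ θ : ℝ, 0 < θ ∧ θ ≤ 1 ∧
      ∀ t : ℝ, ∀ x ∈ Icc (0:ℝ) 1, ∀ s : ℝ, ∀ y ∈ Icc (0:ℝ) 1,
        |g t x - g s y| ≤ L * (|t - s| + |x - y|) ^ θ)
    (hgper : ∀ t : ℝ, ∀ x ∈ Icc (0:ℝ) 1, g (t + ω) x = g t x)
    (β : Fin n → ℝ) (hβ : ∀ k, 0 < β k)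
    (hH3 : ∀ ξ η : Fin n → ℝ, |f ξ - f η| ≤ ∑ k, β k * |ξ k - η k|)
    (hH2 : ∑ k, β k < γ * π ^ 4 + π ^ 2 - 1) :
    ∃ u : ℝ → ℝ → ℝ, IsPeriodicClassicalSolution γ ω τ f g u ∧
      ∀ v : ℝ → ℝ → ℝ, IsPeriodicClassicalSolution γ ω τ f g v →
        ∀ t : ℝ, ∀ x ∈ Icc (0:ℝ) 1, v t x = u t x := by
  obtain ⟨L, hL, θ, hθ, -, hg⟩ := hg
  obtain ⟨G, hG⟩ := exists_bound_of_holder_of_periodic hω hL hθ hg hgper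
  have H : IsAdmissible f g β G :=
    ⟨hβ, hf.continuous, hH3, continuous_clamp_of_holder hθ hg, hG⟩
  have hq : ∑ k, β k < eigenvalue γ 0 := by rwa [eigenvalue_zero]
  obtain ⟨u, hu, hm⟩ := exists_isPeriodicClassicalSolution hγ H hq hL hθ hg hgper τ
  refine ⟨u, hu, fun v hv t x hx => ?_⟩
  have hv' := hv.isMild_clamp hγ hω H
  rw [← clamp_of_mem v t hx]
  exact eqOn_of_sineCoeff_eq (continuous_slice hv'.continuous t) (continuous_slice hm.continuous t)
    (hv'.sineCoeff_eq hγ H hq hm t) hx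
end

section
/- Let γ > 0 and let u : [0,1] → ℝ be four times continuously differentiable with u(0) = u(1) = u″(0) = u″(1) = 0. Then ∫₀¹ (γ u⁗(x) − u″(x) − u(x)) · u(x) dx ≥ (γπ⁴ + π² − 1) ∫₀¹ (u(x))² dx. Moreover, ∫₀¹ (γ u⁗(x) − u″(x) − u(x)) · u(x) dx ≥ ∫₀¹ (u(x))² dx, with equality to 0 if and only if u ≡ 0; in particular the EFK operator with Navier boundary conditions is positive definite. -/
open Real Set

/-- `k`-th derivative of `f` within the interval `[0,1]`. -/
noncomputable def D (k : ℕ) (f : ℝ → ℝ) : ℝ → ℝ := iteratedDerivWithin k f (Set.Icc (0:ℝ) 1)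

/-- A parametrized Wirtinger inequality, obtained by completing the square with the
antiderivative `a * f ^ 2 * tan (a * (x - 1 / 2))`, which is regular for `a < π`. -/
lemma sq_mul_integral_sq_le_of_lt_pi {f f' : ℝ → ℝ} {a : ℝ} (ha0 : 0 < a) (ha : a < π)
    (hf : ContinuousOn f (Icc 0 1)) (hf' : ContinuousOn f' (Icc 0 1))
    (hd : ∀ x ∈ Ioo (0 : ℝ) 1, HasDerivAt f (f' x) x) (h0 : f 0 = 0) (h1 : f 1 = 0) :
    a ^ 2 * ∫ x in (0 : ℝ)..1, f x ^ 2 ≤ ∫ x in (0 : ℝ)..1, f' x ^ 2 := by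
  have hcos : ∀ x ∈ Icc (0 : ℝ) 1, cos (a * (x - 1 / 2)) ≠ 0 := fun x hx ↦
    (cos_pos_of_mem_Ioo ⟨by nlinarith [hx.1, hx.2], by nlinarith [hx.1, hx.2]⟩).ne'
  have htan : ContinuousOn (fun x ↦ tan (a * (x - 1 / 2))) (Icc 0 1) := fun x hx ↦
    ContinuousAt.continuousWithinAt <|
      (continuousAt_tan.2 (hcos x hx)).comp (f := fun x ↦ a * (x - 1 / 2)) (by fun_prop)
  have hdtan : ∀ x ∈ Ioo (0 : ℝ) 1, HasDerivAt (fun x ↦ tan (a * (x - 1 / 2)))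
      (a * (1 + tan (a * (x - 1 / 2)) ^ 2)) x := fun x hx ↦ by
    have hc := hcos x (Ioo_subset_Icc_self hx)
    have h := (hasDerivAt_tan hc).comp x
      (((hasDerivAt_id x).sub_const (1 / 2)).const_mul a)
    refine h.congr_deriv ?_
    rw [← inv_one_add_tan_sq hc]
    simp only [one_div, inv_inv]
    ring
  have hint {g : ℝ → ℝ} (hg : ContinuousOn g (Icc 0 1)) :
      IntervalIntegrable g MeasureTheory.volume 0 1 :=
    hg.intervalIntegrable_of_Icc zero_le_one
  set t : ℝ → ℝ := fun x ↦ tan (a * (x - 1 / 2)) with ht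
  have hF := intervalIntegral.integral_eq_sub_of_hasDerivAt_of_le zero_le_one
    (f := fun x ↦ a * (f x ^ 2 * t x))
    (f' := fun x ↦ (f' x + a * t x * f x) ^ 2 - f' x ^ 2 + a ^ 2 * f x ^ 2)
    (by fun_prop)
    (fun x hx ↦ by
      have h := (((hd x hx).pow 2).mul (hdtan x hx)).const_mul a
      refine h.congr_deriv ?_
      simp only [ht, Pi.pow_apply]
      push_cast
      ring)
    (hint (by fun_prop))
  rw [intervalIntegral.integral_add (hint (by fun_prop)) (hint (by fun_prop)),
    intervalIntegral.integral_sub (hint (by fun_prop)) (hint (by fun_prop)),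
    intervalIntegral.integral_const_mul, h0, h1] at hF
  have hpos : 0 ≤ ∫ x in (0 : ℝ)..1, (f' x + a * t x * f x) ^ 2 :=
    intervalIntegral.integral_nonneg zero_le_one fun x _ ↦ sq_nonneg _
  linarith

/-- The Wirtinger inequality on `[0, 1]` with Dirichlet boundary conditions. -/
lemma pi_sq_mul_integral_sq_le {f f' : ℝ → ℝ}
    (hf : ContinuousOn f (Icc 0 1)) (hf' : ContinuousOn f' (Icc 0 1))
    (hd : ∀ x ∈ Ioo (0 : ℝ) 1, HasDerivAt f (f' x) x) (h0 : f 0 = 0) (h1 : f 1 = 0) :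
    π ^ 2 * ∫ x in (0 : ℝ)..1, f x ^ 2 ≤ ∫ x in (0 : ℝ)..1, f' x ^ 2 := by
  have hcont : Continuous fun a : ℝ ↦ a ^ 2 * ∫ x in (0 : ℝ)..1, f x ^ 2 := by fun_prop
  refine le_of_tendsto (hcont.continuousWithinAt (s := Iio π) (x := π)) ?_
  filter_upwards [Ioo_mem_nhdsLT pi_pos] with a ha
  exact sq_mul_integral_sq_le_of_lt_pi ha.1 ha.2 hf hf' hd h0 h1

lemma continuousOn_D {n : WithTop ℕ∞} {f : ℝ → ℝ} (hf : ContDiffOn ℝ n f (Icc 0 1)) {k : ℕ}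
    (hk : k ≤ n) : ContinuousOn (D k f) (Icc 0 1) :=
  hf.continuousOn_iteratedDerivWithin hk (uniqueDiffOn_Icc zero_lt_one)

lemma hasDerivAt_D {n : WithTop ℕ∞} {f : ℝ → ℝ} (hf : ContDiffOn ℝ n f (Icc 0 1)) {k : ℕ}
    (hk : k < n) {x : ℝ} (hx : x ∈ Ioo (0 : ℝ) 1) :
    HasDerivAt (D k f) (D (k + 1) f x) x := by
  have h := (hf.differentiableOn_iteratedDerivWithin hk (uniqueDiffOn_Icc zero_lt_one) x
    (Ioo_subset_Icc_self hx)).hasDerivWithinAt.hasDerivAt (Icc_mem_nhds hx.1 hx.2)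
  rwa [← iteratedDerivWithin_succ] at h

/-- Positive definiteness of the EFK operator `Au = γu⁗ − u″ − u` with Navier
boundary conditions: `⟨Au, u⟩ ≥ (γπ⁴ + π² − 1)‖u‖²`, hence `⟨Au, u⟩ ≥ ‖u‖²`, and
`⟨Au, u⟩ = 0` if and only if `u ≡ 0` on `[0,1]`. -/
theorem efk_operator_positive_definite
    (γ : ℝ) (hγ : 0 < γ) (u : ℝ → ℝ)
    (hu : ContDiffOn ℝ 4 u (Icc 0 1))
    (hu0 : u 0 = 0) (hu1 : u 1 = 0) (hu''0 : D 2 u 0 = 0) (hu''1 : D 2 u 1 = 0) :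
    (γ * π ^ 4 + π ^ 2 - 1) * (∫ x in (0:ℝ)..1, (u x) ^ 2)
        ≤ ∫ x in (0:ℝ)..1, (γ * D 4 u x - D 2 u x - u x) * u x ∧
    (∫ x in (0:ℝ)..1, (u x) ^ 2)
        ≤ ∫ x in (0:ℝ)..1, (γ * D 4 u x - D 2 u x - u x) * u x ∧
    ((∫ x in (0:ℝ)..1, (γ * D 4 u x - D 2 u x - u x) * u x) = 0 ↔
        ∀ x ∈ Icc (0:ℝ) 1, u x = 0) := by
  have c0 : ContinuousOn u (Icc 0 1) := hu.continuousOn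
  have c1 : ContinuousOn (D 1 u) (Icc 0 1) := continuousOn_D hu (by norm_num)
  have c2 : ContinuousOn (D 2 u) (Icc 0 1) := continuousOn_D hu (by norm_num)
  have c3 : ContinuousOn (D 3 u) (Icc 0 1) := continuousOn_D hu (by norm_num)
  have c4 : ContinuousOn (D 4 u) (Icc 0 1) := continuousOn_D hu (by norm_num)
  have d0 : ∀ x ∈ Ioo (0 : ℝ) 1, HasDerivAt u (D 1 u x) x := fun x hx ↦ by
    have h := hasDerivAt_D hu (k := 0) (by norm_num) hx
    rwa [D, iteratedDerivWithin_zero] at h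
  have d1 : ∀ x ∈ Ioo (0 : ℝ) 1, HasDerivAt (D 1 u) (D 2 u x) x := fun x hx ↦
    hasDerivAt_D hu (by norm_num) hx
  have d2 : ∀ x ∈ Ioo (0 : ℝ) 1, HasDerivAt (D 2 u) (D 3 u x) x := fun x hx ↦
    hasDerivAt_D hu (by norm_num) hx
  have d3 : ∀ x ∈ Ioo (0 : ℝ) 1, HasDerivAt (D 3 u) (D 4 u x) x := fun x hx ↦
    hasDerivAt_D hu (by norm_num) hx
  have hint {g : ℝ → ℝ} (hg : ContinuousOn g (Icc 0 1)) :
      IntervalIntegrable g MeasureTheory.volume 0 1 :=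
    hg.intervalIntegrable_of_Icc zero_le_one
  have wirtinger := pi_sq_mul_integral_sq_le c0 c1 d0 hu0 hu1
  have hparts : ∫ x in (0 : ℝ)..1, (D 2 u x * u x + D 1 u x ^ 2) = 0 := by
    rw [intervalIntegral.integral_eq_sub_of_hasDerivAt_of_le zero_le_one
      (f := fun x ↦ D 1 u x * u x) (by fun_prop)
      (fun x hx ↦ by
        refine ((d1 x hx).mul (d0 x hx)).congr_deriv ?_
        ring)
      (hint (by fun_prop)), hu0, hu1]
    ring
  have hparts' : ∫ x in (0 : ℝ)..1, (D 4 u x * u x - D 2 u x ^ 2) = 0 := by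
    rw [intervalIntegral.integral_eq_sub_of_hasDerivAt_of_le zero_le_one
      (f := fun x ↦ D 3 u x * u x - D 2 u x * D 1 u x) (by fun_prop)
      (fun x hx ↦ by
        refine (((d3 x hx).mul (d0 x hx)).sub ((d2 x hx).mul (d1 x hx))).congr_deriv ?_
        ring)
      (hint (by fun_prop)), hu0, hu1, hu''0, hu''1]
    ring
  have hsq : 0 ≤ ∫ x in (0 : ℝ)..1, (D 2 u x + π ^ 2 * u x) ^ 2 :=
    intervalIntegral.integral_nonneg zero_le_one fun x _ ↦ sq_nonneg _
  have hexpand : ∫ x in (0 : ℝ)..1, (D 2 u x + π ^ 2 * u x) ^ 2 =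
      (∫ x in (0 : ℝ)..1, D 2 u x ^ 2) + 2 * π ^ 2 * (∫ x in (0 : ℝ)..1, D 2 u x * u x)
        + π ^ 4 * ∫ x in (0 : ℝ)..1, u x ^ 2 := by
    rw [← intervalIntegral.integral_const_mul, ← intervalIntegral.integral_const_mul,
      ← intervalIntegral.integral_add (hint (by fun_prop)) (hint (by fun_prop)),
      ← intervalIntegral.integral_add (hint (by fun_prop)) (hint (by fun_prop))]
    congr 1
    ext x
    ring
  have henergy : ∫ x in (0 : ℝ)..1, (γ * D 4 u x - D 2 u x - u x) * u x =
      γ * (∫ x in (0 : ℝ)..1, D 4 u x * u x) - (∫ x in (0 : ℝ)..1, D 2 u x * u x)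
        - ∫ x in (0 : ℝ)..1, u x ^ 2 := by
    rw [← intervalIntegral.integral_const_mul,
      ← intervalIntegral.integral_sub (hint (by fun_prop)) (hint (by fun_prop)),
      ← intervalIntegral.integral_sub (hint (by fun_prop)) (hint (by fun_prop))]
    congr 1
    ext x
    ring
  rw [intervalIntegral.integral_add (hint (by fun_prop)) (hint (by fun_prop))] at hparts
  rw [intervalIntegral.integral_sub (hint (by fun_prop)) (hint (by fun_prop))] at hparts'
  have hnonneg : 0 ≤ ∫ x in (0 : ℝ)..1, u x ^ 2 :=
    intervalIntegral.integral_nonneg zero_le_one fun x _ ↦ sq_nonneg _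
  have hbiharmonic : π ^ 4 * (∫ x in (0 : ℝ)..1, u x ^ 2) ≤ ∫ x in (0 : ℝ)..1, D 4 u x * u x := by
    nlinarith [mul_le_mul_of_nonneg_left wirtinger (sq_nonneg π)]
  have hspectral : (γ * π ^ 4 + π ^ 2 - 1) * (∫ x in (0 : ℝ)..1, u x ^ 2) ≤
      ∫ x in (0 : ℝ)..1, (γ * D 4 u x - D 2 u x - u x) * u x := by
    nlinarith [mul_le_mul_of_nonneg_left hbiharmonic hγ.le]
  have hcoef : 1 ≤ γ * π ^ 4 + π ^ 2 - 1 := by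
    have : 0 < γ * π ^ 4 := by positivity
    nlinarith [pi_gt_three]
  have hcoercive := (le_mul_of_one_le_left hnonneg hcoef).trans hspectral
  refine ⟨hspectral, hcoercive, fun h ↦ ?_, fun h ↦ ?_⟩
  · by_contra! hne
    obtain ⟨c, hc, hcne⟩ := hne
    have hpos : 0 < ∫ x in (0 : ℝ)..1, u x ^ 2 :=
      intervalIntegral.integral_pos zero_lt_one (by fun_prop) (fun x _ ↦ sq_nonneg _)
        ⟨c, hc, by positivity⟩
    linarith
  · rw [intervalIntegral.integral_congr (g := fun _ ↦ 0) fun x hx ↦ ?_,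
      intervalIntegral.integral_zero]
    rw [uIcc_of_le zero_le_one] at hx
    simp [h x hx]
end

section
/- Let γ > 0. For every continuous φ : [0,1] → ℝ there exists a four times continuously differentiable function u : [0,1] → ℝ such that γ u⁗(x) − u″(x) − u(x) = φ(x) for all x ∈ [0,1], and u(0) = u(1) = 0, u″(0) = u″(1) = 0; that is, the fourth-order two-point boundary value problem for the EFK operator with Navier boundary conditions is solvable for every continuous right-hand side. -/
open Real Set

/-- A function on `ℝ` whose derivative is `C^n` is `C^(n+1)`. -/
lemma contDiff_succ_of_hasDerivAt {n : ℕ} {f f' : ℝ → ℝ} (h : ∀ x, HasDerivAt f (f' x) x)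
    (hf' : ContDiff ℝ n f') : ContDiff ℝ ((n + 1 : ℕ) : WithTop ℕ∞) f := by
  have hd : deriv f = f' := funext fun x => (h x).deriv
  rw [Nat.cast_succ, contDiff_succ_iff_deriv]
  exact ⟨fun x => (h x).differentiableAt, fun hn => absurd hn (by simp), hd ▸ hf'⟩

/-- The Dirichlet problem `-v'' + μ v = ψ` on `[0,1]`, by variation of parameters. -/
lemma exists_dirichlet_solution {μ : ℝ} {s c ψ : ℝ → ℝ} (hs : ∀ x, HasDerivAt s (c x) x)
    (hc : ∀ x, HasDerivAt c (μ * s x) x) (h0 : s 0 = 0) (h1 : s 1 ≠ 0)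
    (hw : ∀ x, c x ^ 2 - μ * s x ^ 2 = 1) (hψ : Continuous ψ) :
    ∃ v w : ℝ → ℝ, (∀ x, HasDerivAt v (w x) x) ∧ (∀ x, HasDerivAt w (μ * v x - ψ x) x) ∧
      v 0 = 0 ∧ v 1 = 0 := by
  have hsc : Continuous s := continuous_iff_continuousAt.2 fun x => (hs x).continuousAt
  have hcc : Continuous c := continuous_iff_continuousAt.2 fun x => (hc x).continuousAt
  obtain ⟨I, hI, hI0⟩ : ∃ I : ℝ → ℝ, (∀ x, HasDerivAt I (c x * ψ x) x) ∧ I 0 = 0 :=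
    ⟨fun x => ∫ t in (0 : ℝ)..x, c t * ψ t,
      fun x => (hcc.mul hψ).integral_hasStrictDerivAt 0 x |>.hasDerivAt, by simp⟩
  obtain ⟨J, hJ, hJ0⟩ : ∃ J : ℝ → ℝ, (∀ x, HasDerivAt J (s x * ψ x) x) ∧ J 0 = 0 :=
    ⟨fun x => ∫ t in (0 : ℝ)..x, s t * ψ t,
      fun x => (hsc.mul hψ).integral_hasStrictDerivAt 0 x |>.hasDerivAt, by simp⟩
  let k := (c 1 * J 1 - s 1 * I 1) / s 1
  refine ⟨fun x => c x * J x - s x * I x - k * s x,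
    fun x => μ * s x * J x - c x * I x - k * c x, fun x => ?_, fun x => ?_, ?_, ?_⟩
  · refine ((((hc x).mul (hJ x)).sub ((hs x).mul (hI x))).sub
      ((hs x).const_mul k)).congr_deriv ?_
    ring
  · refine (((((hs x).const_mul μ).mul (hJ x)).sub ((hc x).mul (hI x))).sub
      ((hc x).const_mul k)).congr_deriv ?_
    linear_combination (-ψ x) * hw x
  · simp [h0, hJ0]
  · simp only [k]
    field_simp
    ring

lemma exists_dirichlet_solution_of_pos {μ : ℝ} (hμ : 0 < μ) {ψ : ℝ → ℝ} (hψ : Continuous ψ) :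
    ∃ v w : ℝ → ℝ, (∀ x, HasDerivAt v (w x) x) ∧ (∀ x, HasDerivAt w (μ * v x - ψ x) x) ∧
      v 0 = 0 ∧ v 1 = 0 := by
  obtain ⟨a, ha, rfl⟩ : ∃ a : ℝ, 0 < a ∧ a ^ 2 = μ := ⟨√μ, sqrt_pos.2 hμ, sq_sqrt hμ.le⟩
  have hd : ∀ x : ℝ, HasDerivAt (fun x => a * x) a x := fun x => by
    simpa using (hasDerivAt_id x).const_mul a
  refine exists_dirichlet_solution (s := fun x => sinh (a * x) / a) (c := fun x => cosh (a * x))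
    (fun x => ?_) (fun x => ?_) (by simp) ?_ (fun x => ?_) hψ
  · refine ((hd x).sinh.div_const a).congr_deriv ?_
    field_simp
  · refine ((hd x).cosh).congr_deriv ?_
    field_simp
  · simp [ha.ne']
  · field_simp
    linear_combination cosh_sq_sub_sinh_sq (a * x)

lemma exists_dirichlet_solution_of_neg {μ : ℝ} (hμ : μ < 0) (hμπ : -π ^ 2 < μ) {ψ : ℝ → ℝ}
    (hψ : Continuous ψ) :
    ∃ v w : ℝ → ℝ, (∀ x, HasDerivAt v (w x) x) ∧ (∀ x, HasDerivAt w (μ * v x - ψ x) x) ∧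
      v 0 = 0 ∧ v 1 = 0 := by
  obtain ⟨b, hb, rfl⟩ : ∃ b : ℝ, 0 < b ∧ -b ^ 2 = μ :=
    ⟨√(-μ), sqrt_pos.2 (by linarith), by rw [sq_sqrt (by linarith)]; ring⟩
  have hbπ : b < π := lt_of_pow_lt_pow_left₀ 2 pi_pos.le (by linarith)
  have hd : ∀ x : ℝ, HasDerivAt (fun x => b * x) b x := fun x => by
    simpa using (hasDerivAt_id x).const_mul b
  refine exists_dirichlet_solution (s := fun x => sin (b * x) / b) (c := fun x => cos (b * x))
    (fun x => ?_) (fun x => ?_) (by simp) ?_ (fun x => ?_) hψ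
  · refine ((hd x).sin.div_const b).congr_deriv ?_
    field_simp
  · refine ((hd x).cos).congr_deriv ?_
    field_simp
  · simp [hb.ne', (sin_pos_of_pos_of_lt_pi hb hbπ).ne']
  · field_simp
    linear_combination cos_sq_add_sin_sq (b * x)

/-- The roots of `γ μ² - μ - 1`. -/
lemma exists_efk_roots {γ : ℝ} (hγ : 0 < γ) :
    ∃ μ₁ μ₂ : ℝ, 0 < μ₁ ∧ μ₂ < 0 ∧ -π ^ 2 < μ₂ ∧ γ * (μ₁ + μ₂) = 1 ∧ γ * (μ₁ * μ₂) = -1 := by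
  have hr : √(1 + 4 * γ) ^ 2 = 1 + 4 * γ := sq_sqrt (by linarith)
  have hr1 : 1 < √(1 + 4 * γ) := by rw [lt_sqrt (by norm_num)]; linarith
  set r := √(1 + 4 * γ)
  refine ⟨(1 + r) / (2 * γ), (1 - r) / (2 * γ), by positivity,
    div_neg_of_neg_of_pos (by linarith) (by positivity), ?_, by field_simp; ring, ?_⟩
  · have h : -1 < (1 - r) / (2 * γ) := by
      rw [lt_div_iff₀ (by positivity)]
      nlinarith
    nlinarith [pi_gt_three]
  · field_simp
    linear_combination -hr

/-- Solvability of the fourth-order two-point boundary value problem for the EFK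
operator with Navier boundary conditions: for `γ > 0` and every continuous
`φ : [0,1] → ℝ` there is a four times continuously differentiable `u` with
`γu⁗ − u″ − u = φ` on `[0,1]` and `u(0) = u(1) = u″(0) = u″(1) = 0`. -/
theorem efk_bvp_solvable
    (γ : ℝ) (hγ : 0 < γ) (φ : ℝ → ℝ) (hφ : ContinuousOn φ (Icc 0 1)) :
    ∃ u : ℝ → ℝ, ContDiffOn ℝ 4 u (Icc 0 1) ∧
      (∀ x ∈ Icc (0:ℝ) 1, γ * D 4 u x - D 2 u x - u x = φ x) ∧
      u 0 = 0 ∧ u 1 = 0 ∧ D 2 u 0 = 0 ∧ D 2 u 1 = 0 := by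
  obtain ⟨Φ, hΦ, hΦφ⟩ : ∃ Φ : ℝ → ℝ, Continuous Φ ∧ ∀ x ∈ Icc (0:ℝ) 1, Φ x = φ x :=
    ⟨IccExtend zero_le_one ((Icc (0:ℝ) 1).domRestrict φ), hφ.domRestrict.Icc_extend',
      fun x hx => by rw [IccExtend_of_mem _ _ hx]; rfl⟩
  obtain ⟨μ₁, μ₂, h1, h2, h2π, hsum, hprod⟩ := exists_efk_roots hγ
  obtain ⟨v, w, hv, hw, hv0, hv1⟩ := exists_dirichlet_solution_of_pos h1 (hΦ.div_const γ)
  have hvc : Continuous v := continuous_iff_continuousAt.2 fun x => (hv x).continuousAt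
  obtain ⟨u, p, hu, hp, hu0, hu1⟩ := exists_dirichlet_solution_of_neg h2 h2π hvc
  have hp' : ∀ x, HasDerivAt (fun x => μ₂ * u x - v x) (μ₂ * p x - w x) x :=
    fun x => ((hu x).const_mul μ₂).sub (hv x)
  have hp'' : ∀ x, HasDerivAt (fun x => μ₂ * p x - w x)
      (μ₂ * (μ₂ * u x - v x) - (μ₁ * v x - Φ x / γ)) x :=
    fun x => ((hp x).const_mul μ₂).sub (hw x)
  have huc : Continuous u := continuous_iff_continuousAt.2 fun x => (hu x).continuousAt
  have hcd : ContDiff ℝ 4 u := by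
    refine contDiff_succ_of_hasDerivAt (n := 3) hu (contDiff_succ_of_hasDerivAt (n := 2) hp
      (contDiff_succ_of_hasDerivAt (n := 1) hp' (contDiff_succ_of_hasDerivAt (n := 0) hp'' ?_)))
    rw [Nat.cast_zero, contDiff_zero]
    fun_prop
  have hd2 : iteratedDeriv 2 u = fun x => μ₂ * u x - v x := by
    rw [iteratedDeriv_succ, iteratedDeriv_one, funext fun x => (hu x).deriv]
    exact funext fun x => (hp x).deriv
  have hd4 : iteratedDeriv 4 u =
      fun x => μ₂ * (μ₂ * u x - v x) - (μ₁ * v x - Φ x / γ) := by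
    rw [iteratedDeriv_succ, iteratedDeriv_succ, hd2, funext fun x => (hp' x).deriv]
    exact funext fun x => (hp'' x).deriv
  have hD2 : ∀ x ∈ Icc (0:ℝ) 1, D 2 u x = μ₂ * u x - v x := fun x hx => by
    rw [D, iteratedDerivWithin_eq_iteratedDeriv (uniqueDiffOn_Icc zero_lt_one)
      (hcd.of_le (by norm_num)).contDiffAt hx, hd2]
  have hD4 : ∀ x ∈ Icc (0:ℝ) 1,
      D 4 u x = μ₂ * (μ₂ * u x - v x) - (μ₁ * v x - Φ x / γ) := fun x hx => by
    rw [D, iteratedDerivWithin_eq_iteratedDeriv (uniqueDiffOn_Icc zero_lt_one)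
      hcd.contDiffAt hx, hd4]
  refine ⟨u, hcd.contDiffOn, fun x hx => ?_, hu0, hu1, ?_, ?_⟩
  · have hγΦ : γ * (Φ x / γ) = Φ x := by field_simp
    rw [hD4 x hx, hD2 x hx, ← hΦφ x hx]
    linear_combination hγΦ + (μ₂ * u x - v x) * hsum - u x * hprod
  · rw [hD2 0 (by simp), hu0, hv0]; ring
  · rw [hD2 1 (by simp), hu1, hv1]; ring
end

section
/- Let γ > 0 and let u : [0,1] → ℝ be four times continuously differentiable with u(0) = u(1) = u″(0) = u″(1) = 0 and γ u⁗(x) − u″(x) − u(x) = 0 for all x ∈ [0,1]. Then u ≡ 0. Consequently, for every continuous φ : [0,1] → ℝ, the boundary value problem γ u⁗ − u″ − u = φ, u(0) = u(1) = u″(0) = u″(1) = 0 has at most one four times continuously differentiable solution. -/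
open Real Set

theorem D_zero (f : ℝ → ℝ) : D 0 f = f := iteratedDerivWithin_zero

theorem hasDerivWithinAt_D {u : ℝ → ℝ} {n k : ℕ} (hu : ContDiffOn ℝ n u (Icc 0 1)) (hk : k < n)
    {x : ℝ} (hx : x ∈ Icc (0:ℝ) 1) : HasDerivWithinAt (D k u) (D (k + 1) u x) (Icc 0 1) x := by
  have h := (hu.differentiableOn_iteratedDerivWithin (m := k) (by exact_mod_cast hk)
    (uniqueDiffOn_Icc zero_lt_one) x hx).hasDerivWithinAt
  rwa [← iteratedDerivWithin_succ] at h

theorem D_sub {v w : ℝ → ℝ} {n k : ℕ} (hv : ContDiffOn ℝ n v (Icc 0 1))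
    (hw : ContDiffOn ℝ n w (Icc 0 1)) (hk : k ≤ n) {x : ℝ} (hx : x ∈ Icc (0:ℝ) 1) :
    D k (v - w) x = D k v x - D k w x :=
  iteratedDerivWithin_sub hx (uniqueDiffOn_Icc zero_lt_one)
    ((hv x hx).of_le (by exact_mod_cast hk)) ((hw x hx).of_le (by exact_mod_cast hk))

/-- The boundary term of the energy identity for `γu⁗ − u″ − u`, with the extra term
`(1 - 2x) u²` (as in Jacobi's proof of the Poincaré inequality) that makes it nonincreasing along
solutions. -/
noncomputable def energyFlux (γ : ℝ) (u : ℝ → ℝ) (x : ℝ) : ℝ :=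
  γ * (D 3 u x * u x - D 2 u x * D 1 u x) - D 1 u x * u x + (1 - 2 * x) * (u x * u x)

theorem hasDerivWithinAt_energyFlux {γ : ℝ} {u : ℝ → ℝ} (hu : ContDiffOn ℝ 4 u (Icc 0 1))
    {x : ℝ} (hx : x ∈ Icc (0:ℝ) 1) (hode : γ * D 4 u x - D 2 u x - u x = 0) :
    HasDerivWithinAt (energyFlux γ u)
      (-(γ * D 2 u x ^ 2 + (D 1 u x - (1 - 2 * x) * u x) ^ 2 + 4 * (x * (1 - x)) * u x ^ 2))
      (Icc 0 1) x := by
  have h0 : HasDerivWithinAt u (D 1 u x) (Icc 0 1) x := by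
    simpa only [D_zero] using hasDerivWithinAt_D (n := 4) (k := 0) hu (by norm_num) hx
  have h1 : HasDerivWithinAt (D 1 u) (D 2 u x) (Icc 0 1) x :=
    hasDerivWithinAt_D (n := 4) hu (by norm_num) hx
  have h2 : HasDerivWithinAt (D 2 u) (D 3 u x) (Icc 0 1) x :=
    hasDerivWithinAt_D (n := 4) hu (by norm_num) hx
  have h3 : HasDerivWithinAt (D 3 u) (D 4 u x) (Icc 0 1) x :=
    hasDerivWithinAt_D (n := 4) hu (by norm_num) hx
  have hk : HasDerivWithinAt (fun y : ℝ => 1 - 2 * y) (-(2 * 1)) (Icc 0 1) x :=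
    ((hasDerivWithinAt_id x _).const_mul 2).const_sub 1
  have h := (((h3.mul h0).sub (h2.mul h1)).const_mul γ |>.sub (h1.mul h0)).add
    (hk.mul (h0.mul h0))
  refine HasDerivWithinAt.congr_deriv h ?_
  simp only [Pi.mul_apply]
  linear_combination u x * hode

theorem eqOn_zero_of_homogeneous {γ : ℝ} (hγ : 0 < γ) {u : ℝ → ℝ}
    (hu : ContDiffOn ℝ 4 u (Icc 0 1))
    (hu0 : u 0 = 0) (hu1 : u 1 = 0) (hu''0 : D 2 u 0 = 0) (hu''1 : D 2 u 1 = 0)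
    (hhom : ∀ x ∈ Icc (0:ℝ) 1, γ * D 4 u x - D 2 u x - u x = 0) :
    ∀ x ∈ Icc (0:ℝ) 1, u x = 0 := by
  have hderiv := fun x (hx : x ∈ Icc (0:ℝ) 1) => hasDerivWithinAt_energyFlux hu hx (hhom x hx)
  have hanti : AntitoneOn (energyFlux γ u) (Icc 0 1) := by
    refine antitoneOn_of_hasDerivWithinAt_nonpos (convex_Icc 0 1)
      (fun x hx => (hderiv x hx).continuousWithinAt)
      (fun x hx => (hderiv x (interior_subset hx)).mono interior_subset) fun x hx => ?_
    have hx' := interior_subset hx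
    have := mul_nonneg hx'.1 (sub_nonneg.2 hx'.2)
    exact neg_nonpos.2 (by positivity)
  have hG0 : energyFlux γ u 0 = 0 := by simp [energyFlux, hu0, hu''0]
  have hG1 : energyFlux γ u 1 = 0 := by simp [energyFlux, hu1, hu''1]
  have hG : ∀ x ∈ Icc (0:ℝ) 1, energyFlux γ u x = 0 := fun x hx =>
    le_antisymm (hG0 ▸ hanti (left_mem_Icc.2 zero_le_one) hx hx.1)
      (hG1 ▸ hanti hx (right_mem_Icc.2 zero_le_one) hx.2)
  intro x hx
  rcases hx.1.eq_or_lt with rfl | hx0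
  · exact hu0
  rcases hx.2.eq_or_lt with rfl | hx1
  · exact hu1
  have hzero : HasDerivWithinAt (energyFlux γ u) 0 (Icc 0 1) x :=
    (hasDerivWithinAt_const x _ (0:ℝ)).congr hG (hG x hx)
  have heq := (uniqueDiffOn_Icc zero_lt_one x hx).eq_deriv _ (hderiv x hx) hzero
  have hpos : 0 < 4 * (x * (1 - x)) := by
    have := sub_pos.2 hx1
    positivity
  have h1 : 0 ≤ γ * D 2 u x ^ 2 := by positivity
  have h2 := sq_nonneg (D 1 u x - (1 - 2 * x) * u x)
  have h3 : 0 ≤ 4 * (x * (1 - x)) * u x ^ 2 := by positivity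
  have h4 : 4 * (x * (1 - x)) * u x ^ 2 = 0 := by linarith
  exact pow_eq_zero_iff two_ne_zero |>.1 ((mul_eq_zero.1 h4).resolve_left hpos.ne')

/-- Uniqueness for the EFK boundary value problem: if `u` is four times continuously
differentiable on `[0,1]`, satisfies the Navier boundary conditions and
`γu⁗ − u″ − u = 0` on `[0,1]`, then `u ≡ 0`; consequently, for every continuous `φ`
the problem `γu⁗ − u″ − u = φ` with Navier boundary conditions has at most one
four times continuously differentiable solution. -/
theorem efk_bvp_uniqueness
    (γ : ℝ) (hγ : 0 < γ) (u : ℝ → ℝ)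
    (hu : ContDiffOn ℝ 4 u (Icc 0 1))
    (hu0 : u 0 = 0) (hu1 : u 1 = 0) (hu''0 : D 2 u 0 = 0) (hu''1 : D 2 u 1 = 0)
    (hhom : ∀ x ∈ Icc (0:ℝ) 1, γ * D 4 u x - D 2 u x - u x = 0) :
    (∀ x ∈ Icc (0:ℝ) 1, u x = 0) ∧
    (∀ φ v w : ℝ → ℝ, ContinuousOn φ (Icc 0 1) →
      ContDiffOn ℝ 4 v (Icc 0 1) →
      v 0 = 0 → v 1 = 0 → D 2 v 0 = 0 → D 2 v 1 = 0 →
      (∀ x ∈ Icc (0:ℝ) 1, γ * D 4 v x - D 2 v x - v x = φ x) →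
      ContDiffOn ℝ 4 w (Icc 0 1) →
      w 0 = 0 → w 1 = 0 → D 2 w 0 = 0 → D 2 w 1 = 0 →
      (∀ x ∈ Icc (0:ℝ) 1, γ * D 4 w x - D 2 w x - w x = φ x) →
      ∀ x ∈ Icc (0:ℝ) 1, v x = w x) := by
  refine ⟨eqOn_zero_of_homogeneous hγ hu hu0 hu1 hu''0 hu''1 hhom, ?_⟩
  intro φ v w _ hv hv0 hv1 hv''0 hv''1 hvφ hw hw0 hw1 hw''0 hw''1 hwφ x hx
  have h2 : ∀ y ∈ Icc (0:ℝ) 1, D 2 (v - w) y = D 2 v y - D 2 w y :=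
    fun y hy => D_sub (n := 4) hv hw (by norm_num) hy
  have h4 : ∀ y ∈ Icc (0:ℝ) 1, D 4 (v - w) y = D 4 v y - D 4 w y :=
    fun y hy => D_sub (n := 4) hv hw le_rfl hy
  refine sub_eq_zero.1 (eqOn_zero_of_homogeneous (u := v - w) hγ (hv.sub hw) (by simp [hv0, hw0])
    (by simp [hv1, hw1]) ?_ ?_ (fun y hy => ?_) x hx)
  · rw [h2 0 (by simp), hv''0, hw''0, sub_zero]
  · rw [h2 1 (by simp), hv''1, hw''1, sub_zero]
  · rw [h2 y hy, h4 y hy, Pi.sub_apply]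
    linear_combination hvφ y hy - hwφ y hy
end

section
/- Let n ≥ 1, let τ₁, …, τₙ > 0, set r = max{τ₁,…,τₙ}, and let b₁, …, bₙ > 0. Let ψ : [−r, ∞) → [0, ∞) be continuous and suppose that ψ(t) ≤ ψ(0) + Σ_{k=1}^n bₖ ∫₀ᵗ ψ(s − τₖ) ds for all t ≥ 0. Then for every t ≥ 0, ψ(t) ≤ (max_{s ∈ [−r,0]} ψ(s)) · e^{(Σ_{k=1}^n bₖ) t}. -/
open Real Set

/-- The integral of `B e^{Bs}` over `[0,t]`. -/
theorem integral_mul_exp_mul (B t : ℝ) :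
    ∫ s in (0 : ℝ)..t, B * Real.exp (B * s) = Real.exp (B * t) - 1 := by
  have hderiv : ∀ s ∈ uIcc 0 t, HasDerivAt (fun s => Real.exp (B * s)) (B * Real.exp (B * s)) s := by
    intro s _
    simpa [mul_comm] using ((hasDerivAt_id s).const_mul B).exp
  rw [intervalIntegral.integral_eq_sub_of_hasDerivAt hderiv
    (Continuous.intervalIntegrable (by fun_prop) _ _)]
  simp

/-- Method of steps: an exponential bound propagates along intervals of length `δ`, where `δ` is a
lower bound for the delays. -/
theorem delay_bound_of_le_nat_mul {ι : Type*} [Fintype ι] {τ b : ι → ℝ} {r δ M : ℝ} {ψ : ℝ → ℝ}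
    (hδ : 0 ≤ δ) (hδτ : ∀ k, δ ≤ τ k) (hτr : ∀ k, τ k ≤ r) (hb : ∀ k, 0 ≤ b k)
    (hr : 0 ≤ r) (hM : 0 ≤ M)
    (hψc : ContinuousOn ψ (Ici (-r))) (hψM : ∀ t ∈ Icc (-r) 0, ψ t ≤ M)
    (hineq : ∀ t : ℝ, 0 ≤ t →
      ψ t ≤ ψ 0 + ∑ k, b k * ∫ s in (0:ℝ)..t, ψ (s - τ k)) (m : ℕ) :
    ∀ t ∈ Icc (-r) (m * δ), ψ t ≤ M * Real.exp ((∑ k, b k) * max t 0) := by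
  have hB : 0 ≤ ∑ k, b k := Finset.sum_nonneg fun k _ => hb k
  have hnonpos : ∀ t ∈ Icc (-r) 0, ψ t ≤ M * Real.exp ((∑ k, b k) * max t 0) := by
    intro t ht
    simpa [max_eq_right ht.2] using hψM t ht
  induction m with
  | zero => simpa using hnonpos
  | succ m ih =>
    rintro t ⟨htr, htm⟩
    rcases le_total t 0 with ht | ht
    · exact hnonpos t ⟨htr, ht⟩
    have hint : ∀ k, ∫ s in (0:ℝ)..t, ψ (s - τ k) ≤
        ∫ s in (0:ℝ)..t, M * Real.exp ((∑ k, b k) * s) := by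
      intro k
      refine intervalIntegral.integral_mono_on ht (ContinuousOn.intervalIntegrable ?_)
        (Continuous.intervalIntegrable (by fun_prop) _ _) ?_
      · rw [uIcc_of_le ht]
        refine hψc.comp (by fun_prop) fun s hs => ?_
        have := hτr k
        have := hs.1
        simp only [mem_Ici]
        linarith
      · rintro s ⟨hs0, hst⟩
        have h1 := hδτ k
        have h2 := hτr k
        push_cast at htm
        refine (ih (s - τ k) ⟨by linarith, by linarith⟩).trans ?_
        have : max (s - τ k) 0 ≤ s := max_le (by linarith) hs0
        gcongr
    calc ψ t ≤ ψ 0 + ∑ k, b k * ∫ s in (0:ℝ)..t, ψ (s - τ k) := hineq t ht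
      _ ≤ M + ∑ k, b k * ∫ s in (0:ℝ)..t, M * Real.exp ((∑ k, b k) * s) := by
        gcongr with k
        · exact hψM 0 ⟨by linarith, le_rfl⟩
        · exact hb k
        · exact hint k
      _ = M + M * ∫ s in (0:ℝ)..t, (∑ k, b k) * Real.exp ((∑ k, b k) * s) := by
        rw [← Finset.sum_mul, intervalIntegral.integral_const_mul,
          intervalIntegral.integral_const_mul]
        ring
      _ = M * Real.exp ((∑ k, b k) * max t 0) := by
        rw [integral_mul_exp_mul, max_eq_left ht]
        ring

/-- Bellman–Gronwall type integral inequality with delays: if `ψ ≥ 0` is continuous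
on `[−r,∞)`, `r = max{τ₁,…,τₙ}`, and
`ψ(t) ≤ ψ(0) + Σₖ bₖ ∫₀ᵗ ψ(s − τₖ) ds` for all `t ≥ 0`, then
`ψ(t) ≤ (max_{s ∈ [−r,0]} ψ(s)) · e^{(Σₖ bₖ)t}` for all `t ≥ 0`. -/
theorem bellman_inequality_with_delays
    (n : ℕ) (hn : 1 ≤ n) (τ : Fin n → ℝ) (hτ : ∀ k, 0 < τ k)
    (r : ℝ) (hr : IsGreatest (Set.range τ) r)
    (b : Fin n → ℝ) (hb : ∀ k, 0 < b k)
    (ψ : ℝ → ℝ) (hψc : ContinuousOn ψ (Ici (-r)))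
    (hψ0 : ∀ t ∈ Ici (-r), 0 ≤ ψ t)
    (hineq : ∀ t : ℝ, 0 ≤ t →
      ψ t ≤ ψ 0 + ∑ k, b k * ∫ s in (0:ℝ)..t, ψ (s - τ k)) :
    ∀ t : ℝ, 0 ≤ t →
      ψ t ≤ sSup (ψ '' Icc (-r) 0) * Real.exp ((∑ k, b k) * t) := by
  obtain ⟨⟨k₀, hk₀⟩, hτr⟩ := hr
  have hr0 : 0 < r := hk₀ ▸ hτ k₀
  have : Nonempty (Fin n) := ⟨k₀⟩
  obtain ⟨j, hj⟩ := Finite.exists_min τ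
  have hbdd : BddAbove (ψ '' Icc (-r) 0) :=
    isCompact_Icc.bddAbove_image (hψc.mono Icc_subset_Ici_self)
  have hψM : ∀ t ∈ Icc (-r) 0, ψ t ≤ sSup (ψ '' Icc (-r) 0) := fun t ht =>
    le_csSup hbdd (mem_image_of_mem ψ ht)
  have hM : 0 ≤ sSup (ψ '' Icc (-r) 0) :=
    (hψ0 0 (by simpa using hr0.le)).trans (hψM 0 ⟨by linarith, le_rfl⟩)
  intro t ht
  obtain ⟨m, hm⟩ := exists_nat_ge (t / τ j)
  have := delay_bound_of_le_nat_mul (hτ j).le hj (fun k => hτr (mem_range_self k))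
    (fun k => (hb k).le) hr0.le hM hψc hψM hineq m t
    ⟨by linarith, (div_le_iff₀ (hτ j)).1 hm⟩
  rwa [max_eq_left ht] at this
end
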